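/- arXiv:1105.4159 — 5 statements merged into one kernel-verified Lean document; each statement's English description precedes it below -/
import Mathlib

section
/- Let w ≥ 3 be an odd integer, p ≥ 1, l ≥ 1, and let S ⊆ ℤ^D. Suppose ζ is a path contained in S joining sites u₁ and u_n with d(u₁, u_n) = l·w^p − 1. Then there exist l pairwise disjoint maximal level-p chunks with respect to S, each having a midpoint lying on ζ. -/
namespace BH

/-- Sites of the infinite lattice `ℤ^D`. -/
abbrev ZSite (D : ℕ) := Fin D → ℤ

/-- The `l_∞` distance on `ℤ^D`. -/
def zDist {D : ℕ} (u v : ZSite D) : ℕ :=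
  Finset.univ.sup fun i => (u i - v i).natAbs

/-- A path: a nonempty finite sequence of sites with consecutive `l_∞`
distances equal to 1. -/
def IsPath {D : ℕ} (ζ : List (ZSite D)) : Prop :=
  ζ ≠ [] ∧ ζ.Chain' fun u v => zDist u v = 1

/-- A set of sites is connected if any two of its sites are joined by a path
lying in it. -/
def zConn {D : ℕ} (X : Set (ZSite D)) : Prop :=
  ∀ u ∈ X, ∀ v ∈ X, ∃ ζ : List (ZSite D), IsPath ζ ∧
    ζ.head? = some u ∧ ζ.getLast? = some v ∧ ∀ x ∈ ζ, x ∈ X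

/-- `B_r(A)`: the set of points at `l_∞` distance at most `r` from `A`. -/
def zBall {D : ℕ} (r : ℕ) (A : Set (ZSite D)) : Set (ZSite D) :=
  {v | ∃ u ∈ A, zDist u v ≤ r}

/-- The connected component of `A` inside `X`: all sites reachable from `A`
by a path lying in `X`. -/
def zConnComp {D : ℕ} (X A : Set (ZSite D)) : Set (ZSite D) :=
  {x | ∃ a ∈ A, ∃ ζ : List (ZSite D), IsPath ζ ∧
    ζ.head? = some a ∧ ζ.getLast? = some x ∧ ∀ y ∈ ζ, y ∈ X}

/-- `C` is a maximal level-`p` chunk with respect to `S`, with midpoint `m`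
(for a fixed odd width `w`): `C ⊆ S` is a connected set of diameter `< w^p`,
and there are a connected `C° ⊆ C` and a path `ζ = (u₁,…,m,…,u_n) ⊆ C°` with
(i) `d(u₁,u_n) = w^p − w^{p−1}`;
(ii) `d(u₁,m), d(u_n,m) ≥ (w^p − w^{p−1})/2`;
(iii) `C°` contains the connected component of `m` in
      `B_{(w^p − w^{p−1})/2}(m) ∩ S`;
(iv) `C` contains the connected component of `C°` in
     `B_{w^{p−1}/2}(C°) ∩ S`. -/
def IsMaxChunk {D : ℕ} (w p : ℕ) (S C : Set (ZSite D)) (m : ZSite D) : Prop :=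
  C ⊆ S ∧ zConn C ∧ (∀ u ∈ C, ∀ v ∈ C, zDist u v < w ^ p) ∧
  ∃ C₀ : Set (ZSite D), C₀ ⊆ C ∧ zConn C₀ ∧
    ∃ (ζ : List (ZSite D)) (u₁ un : ZSite D),
      IsPath ζ ∧ (∀ x ∈ ζ, x ∈ C₀) ∧
      ζ.head? = some u₁ ∧ ζ.getLast? = some un ∧ m ∈ ζ ∧
      zDist u₁ un = w ^ p - w ^ (p - 1) ∧
      (w ^ p - w ^ (p - 1)) / 2 ≤ zDist u₁ m ∧
      (w ^ p - w ^ (p - 1)) / 2 ≤ zDist un m ∧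
      zConnComp (zBall ((w ^ p - w ^ (p - 1)) / 2) {m} ∩ S) {m} ⊆ C₀ ∧
      zConnComp (zBall (w ^ (p - 1) / 2) (C₀ : Set (ZSite D)) ∩ S) C₀ ⊆ C

end BH

namespace BH

section Helpers

variable {D : ℕ}

lemma zd_le {u v : ZSite D} {n : ℕ} : zDist u v ≤ n ↔ ∀ i, (u i - v i).natAbs ≤ n := by
  unfold zDist
  simp [Finset.sup_le_iff]

lemma zd_self (u : ZSite D) : zDist u u = 0 := by
  have : zDist u u ≤ 0 := zd_le.2 (by simp)
  omega

lemma zd_comm (u v : ZSite D) : zDist u v = zDist v u := by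
  apply le_antisymm
  · refine zd_le.2 fun i => ?_
    have := zd_le.1 (le_refl (zDist v u)) i
    omega
  · refine zd_le.2 fun i => ?_
    have := zd_le.1 (le_refl (zDist u v)) i
    omega

lemma zd_tri (u v w : ZSite D) : zDist u w ≤ zDist u v + zDist v w := by
  refine zd_le.2 fun i => ?_
  have h1 := zd_le.1 (le_refl (zDist u v)) i
  have h2 := zd_le.1 (le_refl (zDist v w)) i
  omega

lemma zd_eq {u v : ZSite D} (h : zDist u v = 0) : u = v := by
  funext i
  have := zd_le.1 h.le i
  omega

/-- One step inside `X`. -/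
def Step (X : Set (ZSite D)) (a b : ZSite D) : Prop := zDist a b ≤ 1 ∧ a ∈ X ∧ b ∈ X

/-- Reachability inside `X`. -/
def Conn (X : Set (ZSite D)) (u v : ZSite D) : Prop :=
  u ∈ X ∧ Relation.ReflTransGen (Step X) u v

lemma Conn.refl {X : Set (ZSite D)} {u : ZSite D} (h : u ∈ X) : Conn X u u := ⟨h, .refl⟩

lemma Conn.right {X : Set (ZSite D)} {u v : ZSite D} (h : Conn X u v) : v ∈ X := by
  obtain ⟨hu, h⟩ := h
  induction h with
  | refl => exact hu
  | tail _ h _ => exact h.2.2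

lemma Conn.trans {X : Set (ZSite D)} {u v w : ZSite D} (h : Conn X u v) (h' : Conn X v w) :
    Conn X u w := ⟨h.1, h.2.trans h'.2⟩

lemma Conn.symm {X : Set (ZSite D)} {u v : ZSite D} (h : Conn X u v) : Conn X v u := by
  refine ⟨h.right, ?_⟩
  have := h.2
  clear h
  induction this with
  | refl => exact .refl
  | tail _ h ih => exact .head ⟨by rw [zd_comm]; exact h.1, h.2.2, h.2.1⟩ ih

lemma Conn.mono {X Y : Set (ZSite D)} (hXY : X ⊆ Y) {u v : ZSite D} (h : Conn X u v) :
    Conn Y u v :=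
  ⟨hXY h.1, Relation.ReflTransGen.mono (fun _ _ s => ⟨s.1, hXY s.2.1, hXY s.2.2⟩) _ _ h.2⟩

lemma Conn.step {X : Set (ZSite D)} {u v : ZSite D} (hu : u ∈ X) (hv : v ∈ X)
    (h : zDist u v ≤ 1) : Conn X u v := ⟨hu, .single ⟨h, hu, hv⟩⟩

/-- The component is connected within itself. -/
lemma Conn.self {X : Set (ZSite D)} {u v : ZSite D} (h : Conn X u v) :
    Conn {y | Conn X u y} u v := by
  have hu := h.1
  refine ⟨Conn.refl hu, ?_⟩
  have h2 := h.2
  clear h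
  induction h2 with
  | refl => exact .refl
  | tail h1 h ih => exact ih.tail ⟨h.1, ⟨hu, h1⟩, ⟨hu, h1.tail h⟩⟩

lemma Conn.fn {X : Set (ZSite D)} {u v : ZSite D} (h : Conn X u v) :
    ∃ (n : ℕ) (p : ℕ → ZSite D), p 0 = u ∧ p n = v ∧ (∀ k, p k ∈ X) ∧
      ∀ k, zDist (p k) (p (k + 1)) ≤ 1 := by
  obtain ⟨hu, h⟩ := h
  induction h with
  | refl => exact ⟨0, fun _ => u, rfl, rfl, fun _ => hu, fun _ => by simp [zd_self]⟩
  | @tail b c _ h ih =>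
    obtain ⟨n, p, h0, hn, hX, hs⟩ := ih
    refine ⟨n + 1, fun k => if k ≤ n then p k else c, by simp [h0], by simp, ?_, ?_⟩
    · intro k
      dsimp only
      split_ifs
      · exact hX k
      · exact h.2.2
    · intro k
      dsimp only
      split_ifs with h1 h2 h2
      · exact hs k
      · have : k = n := by omega
        subst this
        rw [hn]; exact h.1
      · omega
      · simp [zd_self]

lemma fn_conn {X : Set (ZSite D)} (p : ℕ → ZSite D) (n : ℕ) (hX : ∀ k ≤ n, p k ∈ X)
    (hs : ∀ k, zDist (p k) (p (k + 1)) ≤ 1) : ∀ k ≤ n, Conn X (p 0) (p k) := by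
  intro k
  induction k with
  | zero => intro h; exact Conn.refl (hX 0 h)
  | succ k ih =>
    intro h
    exact (ih (by omega)).trans (Conn.step (hX _ (by omega)) (hX _ h) (hs k))

/-- Extending list paths. -/
lemma Conn.list {X : Set (ZSite D)} {m v : ZSite D} (h : Conn X m v) {ζ : List (ZSite D)}
    {u : ZSite D} (hp : IsPath ζ) (hh : ζ.head? = some u) (hl : ζ.getLast? = some m)
    (hX : ∀ x ∈ ζ, x ∈ X) :
    ∃ ξ : List (ZSite D), IsPath ξ ∧ ξ.head? = some u ∧ ξ.getLast? = some v ∧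
      (∀ x ∈ ξ, x ∈ X) ∧ ∀ x ∈ ζ, x ∈ ξ := by
  obtain ⟨_, h⟩ := h
  induction h with
  | refl => exact ⟨ζ, hp, hh, hl, hX, fun _ h => h⟩
  | @tail b c _ h ih =>
    obtain ⟨ξ, h1, h2, h3, h4, h5⟩ := ih
    by_cases h0 : zDist b c = 0
    · rw [← zd_eq h0]; exact ⟨ξ, h1, h2, h3, h4, h5⟩
    · refine ⟨ξ ++ [c], ⟨by simp, ?_⟩, ?_, by simp, ?_, ?_⟩
      · have h12 := h1.2
        unfold List.Chain' at h12 ⊢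
        rw [List.isChain_append]
        refine ⟨h12, by simp, ?_⟩
        intro x hx y hy
        rw [h3] at hx
        simp at hx hy
        subst hx; subst hy
        have := h.1
        omega
      · rw [List.head?_append, h2]; rfl
      · intro x hx
        rcases List.mem_append.1 hx with hx | hx
        · exact h4 x hx
        · simp at hx; subst hx; exact h.2.2
      · intro x hx
        exact List.mem_append_left _ (h5 x hx)

lemma Conn.list' {X : Set (ZSite D)} {u v : ZSite D} (h : Conn X u v) :
    ∃ ξ : List (ZSite D), IsPath ξ ∧ ξ.head? = some u ∧ ξ.getLast? = some v ∧
      (∀ x ∈ ξ, x ∈ X) := by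
  obtain ⟨ξ, h1, h2, h3, h4, _⟩ := h.list (ζ := [u]) (u := u) ⟨by simp, by simp [List.Chain']⟩
    (by simp) (by simp) (by simpa using h.1)
  exact ⟨ξ, h1, h2, h3, h4⟩

lemma conn_of_list {X : Set (ZSite D)} : ∀ {ξ : List (ZSite D)} {u v : ZSite D}, IsPath ξ →
    ξ.head? = some u → ξ.getLast? = some v → (∀ x ∈ ξ, x ∈ X) → Conn X u v
  | [], _, _, h, _, _, _ => absurd rfl h.1
  | [a], u, v, _, hu, hv, hX => by
    simp at hu hv
    subst hu; subst hv
    exact Conn.refl (hX _ (by simp))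
  | a :: b :: l, u, v, h, hu, hv, hX => by
    simp at hu
    subst hu
    have hc := h.2
    unfold List.Chain' at hc
    rw [List.isChain_cons_cons] at hc
    have h2 : Conn X b v := conn_of_list (ξ := b :: l) ⟨by simp, hc.2⟩ (by simp)
      (by simpa using hv) (fun x hx => hX x (List.mem_cons_of_mem _ hx))
    exact (Conn.step (hX _ (by simp)) (hX _ (by simp)) hc.1.le).trans h2

lemma zConn_iff {X : Set (ZSite D)} : zConn X ↔ ∀ u ∈ X, ∀ v ∈ X, Conn X u v := by
  constructor
  · intro h u hu v hv
    obtain ⟨ξ, h1, h2, h3, h4⟩ := h u hu v hv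
    exact conn_of_list h1 h2 h3 h4
  · intro h u hu v hv
    exact (h u hu v hv).list'

lemma mem_comp_iff {X A : Set (ZSite D)} {x : ZSite D} :
    x ∈ zConnComp X A ↔ ∃ a ∈ A, Conn X a x := by
  constructor
  · rintro ⟨a, ha, ξ, h1, h2, h3, h4⟩
    exact ⟨a, ha, conn_of_list h1 h2 h3 h4⟩
  · rintro ⟨a, ha, h⟩
    exact ⟨a, ha, h.list'⟩

/-- The component of `m` in `B_r(m) ∩ S`. -/
def KK (S : Set (ZSite D)) (r : ℕ) (m : ZSite D) : Set (ZSite D) :=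
  {x | Conn (zBall r {m} ∩ S) m x}

lemma KK_dist {S : Set (ZSite D)} {r : ℕ} {m x : ZSite D} (h : x ∈ KK S r m) :
    zDist m x ≤ r := by
  have := (Conn.right h).1
  simpa [zBall] using this

lemma KK_sub {S : Set (ZSite D)} {r : ℕ} {m x : ZSite D} (h : x ∈ KK S r m) : x ∈ S :=
  (Conn.right h).2

lemma mem_KK_of_near {S : Set (ZSite D)} {r : ℕ} (hr : 1 ≤ r) {m x : ZSite D} (hm : m ∈ S)
    (hx : x ∈ S) (h : zDist m x ≤ 1) : x ∈ KK S r m := by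
  refine Conn.step ⟨?_, hm⟩ ⟨?_, hx⟩ h
  · simp [zBall, zd_self]
  · simp [zBall]; omega

lemma KK_conn {S : Set (ZSite D)} {r : ℕ} {m x : ZSite D} (h : x ∈ KK S r m) :
    Conn (KK S r m) m x := Conn.self h

/-- Both points are at distance at least `r` from some site of the window. -/
def Good (z : ℕ → ZSite D) (r a b : ℕ) (x y : ZSite D) : Prop :=
  ∃ t, a ≤ t ∧ t ≤ b ∧ r ≤ zDist x (z t) ∧ r ≤ zDist y (z t)

lemma Good.symm {z : ℕ → ZSite D} {r a b : ℕ} {x y : ZSite D} (h : Good z r a b x y) :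
    Good z r a b y x := by
  obtain ⟨t, h1, h2, h3, h4⟩ := h
  exact ⟨t, h1, h2, h4, h3⟩

lemma no_switch {z : ℕ → ZSite D} (hz : ∀ t, zDist (z t) (z (t + 1)) ≤ 1) {r a b : ℕ}
    {x y : ZSite D} (hxy : 2 * r ≤ zDist x y) (hg : ¬ Good z r a b x y)
    (h0 : zDist x (z a) < r) : ∀ t, a ≤ t → t ≤ b → zDist x (z t) < r := by
  intro t hat
  induction t, hat using Nat.le_induction with
  | base => intro _; exact h0
  | succ t hat ih =>
    intro htb
    have h1 := ih (by omega)
    by_contra hcon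
    apply hg
    refine ⟨t + 1, by omega, htb, by omega, ?_⟩
    have h2 := zd_tri x (z t) (z (t+1))
    have h3 := zd_tri x (z t) y
    have h4 := zd_tri (z t) (z (t+1)) y
    have h5 := hz t
    have h6 := zd_comm y (z (t+1))
    omega

lemma not_good_cases {z : ℕ → ZSite D} (hz : ∀ t, zDist (z t) (z (t + 1)) ≤ 1) {r a b : ℕ}
    (hab : a ≤ b) {x y : ZSite D} (hxy : 2 * r ≤ zDist x y) (hg : ¬ Good z r a b x y) :
    (∀ t, a ≤ t → t ≤ b → zDist x (z t) < r) ∨ (∀ t, a ≤ t → t ≤ b → zDist y (z t) < r) := by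
  by_cases h : zDist x (z a) < r
  · exact Or.inl (no_switch hz hxy hg h)
  · refine Or.inr (no_switch hz (by rwa [zd_comm]) (fun h => hg h.symm) ?_)
    by_contra h'
    exact hg ⟨a, le_refl _, hab, by omega, by omega⟩

/-- Within distance `r + 1` of the window. -/
def Near (z : ℕ → ZSite D) (r a b : ℕ) (x : ZSite D) : Prop :=
  ∃ t, a ≤ t ∧ t ≤ b ∧ zDist x (z t) ≤ r + 1

lemma not_good_le {z : ℕ → ZSite D} (hz : ∀ t, zDist (z t) (z (t + 1)) ≤ 1) {r a b : ℕ}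
    (hab : a ≤ b) {x y : ZSite D} (hx : Near z r a b x) (hy : Near z r a b y)
    (hg : ¬ Good z r a b x y) : zDist x y ≤ 2 * r := by
  by_contra hcon
  obtain ⟨s, hs1, hs2, hs⟩ := hx
  obtain ⟨t, ht1, ht2, ht⟩ := hy
  rcases not_good_cases hz hab (by omega) hg with h | h
  · have h1 := h t ht1 ht2
    have h2 := zd_tri x (z t) y
    have h3 := zd_comm y (z t)
    omega
  · have h1 := h s hs1 hs2
    have h2 := zd_tri x (z s) y
    have h3 := zd_comm y (z s)
    omega

lemma jump {z : ℕ → ZSite D} (hz : ∀ t, zDist (z t) (z (t + 1)) ≤ 1) {r a b : ℕ}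
    (hab : a ≤ b) {x x' y : ZSite D} (hxy : 2 * r + 1 ≤ zDist x y) (hg : Good z r a b x y)
    (hxx : zDist x' x ≤ 1) (hg' : ¬ (Good z r a b x' y ∧ 2 * r ≤ zDist x' y)) :
    (∀ t, a ≤ t → t ≤ b → zDist x (z t) ≤ r) ∧
      (∀ t, a ≤ t → t ≤ b → r + 1 ≤ zDist y (z t)) := by
  have h1 := zd_tri x x' y
  have h2 := zd_comm x x'
  have h3 : 2 * r ≤ zDist x' y := by omega
  have h4 : ¬ Good z r a b x' y := fun h => hg' ⟨h, h3⟩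
  rcases not_good_cases hz hab h3 h4 with h | h
  · have key : ∀ t, a ≤ t → t ≤ b → zDist x (z t) ≤ r := by
      intro t h5 h6
      have h7 := h t h5 h6
      have h8 := zd_tri x x' (z t)
      omega
    refine ⟨key, fun t h5 h6 => ?_⟩
    have h7 := key t h5 h6
    have h8 := zd_tri x (z t) y
    have h9 := zd_comm y (z t)
    omega
  · obtain ⟨t, h5, h6, _, h7⟩ := hg
    have := h t h5 h6
    omega

/-- `A` contains a good pair at distance at least `2r`. -/
def Hot (z : ℕ → ZSite D) (r a b : ℕ) (A : Set (ZSite D)) : Prop :=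
  ∃ x ∈ A, ∃ y ∈ A, Good z r a b x y ∧ 2 * r ≤ zDist x y

/-- A solution: the core of a chunk. -/
def Sol (S X : Set (ZSite D)) (r : ℕ) (m : ZSite D) : Prop :=
  ∃ C : Set (ZSite D), C ⊆ X ∧ (∀ u ∈ C, ∀ v ∈ C, Conn C u v) ∧ KK S r m ⊆ C ∧
    (∀ u ∈ C, ∀ v ∈ C, zDist u v ≤ 2 * r) ∧
    ∃ x ∈ C, ∃ y ∈ C, zDist x y = 2 * r ∧ r ≤ zDist x m ∧ r ≤ zDist y m

/-- Main extension lemma. -/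
lemma extend {z : ℕ → ZSite D} (hz : ∀ t, zDist (z t) (z (t + 1)) ≤ 1) {r a b : ℕ}
    (hr : 1 ≤ r) (hab : a ≤ b) {S X A : Set (ZSite D)} (hAX : A ⊆ X)
    (hAc : ∀ u ∈ A, ∀ v ∈ A, Conn A u v)
    (hAK : ∀ t, a ≤ t → t ≤ b → KK S r (z t) ⊆ A)
    (hAn : ∀ x ∈ A, ∃ t, a ≤ t ∧ t ≤ b ∧ zDist x (z t) ≤ r)
    (hA : ¬ Hot z r a b A)
    (p q : ℕ → ZSite D) (M N : ℕ)
    (hp0 : p 0 ∈ A) (hq0 : q 0 ∈ A)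
    (hps : ∀ k, zDist (p k) (p (k + 1)) ≤ 1) (hqs : ∀ k, zDist (q k) (q (k + 1)) ≤ 1)
    (hpX : ∀ k ≤ M, p k ∈ X) (hqX : ∀ k ≤ N, q k ∈ X)
    (hpn : ∀ k ≤ M, Near z r a b (p k)) (hqn : ∀ k ≤ N, Near z r a b (q k))
    (hpp : ∀ k ≤ M, ∀ j ≤ M, zDist (p k) (p j) ≤ 2 * r)
    (hqq : ∀ k ≤ N, ∀ j ≤ N, zDist (q k) (q j) ≤ 2 * r)
    (hot : Hot z r a b (A ∪ {x | ∃ k ≤ M, x = p k} ∪ {x | ∃ k ≤ N, x = q k})) :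
    ∃ t, a ≤ t ∧ t ≤ b ∧ Sol S X r (z t) := by
  classical
  set E : ℕ → ℕ → Set (ZSite D) := fun i j =>
    A ∪ {x | ∃ k ≤ i, x = p k} ∪ {x | ∃ k ≤ j, x = q k} with hE
  -- a minimal hot pair of indices
  have hex : ∃ s, ∃ i j, i ≤ M ∧ j ≤ N ∧ i + j = s ∧ Hot z r a b (E i j) :=
    ⟨M + N, M, N, le_rfl, le_rfl, rfl, hot⟩
  obtain ⟨i, j, hiM, hjN, hij, hh⟩ := Nat.find_spec hex
  have hmin : ∀ i' j', i' ≤ M → j' ≤ N → i' + j' < i + j → ¬ Hot z r a b (E i' j') := by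
    intro i' j' h1 h2 h3 h4
    exact Nat.find_min hex (m := i' + j') (by omega) ⟨i', j', h1, h2, rfl, h4⟩
  -- dichotomy of members
  have memE : ∀ x, x ∈ E i j ↔ (x ∈ A ∨ (∃ k ≤ i, x = p k)) ∨ (∃ k ≤ j, x = q k) := by
    intro x; rfl
  have hpi : i ≠ 0 → ∀ x ∈ E i j, x ∈ E (i - 1) j ∨ x = p i := by
    rintro hi x ((hx | ⟨k, hk, rfl⟩) | hx)
    · exact Or.inl (Or.inl (Or.inl hx))
    · rcases Nat.lt_or_ge k i with h | h
      · exact Or.inl (Or.inl (Or.inr ⟨k, by omega, rfl⟩))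
      · exact Or.inr (by rw [le_antisymm hk h])
    · exact Or.inl (Or.inr hx)
  have hqj : j ≠ 0 → ∀ x ∈ E i j, x ∈ E i (j - 1) ∨ x = q j := by
    rintro hi x ((hx | hx) | ⟨k, hk, rfl⟩)
    · exact Or.inl (Or.inl (Or.inl hx))
    · exact Or.inl (Or.inl (Or.inr hx))
    · rcases Nat.lt_or_ge k j with h | h
      · exact Or.inl (Or.inr ⟨k, by omega, rfl⟩)
      · exact Or.inr (by rw [le_antisymm hk h])
  have hpp' : i ≠ 0 → zDist (p (i - 1)) (p i) ≤ 1 := by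
    intro hi
    have := hps (i - 1)
    rwa [Nat.sub_add_cancel (by omega)] at this
  have hqq' : j ≠ 0 → zDist (q (j - 1)) (q j) ≤ 1 := by
    intro hj
    have := hqs (j - 1)
    rwa [Nat.sub_add_cancel (by omega)] at this
  have hA' : ∀ y ∈ A, ¬ ∀ t, a ≤ t → t ≤ b → r + 1 ≤ zDist y (z t) := by
    intro y hy h
    obtain ⟨t, h1, h2, h3⟩ := hAn y hy
    have := h t h1 h2
    omega
  -- hot pairs have distance exactly `2r`
  have key : ∀ x ∈ E i j, ∀ y ∈ E i j, Good z r a b x y → zDist x y ≤ 2 * r := by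
    intro x hx y hy hg
    by_contra hcon
    have hcon : 2 * r + 1 ≤ zDist x y := by omega
    by_cases hi : i = 0
    · by_cases hj : j = 0
      · subst hi; subst hj
        have hsub : ∀ x ∈ E 0 0, x ∈ A := by
          rintro x ((hx | ⟨k, hk, rfl⟩) | ⟨k, hk, rfl⟩)
          · exact hx
          · rw [Nat.le_zero.1 hk]; exact hp0
          · rw [Nat.le_zero.1 hk]; exact hq0
        exact hA ⟨x, hsub x hx, y, hsub y hy, hg, by omega⟩
      · -- only q moves
        have hcold := hmin i (j - 1) hiM (by omega) (by omega)
        have sub : ∀ x ∈ E i j, x ∈ A ∨ ∃ k ≤ j, x = q k := by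
          rintro x ((hx | ⟨k, hk, rfl⟩) | hx)
          · exact Or.inl hx
          · have : k = 0 := by omega
            rw [this]; exact Or.inl hp0
          · exact Or.inr hx
        have main : ∀ y ∈ E i j, y ∈ E i (j - 1) → Good z r a b (q j) y →
            2 * r + 1 ≤ zDist (q j) y → False := by
          intro y hy hy' hg hcon
          have := jump hz hab hcon hg (hqq' hj)
            (fun h => hcold ⟨_, Or.inr ⟨j - 1, le_rfl, rfl⟩, y, hy', h.1, h.2⟩)
          rcases sub y hy with h | ⟨k, hk, rfl⟩
          · exact hA' y h this.2
          · have := hqq j hjN k (by omega)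
            omega
        rcases hqj hj x hx with h1 | rfl
        · rcases hqj hj y hy with h2 | rfl
          · exact hcold ⟨x, h1, y, h2, hg, by omega⟩
          · exact main x hx h1 hg.symm (by rw [zd_comm]; exact hcon)
        · rcases hqj hj y hy with h2 | rfl
          · exact main y hy h2 hg hcon
          · rw [zd_self] at hcon; omega
    · have hcold := hmin (i - 1) j (by omega) hjN (by omega)
      by_cases hj : j = 0
      · have sub : ∀ x ∈ E i j, x ∈ A ∨ ∃ k ≤ i, x = p k := by
          rintro x ((hx | hx) | ⟨k, hk, rfl⟩)
          · exact Or.inl hx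
          · exact Or.inr hx
          · have : k = 0 := by omega
            rw [this]; exact Or.inl hq0
        have main : ∀ y ∈ E i j, y ∈ E (i - 1) j → Good z r a b (p i) y →
            2 * r + 1 ≤ zDist (p i) y → False := by
          intro y hy hy' hg hcon
          have := jump hz hab hcon hg (hpp' hi)
            (fun h => hcold ⟨_, Or.inl (Or.inr ⟨i - 1, le_rfl, rfl⟩), y, hy', h.1, h.2⟩)
          rcases sub y hy with h | ⟨k, hk, rfl⟩
          · exact hA' y h this.2
          · have := hpp i hiM k (by omega)
            omega
        rcases hpi hi x hx with h1 | rfl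
        · rcases hpi hi y hy with h2 | rfl
          · exact hcold ⟨x, h1, y, h2, hg, by omega⟩
          · exact main x hx h1 hg.symm (by rw [zd_comm]; exact hcon)
        · rcases hpi hi y hy with h2 | rfl
          · exact main y hy h2 hg hcon
          · rw [zd_self] at hcon; omega
      · have hcold2 := hmin i (j - 1) hiM (by omega) (by omega)
        have main : Good z r a b (p i) (q j) → 2 * r + 1 ≤ zDist (p i) (q j) → False := by
          intro hg hcon
          have h1 := jump hz hab hcon hg (hpp' hi)
            (fun h => hcold ⟨_, Or.inl (Or.inr ⟨i - 1, le_rfl, rfl⟩), _,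
              Or.inr ⟨j, le_rfl, rfl⟩, h.1, h.2⟩)
          have h2 := jump hz hab (by rw [zd_comm]; exact hcon) hg.symm (hqq' hj)
            (fun h => hcold2 ⟨_, Or.inr ⟨j - 1, le_rfl, rfl⟩, _,
              Or.inl (Or.inr ⟨i, le_rfl, rfl⟩), h.1, h.2⟩)
          have h3 := h1.1 a le_rfl hab
          have h4 := h2.2 a le_rfl hab
          omega
        have hc' : 2 * r ≤ zDist x y := by omega
        rcases hpi hi x hx with h1 | h1
        · rcases hpi hi y hy with h2 | h2
          · exact hcold ⟨x, h1, y, h2, hg, hc'⟩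
          · rcases hqj hj x hx with h3 | h3
            · rcases hqj hj y hy with h4 | h4
              · exact hcold2 ⟨x, h3, y, h4, hg, hc'⟩
              · exact hcold ⟨x, h1, y, h4 ▸ Or.inr ⟨j, le_rfl, rfl⟩, hg, hc'⟩
            · subst h2; subst h3
              exact main hg.symm (by rw [zd_comm]; exact hcon)
        · rcases hqj hj y hy with h4 | h4
          · rcases hqj hj x hx with h3 | h3
            · exact hcold2 ⟨x, h3, y, h4, hg, hc'⟩
            · rcases hpi hi y hy with h2 | h2
              · exact hcold ⟨x, h3 ▸ Or.inr ⟨j, le_rfl, rfl⟩, y, h2, hg, hc'⟩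
              · rw [h1, h2, zd_self] at hcon; omega
          · subst h1; subst h4
            exact main hg hcon
  -- assemble
  obtain ⟨x, hx, y, hy, ⟨t, ht1, ht2, ht3, ht4⟩, hxy⟩ := hh
  have hnear : ∀ x ∈ E i j, Near z r a b x := by
    rintro x ((hx | ⟨k, hk, rfl⟩) | ⟨k, hk, rfl⟩)
    · obtain ⟨t, h1, h2, h3⟩ := hAn x hx
      exact ⟨t, h1, h2, by omega⟩
    · exact hpn k (by omega)
    · exact hqn k (by omega)
  have hAE : A ⊆ E i j := fun x hx => Or.inl (Or.inl hx)
  have hcen : ∀ u ∈ E i j, Conn (E i j) (p 0) u := by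
    rintro x ((hx | ⟨k, hk, rfl⟩) | ⟨k, hk, rfl⟩)
    · exact (hAc _ hp0 _ hx).mono hAE
    · exact fn_conn p i (fun k hk => Or.inl (Or.inr ⟨k, hk, rfl⟩)) hps k hk
    · exact ((hAc _ hp0 _ hq0).mono hAE).trans
        (fn_conn q j (fun k hk => Or.inr ⟨k, hk, rfl⟩) hqs k hk)
  refine ⟨t, ht1, ht2, E i j, ?_, ?_, (hAK t ht1 ht2).trans hAE, ?_, x, hx, y, hy, ?_, ht3, ht4⟩
  · rintro x ((hx | ⟨k, hk, rfl⟩) | ⟨k, hk, rfl⟩)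
    · exact hAX hx
    · exact hpX k (by omega)
    · exact hqX k (by omega)
  · intro u hu v hv
    exact (hcen u hu).symm.trans (hcen v hv)
  · intro u hu v hv
    by_cases hg : Good z r a b u v
    · exact key u hu v hv hg
    · exact not_good_le hz hab (hnear u hu) (hnear v hv) hg
  · exact le_antisymm (key x hx y hy ⟨t, ht1, ht2, ht3, ht4⟩) hxy

/-- Union of the components along a window. -/
def AA (S : Set (ZSite D)) (r : ℕ) (z : ℕ → ZSite D) (a b : ℕ) : Set (ZSite D) :=
  {x | ∃ t, a ≤ t ∧ t ≤ b ∧ x ∈ KK S r (z t)}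

lemma AA_conn {z : ℕ → ZSite D} (hz : ∀ t, zDist (z t) (z (t + 1)) ≤ 1) {r a b : ℕ}
    {S : Set (ZSite D)} (hzS : ∀ t, z t ∈ S) (hr : 1 ≤ r) :
    ∀ u ∈ AA S r z a b, ∀ v ∈ AA S r z a b, Conn (AA S r z a b) u v := by
  have hzK : ∀ t, z t ∈ KK S r (z t) := fun t =>
    mem_KK_of_near hr (hzS t) (hzS t) (by rw [zd_self]; omega)
  have h1 : ∀ t, a ≤ t → t ≤ b → Conn (AA S r z a b) (z a) (z t) := by
    intro t hat
    induction t, hat using Nat.le_induction with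
    | base => intro h; exact Conn.refl ⟨a, le_rfl, h, hzK a⟩
    | succ t hat ih =>
      intro h
      exact (ih (by omega)).trans (Conn.step ⟨t, hat, by omega, hzK t⟩
        ⟨t + 1, by omega, h, hzK _⟩ (hz t))
  have h2 : ∀ u ∈ AA S r z a b, Conn (AA S r z a b) (z a) u := by
    rintro u ⟨t, h3, h4, h5⟩
    exact (h1 t h3 h4).trans ((KK_conn h5).mono (Y := AA S r z a b) fun x hx => ⟨t, h3, h4, hx⟩)
  intro u hu v hv
  exact (h2 u hu).symm.trans (h2 v hv)

lemma claim1 {z : ℕ → ZSite D} (hz : ∀ t, zDist (z t) (z (t + 1)) ≤ 1) {r a : ℕ}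
    {S X : Set (ZSite D)} (hzS : ∀ t, z t ∈ S) (hr : 1 ≤ r) (b : ℕ) (hab : a ≤ b) :
    (∀ t, a ≤ t → t ≤ b → KK S r (z t) ⊆ X) →
    (∃ t, a ≤ t ∧ t ≤ b ∧ Sol S X r (z t)) ∨ ¬ Hot z r a b (AA S r z a b) := by
  -- finishing step
  have fin : ∀ b, (∀ t, a ≤ t → t ≤ b → KK S r (z t) ⊆ X) →
      (∀ u ∈ AA S r z a b, ∀ v ∈ AA S r z a b, zDist u v ≤ 2 * r) →
      (∃ t, a ≤ t ∧ t ≤ b ∧ Sol S X r (z t)) ∨ ¬ Hot z r a b (AA S r z a b) := by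
    intro b hX hd
    by_cases hh : Hot z r a b (AA S r z a b)
    · left
      obtain ⟨x, hx, y, hy, ⟨t, ht1, ht2, ht3, ht4⟩, hxy⟩ := hh
      refine ⟨t, ht1, ht2, AA S r z a b, ?_, AA_conn hz hzS hr,
        fun u hu => ⟨t, ht1, ht2, hu⟩, hd, x, hx, y, hy, le_antisymm (hd x hx y hy) hxy, ht3, ht4⟩
      rintro u ⟨s, h1, h2, h3⟩
      exact hX s h1 h2 h3
    · exact Or.inr hh
  induction b, hab using Nat.le_induction with
  | base =>
    intro hX
    refine fin a hX ?_
    rintro u ⟨s, h1, h2, h3⟩ v ⟨t, h4, h5, h6⟩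
    have hs : s = a := by omega
    have ht : t = a := by omega
    subst hs
    subst ht
    have h7 := KK_dist h3
    have h8 := KK_dist h6
    have h9 := zd_tri u (z t) v
    have h10 := zd_comm u (z t)
    omega
  | succ b hab ih =>
    intro hX
    rcases ih (fun t h1 h2 => hX t h1 (by omega)) with ⟨t, h1, h2, h3⟩ | hcold
    · exact Or.inl ⟨t, h1, by omega, h3⟩
    have hAn : ∀ x ∈ AA S r z a b, ∃ t, a ≤ t ∧ t ≤ b ∧ zDist x (z t) ≤ r := by
      rintro x ⟨t, h1, h2, h3⟩
      exact ⟨t, h1, h2, by rw [zd_comm]; exact KK_dist h3⟩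
    have hAX : AA S r z a b ⊆ X := by
      rintro x ⟨t, h1, h2, h3⟩
      exact hX t h1 (by omega) h3
    have hNb : ∀ x ∈ KK S r (z (b + 1)), Near z r a b x := by
      intro x hx
      refine ⟨b, hab, le_rfl, ?_⟩
      have h1 := KK_dist hx
      have h2 := hz b
      have h3 := zd_tri (z b) (z (b + 1)) x
      have h4 := zd_comm x (z b)
      omega
    have hN : ∀ x ∈ AA S r z a (b + 1), Near z r a b x := by
      rintro x ⟨t, h1, h2, h3⟩
      rcases Nat.lt_or_ge b t with h | h
      · have : t = b + 1 := by omega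
        subst this
        exact hNb x h3
      · exact ⟨t, h1, h, by have := KK_dist h3; rw [zd_comm]; omega⟩
    have hpath : ∀ x ∈ AA S r z a (b + 1), ∃ (p : ℕ → ZSite D) (M : ℕ), p 0 ∈ AA S r z a b ∧
        (∀ k, zDist (p k) (p (k + 1)) ≤ 1) ∧ (∀ k ≤ M, p k ∈ X) ∧
        (∀ k ≤ M, Near z r a b (p k)) ∧ (∀ k ≤ M, ∀ j ≤ M, zDist (p k) (p j) ≤ 2 * r) ∧
        p M = x := by
      rintro x ⟨t, h1, h2, h3⟩
      rcases Nat.lt_or_ge b t with h | h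
      · have : t = b + 1 := by omega
        subst this
        obtain ⟨n, p, hp0, hpn, hpK, hps⟩ := (KK_conn h3).fn
        refine ⟨p, n, ?_, hps, fun k _ => hX _ h1 h2 (hpK k), fun k _ => hNb _ (hpK k), ?_, hpn⟩
        · rw [hp0]
          exact ⟨b, hab, le_rfl, mem_KK_of_near hr (hzS _) (hzS _) (hz b)⟩
        · intro k _ j _
          have h7 := KK_dist (hpK k)
          have h8 := KK_dist (hpK j)
          have h9 := zd_tri (p k) (z (b + 1)) (p j)
          have h10 := zd_comm (p k) (z (b + 1))
          omega
      · have hx : x ∈ AA S r z a b := ⟨t, h1, h, h3⟩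
        refine ⟨fun _ => x, 0, hx, ?_, fun _ _ => hAX hx, fun _ _ => hN x ⟨t, h1, h2, h3⟩, ?_, rfl⟩
        · intro _; rw [zd_self]; omega
        · intro _ _ _ _; rw [zd_self]; omega
    by_cases hh : Hot z r a b (AA S r z a (b + 1))
    · left
      obtain ⟨x, hx, y, hy, hg, hxy⟩ := hh
      obtain ⟨p, M, a1, a2, a3, a4, a5, a6⟩ := hpath x hx
      obtain ⟨q, N, b1, b2, b3, b4, b5, b6⟩ := hpath y hy
      obtain ⟨t, h1, h2, h3⟩ := extend (S := S) hz hr hab hAX (AA_conn hz hzS hr)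
        (fun t h1 h2 u hu => ⟨t, h1, h2, hu⟩) hAn hcold p q M N a1 b1 a2 b2 a3 b3 a4 b4 a5 b5
        ⟨x, Or.inl (Or.inr ⟨M, le_rfl, a6.symm⟩), y, Or.inr ⟨N, le_rfl, b6.symm⟩, hg, hxy⟩
      exact ⟨t, h1, by omega, h3⟩
    · refine fin (b + 1) hX ?_
      intro u hu v hv
      by_cases hg : Good z r a b u v
      · by_contra hcon
        exact hh ⟨u, hu, v, hv, hg, by omega⟩
      · exact not_good_le hz hab (hN u hu) (hN v hv) hg

lemma ivt (g : ℕ → ℕ) (hg : ∀ t, g (t + 1) ≤ g t + 1) (a c : ℕ) (ha : g a ≤ c) (b : ℕ)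
    (hab : a ≤ b) : c ≤ g b → ∃ t, a ≤ t ∧ t ≤ b ∧ g t = c := by
  induction b, hab using Nat.le_induction with
  | base => intro h; exact ⟨a, le_rfl, le_rfl, by omega⟩
  | succ b hab ih =>
    intro h
    by_cases h1 : c ≤ g b
    · obtain ⟨t, h2, h3, h4⟩ := ih h1
      exact ⟨t, h2, by omega, h4⟩
    · have := hg b
      exact ⟨b + 1, by omega, le_rfl, by omega⟩

lemma slab {z : ℕ → ZSite D} (hz : ∀ t, zDist (z t) (z (t + 1)) ≤ 1) {r : ℕ}
    {S : Set (ZSite D)} (hzS : ∀ t, z t ∈ S) (hr : 1 ≤ r) (o : ZSite D) (lo i j : ℕ)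
    (hij : i < j) (hi : zDist o (z i) = lo) (hj : zDist o (z j) = lo + 2 * r) :
    ∃ t, Sol S {x | x ∈ S ∧ lo ≤ zDist o x ∧ zDist o x ≤ lo + 2 * r} r (z t) := by
  classical
  set X := {x | x ∈ S ∧ lo ≤ zDist o x ∧ zDist o x ≤ lo + 2 * r} with hXdef
  have lip : ∀ x y, zDist o x ≤ zDist o y + zDist y x := fun x y => zd_tri o y x
  have hzK : ∀ t, z t ∈ KK S r (z t) := fun t =>
    mem_KK_of_near hr (hzS t) (hzS t) (by rw [zd_self]; omega)
  set L : ℕ → Prop := fun t => t = i ∨ ∃ x ∈ KK S r (z t), zDist o x < lo with hL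
  set R : ℕ → Prop := fun t => t = j ∨ ∃ x ∈ KK S r (z t), lo + 2 * r < zDist o x with hR
  have hL1 : ∀ t, L t → zDist o (z t) < lo + r ∧ ∃ x ∈ KK S r (z t), zDist o x ≤ lo := by
    rintro t (rfl | ⟨x, hx, h⟩)
    · exact ⟨by omega, z t, hzK t, hi.le⟩
    · have h1 := lip (z t) x
      have h2 := KK_dist hx
      have h3 := zd_comm x (z t)
      exact ⟨by omega, x, hx, h.le⟩
  have hR1 : ∀ t, R t → lo + r < zDist o (z t) ∧ ∃ x ∈ KK S r (z t), lo + 2 * r ≤ zDist o x := by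
    rintro t (rfl | ⟨x, hx, h⟩)
    · exact ⟨by omega, z t, hzK t, hj.ge⟩
    · have h1 := lip x (z t)
      have h2 := KK_dist hx
      exact ⟨by omega, x, hx, h.le⟩
  have hexR : ∃ t, i < t ∧ R t := ⟨j, hij, Or.inl rfl⟩
  obtain ⟨j0, ⟨hij0, hRj⟩, hjmin⟩ : ∃ j0, (i < j0 ∧ R j0) ∧ ∀ t, i < t → t < j0 → ¬ R t :=
    ⟨Nat.find hexR, Nat.find_spec hexR, fun t h1 h2 h3 => Nat.find_min hexR h2 ⟨h1, h3⟩⟩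
  obtain ⟨i0, hii0, hi0j, hLi, himax⟩ : ∃ i0, i ≤ i0 ∧ i0 < j0 ∧ L i0 ∧
      ∀ t, i0 < t → t < j0 → ¬ L t := by
    have hP : (fun t => i ≤ t ∧ L t) i := ⟨le_rfl, Or.inl rfl⟩
    have hb : i ≤ j0 - 1 := by omega
    have h1 := Nat.findGreatest_spec (P := fun t => i ≤ t ∧ L t) hb hP
    have h2 := Nat.findGreatest_le (P := fun t => i ≤ t ∧ L t) (j0 - 1)
    refine ⟨_, h1.1, by omega, h1.2, ?_⟩
    intro t h3 h4 h5
    exact Nat.findGreatest_is_greatest (P := fun t => i ≤ t ∧ L t) h3 (by omega) ⟨by omega, h5⟩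
  obtain ⟨hfi, xl, hxl, hfl⟩ := hL1 i0 hLi
  obtain ⟨hfj, xr, hxr, hfr⟩ := hR1 j0 hRj
  have hKX : ∀ t, i0 + 1 ≤ t → t ≤ j0 - 1 → KK S r (z t) ⊆ X := by
    intro t h1 h2 x hx
    have h3 := himax t (by omega) (by omega)
    have h4 := hjmin t (by omega) (by omega)
    refine ⟨KK_sub hx, ?_, ?_⟩
    · by_contra h
      exact h3 (Or.inr ⟨x, hx, by omega⟩)
    · by_contra h
      exact h4 (Or.inr ⟨x, hx, by omega⟩)
  obtain ⟨tc, htc1, htc2, htc⟩ := ivt (fun t => zDist o (z t))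
    (fun t => by have := lip (z (t + 1)) (z t); have := hz t; omega)
    i0 (lo + r) hfi.le j0 hi0j.le hfj.le
  have htc3 : tc ≠ i0 := by rintro rfl; omega
  have htc4 : tc ≠ j0 := by rintro rfl; omega
  have hab : i0 + 1 ≤ j0 - 1 := by omega
  have hj0 : j0 - 1 + 1 = j0 := by omega
  rcases claim1 hz hzS hr (j0 - 1) hab hKX with ⟨t, _, _, h⟩ | hcold
  · exact ⟨t, h⟩
  have hiA : z i0 ∈ AA S r z (i0 + 1) (j0 - 1) :=
    ⟨i0 + 1, le_rfl, hab, mem_KK_of_near hr (hzS _) (hzS _) (by rw [zd_comm]; exact hz i0)⟩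
  have hjA : z j0 ∈ AA S r z (i0 + 1) (j0 - 1) := by
    refine ⟨j0 - 1, hab, le_rfl, mem_KK_of_near hr (hzS _) (hzS _) ?_⟩
    have := hz (j0 - 1)
    rwa [hj0] at this
  have hAX : AA S r z (i0 + 1) (j0 - 1) ⊆ X := by
    rintro x ⟨t, h1, h2, h3⟩
    exact hKX t h1 h2 h3
  have hAn : ∀ x ∈ AA S r z (i0 + 1) (j0 - 1), ∃ t, i0 + 1 ≤ t ∧ t ≤ j0 - 1 ∧
      zDist x (z t) ≤ r := by
    rintro x ⟨t, h1, h2, h3⟩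
    exact ⟨t, h1, h2, by rw [zd_comm]; exact KK_dist h3⟩
  have hfi2 := (hAX hiA).2.1
  have hfj2 := (hAX hjA).2.2
  have pair : ∀ m x y, x ∈ KK S r m → y ∈ KK S r m → zDist x y ≤ 2 * r := by
    intro m x y hx hy
    have h7 := KK_dist hx
    have h8 := KK_dist hy
    have h9 := zd_tri x m y
    have h10 := zd_comm x m
    omega
  -- the left path
  obtain ⟨n, p, hp0, hpn, hpK, hps⟩ := (KK_conn hxl).fn
  have hexP : ∃ k, zDist o (p k) ≤ lo := ⟨n, by rw [hpn]; exact hfl⟩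
  obtain ⟨M, hM, hMmin⟩ : ∃ M, zDist o (p M) ≤ lo ∧ ∀ k < M, lo < zDist o (p k) :=
    ⟨Nat.find hexP, Nat.find_spec hexP, fun k hk => by have := Nat.find_min hexP hk; omega⟩
  have hMlo : lo ≤ zDist o (p M) := by
    rcases Nat.eq_zero_or_pos M with h | h
    · rw [h, hp0]; exact hfi2
    · have h1 := hMmin (M - 1) (by omega)
      have h2 := hps (M - 1)
      rw [Nat.sub_add_cancel h] at h2
      have h3 := lip (p (M - 1)) (p M)
      have h4 := zd_comm (p M) (p (M - 1))
      omega
  -- the right path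
  obtain ⟨n', q, hq0, hqn, hqK, hqs⟩ := (KK_conn hxr).fn
  have hexQ : ∃ k, lo + 2 * r ≤ zDist o (q k) := ⟨n', by rw [hqn]; exact hfr⟩
  obtain ⟨N, hN, hNmin⟩ : ∃ M, lo + 2 * r ≤ zDist o (q M) ∧ ∀ k < M, zDist o (q k) < lo + 2 * r :=
    ⟨Nat.find hexQ, Nat.find_spec hexQ, fun k hk => by have := Nat.find_min hexQ hk; omega⟩
  have hNhi : zDist o (q N) ≤ lo + 2 * r := by
    rcases Nat.eq_zero_or_pos N with h | h
    · rw [h, hq0]; exact hfj2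
    · have h1 := hNmin (N - 1) (by omega)
      have h2 := hqs (N - 1)
      rw [Nat.sub_add_cancel h] at h2
      have h3 := lip (q N) (q (N - 1))
      omega
  obtain ⟨t, _, _, h⟩ := extend (S := S) (X := X) hz hr hab hAX (AA_conn hz hzS hr)
    (fun t h1 h2 u hu => ⟨t, h1, h2, hu⟩) hAn hcold p q M N (by rw [hp0]; exact hiA)
    (by rw [hq0]; exact hjA) hps hqs
    (by
      intro k hk
      refine ⟨KK_sub (hpK k), ?_, ?_⟩
      · rcases Nat.lt_or_ge k M with h | h
        · exact (hMmin k h).le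
        · rw [le_antisymm hk h]; exact hMlo
      · have h1 := lip (p k) (z i0)
        have h2 := KK_dist (hpK k)
        omega)
    (by
      intro k hk
      refine ⟨KK_sub (hqK k), ?_, ?_⟩
      · have h1 := lip (z j0) (q k)
        have h2 := KK_dist (hqK k)
        have h3 := zd_comm (z j0) (q k)
        omega
      · rcases Nat.lt_or_ge k N with h | h
        · exact (hNmin k h).le
        · rw [le_antisymm hk h]; exact hNhi)
    (by
      intro k _
      refine ⟨i0 + 1, le_rfl, hab, ?_⟩
      have h1 := KK_dist (hpK k)
      have h2 := zd_tri (p k) (z i0) (z (i0 + 1))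
      have h3 := zd_comm (p k) (z i0)
      have h4 := hz i0
      omega)
    (by
      intro k _
      refine ⟨j0 - 1, hab, le_rfl, ?_⟩
      have h1 := KK_dist (hqK k)
      have h2 := zd_tri (q k) (z j0) (z (j0 - 1))
      have h3 := zd_comm (q k) (z j0)
      have h4 := hz (j0 - 1)
      rw [hj0, zd_comm] at h4
      omega)
    (fun k _ j _ => pair _ _ _ (hpK k) (hpK j))
    (fun k _ j _ => pair _ _ _ (hqK k) (hqK j))
    (by
      have e1 := lip (z tc) (p M)
      have e2 := lip (q N) (z tc)
      have e3 := lip (q N) (p M)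
      have e4 := zd_comm (q N) (z tc)
      refine ⟨p M, Or.inl (Or.inr ⟨M, le_rfl, rfl⟩), q N, Or.inr ⟨N, le_rfl, rfl⟩,
        ⟨tc, by omega, by omega, ?_, ?_⟩, ?_⟩ <;> omega)
  exact ⟨t, h⟩

/-- From a core to a maximal chunk. -/
lemma chunk_of_sol {S : Set (ZSite D)} {w p r β lo : ℕ} {o m : ZSite D} (hm : m ∈ S)
    (h2 : w ^ p - w ^ (p - 1) = 2 * r) (hβ : w ^ (p - 1) / 2 = β)
    (hd : 2 * r + 2 * β < w ^ p)
    (h : Sol S {x | x ∈ S ∧ lo ≤ zDist o x ∧ zDist o x ≤ lo + 2 * r} r m) :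
    ∃ C, IsMaxChunk w p S C m ∧ ∀ x ∈ C, lo ≤ zDist o x + β ∧ zDist o x ≤ lo + 2 * r + β := by
  obtain ⟨C, hCX, hCc, hK, hCd, x, hx, y, hy, hxy, hxm, hym⟩ := h
  have hr2 : (w ^ p - w ^ (p - 1)) / 2 = r := by omega
  have hmC : m ∈ C := by
    apply hK
    refine Conn.refl ⟨?_, hm⟩
    simp [zBall, zd_self]
  set Y := zBall β C ∩ S with hY
  have hCY : C ⊆ Y := fun u hu => ⟨⟨u, hu, by rw [zd_self]; omega⟩, (hCX hu).1⟩
  have hCZ : C ⊆ zConnComp Y C := fun u hu => mem_comp_iff.2 ⟨u, hu, Conn.refl (hCY hu)⟩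
  have hZY : zConnComp Y C ⊆ Y := by
    intro u hu
    obtain ⟨v, _, h⟩ := mem_comp_iff.1 hu
    exact h.right
  refine ⟨zConnComp Y C, ⟨fun u hu => (hZY hu).2, ?_, ?_, C, hCZ, zConn_iff.2 hCc, ?_⟩, ?_⟩
  · rw [zConn_iff]
    have key : ∀ u ∈ zConnComp Y C, Conn (zConnComp Y C) m u := by
      intro u hu
      obtain ⟨v, hv, h⟩ := mem_comp_iff.1 hu
      exact ((hCc m hmC v hv).mono hCZ).trans
        (h.self.mono fun t ht => mem_comp_iff.2 ⟨v, hv, ht⟩)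
    intro u hu v hv
    exact (key u hu).symm.trans (key v hv)
  · intro u hu v hv
    obtain ⟨u', hu', h3⟩ := (hZY hu).1
    obtain ⟨v', hv', h4⟩ := (hZY hv).1
    have h5 := hCd u' hu' v' hv'
    have h6 := zd_tri u u' v
    have h7 := zd_tri u' v' v
    have h8 := zd_comm u u'
    omega
  · obtain ⟨ξ, a1, a2, a3, a4⟩ := (hCc x hx m hmC).list'
    obtain ⟨ζ, b1, b2, b3, b4, b5⟩ := (hCc m hmC y hy).list a1 a2 a3 a4
    rw [hr2, hβ]
    refine ⟨ζ, x, y, b1, b4, b2, b3, b5 m (List.mem_of_getLast? a3), by omega, hxm, hym, ?_,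
      fun _ h => h⟩
    intro u hu
    obtain ⟨v, hv, h⟩ := mem_comp_iff.1 hu
    rw [Set.mem_singleton_iff] at hv
    subst hv
    exact hK h
  · intro u hu
    obtain ⟨u', hu', h3⟩ := (hZY hu).1
    have h4 := hCX hu'
    have h5 := zd_tri o u' u
    have h6 := zd_tri o u u'
    have h7 := zd_comm u u'
    have h8 := h4.2.1
    have h9 := h4.2.2
    omega

end Helpers

end BH

namespace BH

/-- Lemma 3 of Bravyi–Haah. Let `w ≥ 3` be odd, `p ≥ 1`,
`l ≥ 1`, and `S ⊆ ℤ^D`. If `ζ` is a path contained in `S` joining `u₁` and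
`u_n` with `d(u₁,u_n) = l·w^p − 1`, then there are `l` pairwise disjoint
maximal level-`p` chunks with respect to `S`, each having a midpoint on `ζ`. -/
theorem max_chunks_on_path (D : ℕ) (w : ℕ) (hw : Odd w) (hw3 : 3 ≤ w)
    (p : ℕ) (hp : 1 ≤ p) (l : ℕ) (hl : 1 ≤ l)
    (S : Set (ZSite D)) (ζ : List (ZSite D)) (u₁ un : ZSite D)
    (hpath : IsPath ζ) (hζS : ∀ x ∈ ζ, x ∈ S)
    (hhead : ζ.head? = some u₁) (hlast : ζ.getLast? = some un)
    (hdist : zDist u₁ un = l * w ^ p - 1) :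
    ∃ (C : Fin l → Set (ZSite D)) (m : Fin l → ZSite D),
      (∀ i, IsMaxChunk w p S (C i) (m i)) ∧
      (∀ i, m i ∈ ζ) ∧
      (∀ i j, i ≠ j → Disjoint (C i) (C j)) := by
  obtain ⟨n, z, hz0, hzn, hzζ, hz⟩ :=
    (conn_of_list (X := {x | x ∈ ζ}) hpath hhead hlast (fun x hx => hx)).fn
  have hzS : ∀ t, z t ∈ S := fun t => hζS _ (hzζ t)
  obtain ⟨b, hb⟩ : Odd (w ^ (p - 1)) := hw.pow
  obtain ⟨c, hc⟩ : Odd (w ^ p) := hw.pow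
  have hwp : w ^ p = w ^ (p - 1) * w := by
    rw [← pow_succ, Nat.sub_add_cancel hp]
  have h3 : 3 * w ^ (p - 1) ≤ w ^ p := by
    rw [hwp, Nat.mul_comm]; exact Nat.mul_le_mul_left _ hw3
  obtain ⟨r, hr⟩ : ∃ r, c = b + r := ⟨c - b, by omega⟩
  have hr1 : 1 ≤ r := by omega
  have key : ∀ k : Fin l, ∃ C m, IsMaxChunk w p S C m ∧ m ∈ ζ ∧
      ∀ x ∈ C, k * w ^ p ≤ zDist u₁ x ∧ zDist u₁ x < (k + 1) * w ^ p := by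
    intro k
    have hk : ((k : ℕ) + 1) * w ^ p ≤ l * w ^ p := Nat.mul_le_mul_right _ k.2
    have hg : ∀ t, zDist u₁ (z (t + 1)) ≤ zDist u₁ (z t) + 1 := fun t => by
      have := zd_tri u₁ (z t) (z (t + 1))
      have := hz t
      omega
    have e : ((k : ℕ) + 1) * w ^ p = k * w ^ p + w ^ p := by ring
    have hend : zDist u₁ (z n) = l * w ^ p - 1 := by rw [hzn]; exact hdist
    have hstart : zDist u₁ (z 0) = 0 := by rw [hz0]; exact zd_self _
    obtain ⟨i, _, hin, hi⟩ := ivt (fun t => zDist u₁ (z t)) hg 0 (k * w ^ p + b)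
      (by omega) n (Nat.zero_le _) (by omega)
    obtain ⟨j, hij, _, hj⟩ := ivt (fun t => zDist u₁ (z t)) hg i (k * w ^ p + b + 2 * r)
      (by omega) n hin (by omega)
    have hne : i ≠ j := by rintro rfl; omega
    obtain ⟨t, ht⟩ := slab hz hzS hr1 u₁ (k * w ^ p + b) i j (by omega) hi hj
    obtain ⟨C, hC, hCf⟩ := chunk_of_sol (w := w) (p := p) (β := b) (hzS t) (by omega) (by omega)
      (by omega) ht
    refine ⟨C, z t, hC, hzζ t, fun x hx => ?_⟩
    have := hCf x hx
    omega
  choose C m h1 h2 h4 using key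
  refine ⟨C, m, h1, h2, ?_⟩
  have aux : ∀ i j : Fin l, i < j → Disjoint (C i) (C j) := by
    intro i j hij
    rw [Set.disjoint_left]
    intro x hx hx'
    have e1 := (h4 i x hx).2
    have e2 := (h4 j x hx').1
    have e3 : ((i : ℕ) + 1) * w ^ p ≤ j * w ^ p := Nat.mul_le_mul_right _ hij
    omega
  intro i j hij
  rcases lt_or_gt_of_ne hij with h | h
  · exact aux i j h
  · exact (aux j i h).symm

end BH
end

section
/- There exist constants c > 0 and γ > 1, depending only on the spatial dimension D and the no-strings constant α ≥ 1, such that the following holds: if a local stabilizer code on Λ = (ℤ/Lℤ)^D satisfies the topological order conditions at scale L_tqo and obeys the no-strings rule with constant α, then every logical operator has weight at least c·L_tqo^γ (in particular the code distance is at least c·L_tqo^γ). -/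
open Finset

namespace BH

/-- The lattice `Λ = (ℤ/Lℤ)^D`. -/
abbrev Site (L D : ℕ) := Fin D → ZMod L

/-- Pauli operators modulo phase on a set `Q` of qubits, written additively:
`E = (Eˣ, Eᶻ)` componentwise over `𝔽₂ × 𝔽₂`. -/
abbrev Pauli (Q : Type) := Q → ZMod 2 × ZMod 2

/-- A single-qubit Pauli operator: one supported on a single qubit. -/
def singleQubit {Q : Type} (E : Pauli Q) : Prop :=
  ∃ q, ∀ q', E q' ≠ 0 → q' = q

/-- The weight of a Pauli operator: the cardinality of its support. -/
noncomputable def pweight {Q : Type} [Fintype Q] (E : Pauli Q) : ℕ :=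
  (Finset.univ.filter fun q => E q ≠ 0).card

/-- The symplectic form `ω(E,F) = Σ_q (Eˣ_q Fᶻ_q + Eᶻ_q Fˣ_q)`;
`E` and `F` commute iff `ω(E,F) = 0`. -/
def sympForm {Q : Type} [Fintype Q] (E F : Pauli Q) : ZMod 2 :=
  ∑ q, ((E q).1 * (F q).2 + (E q).2 * (F q).1)

/-- Partial product (= sum, in additive notation) `E_t ⋯ E_2 E_1` of the
first `t` errors of an error path. -/
def partialSum {Q : Type} {T : ℕ} (Ep : Fin T → Pauli Q) (t : ℕ) : Pauli Q :=
  ∑ s : Fin T, if (s : ℕ) < t then Ep s else 0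

/-- Distance on the cyclic group `ℤ/Lℤ` (periodic boundary conditions). -/
def cDist {L : ℕ} (a b : ZMod L) : ℕ := min (a - b).val (b - a).val

/-- The `l_∞` distance on the lattice `(ℤ/Lℤ)^D`. -/
def dist' {L D : ℕ} (u v : Site L D) : ℕ :=
  Finset.univ.sup fun i => cDist (u i) (v i)

/-- `l_∞` diameter of a finite set of sites. -/
def fdiam {L D : ℕ} (X : Finset (Site L D)) : ℕ :=
  X.sup fun u => X.sup fun v => dist' u v

/-- `l_∞` distance between two finite sets of sites. -/
noncomputable def fdist {L D : ℕ} (X Y : Finset (Site L D)) : ℕ :=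
  sInf {d | ∃ u ∈ X, ∃ v ∈ Y, dist' u v = d}

/-- `B_r(A)`: the set of points at distance at most `r` from `A`. -/
def ball {L D : ℕ} (r : ℝ) (A : Set (Site L D)) : Set (Site L D) :=
  {v | ∃ u ∈ A, ((dist' u v : ℕ) : ℝ) ≤ r}

/-- The cube of linear size `ℓ` with corner `c`. -/
def cubeSet {L D : ℕ} (c : Site L D) (ℓ : ℝ) : Set (Site L D) :=
  {v | ∀ i, (((v i - c i).val : ℕ) : ℝ) ≤ ℓ}

/-- The elementary cube with corner `c` (a translate of `{0,1}^D`). -/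
def elemCube {L D : ℕ} [NeZero L] (c : Site L D) : Finset (Site L D) :=
  Finset.univ.filter fun v => ∀ i, (v i - c i).val ≤ 1

/-- The level-`p` unit of length `ξ(p) = (10α)^p`. -/
def ξ (α : ℝ) (p : ℕ) : ℝ := (10 * α) ^ p

/-- A local stabilizer code on `Λ = (ℤ/Lℤ)^D` with `K` qubits per site:
a family of pairwise commuting Pauli operators `G a`, each supported on the
sites of the elementary cube located at `loc a`. -/
structure Code (L D K : ℕ) [NeZero L] (A : Type) [Fintype A] where
  G : A → Pauli (Site L D × Fin K)
  loc : A → Site L D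
  comm : ∀ a b, sympForm (G a) (G b) = 0
  localGen : ∀ a q, G a q ≠ 0 → q.1 ∈ elemCube (loc a)

variable {L D K : ℕ} [NeZero L] {A : Type} [Fintype A]

/-- `E` is supported (as a set of sites) inside `X`. -/
def suppIn (E : Pauli (Site L D × Fin K)) (X : Set (Site L D)) : Prop :=
  ∀ q, E q ≠ 0 → q.1 ∈ X

/-- `E` is supported in some cube of linear size `ℓ`. -/
def smallSupp (E : Pauli (Site L D × Fin K)) (ℓ : ℝ) : Prop :=
  ∃ c, suppIn E (cubeSet c ℓ)

/-- `(c, ℓ)` is a smallest cube enclosing `X`. -/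
def minEnclosing {L D : ℕ} (c : Site L D) (ℓ : ℝ) (X : Set (Site L D)) : Prop :=
  0 ≤ ℓ ∧ X ⊆ cubeSet c ℓ ∧ ∀ c' ℓ', 0 ≤ ℓ' → X ⊆ cubeSet c' ℓ' → ℓ ≤ ℓ'

namespace Code

/-- The stabilizer group `𝒢`. -/
def stab (code : Code L D K A) : AddSubgroup (Pauli (Site L D × Fin K)) :=
  AddSubgroup.closure (Set.range code.G)

/-- The syndrome of `E`: the set of generators anticommuting with `E` (defects). -/
def syndrome (code : Code L D K A) (E : Pauli (Site L D × Fin K)) : Finset A :=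
  Finset.univ.filter fun a => sympForm (code.G a) E = 1

/-- The set of lattice sites covered by the elementary cubes of a set `S` of
defects (the syndrome regarded as a set of elementary cubes). -/
def synSites (code : Code L D K A) (S : Finset A) : Finset (Site L D) :=
  S.biUnion fun a => elemCube (code.loc a)

/-- A set of defects is neutral if it is the syndrome of some Pauli operator
supported in a cube of linear size `Ltqo`; otherwise it is charged. -/
def neutral (code : Code L D K A) (Ltqo : ℝ) (S : Finset A) : Prop :=
  ∃ E, code.syndrome E = S ∧ smallSupp E Ltqo

/-- (TQO1) Every Pauli operator with empty syndrome supported in a cube of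
linear size `Ltqo` is a stabilizer. -/
def tqo1 (code : Code L D K A) (Ltqo : ℝ) : Prop :=
  ∀ E, smallSupp E Ltqo → code.syndrome E = ∅ → E ∈ code.stab

/-- (TQO2) Every neutral set `S` of defects is the syndrome of some Pauli
operator supported on `B₁(C_min(S))`. -/
def tqo2 (code : Code L D K A) (Ltqo : ℝ) : Prop :=
  ∀ S, code.neutral Ltqo S →
    ∀ c ℓ, minEnclosing c ℓ (code.synSites S : Set (Site L D)) →
      ∃ E, code.syndrome E = S ∧ suppIn E (ball 1 (cubeSet c ℓ))

/-- The topological order conditions at scale `Ltqo`. -/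
def tqo (code : Code L D K A) (Ltqo : ℝ) : Prop :=
  code.tqo1 Ltqo ∧ code.tqo2 Ltqo

open scoped Classical in
/-- The part of the set `S` of defects whose elementary cubes lie inside `X`. -/
noncomputable def partIn (code : Code L D K A) (S : Finset A) (X : Set (Site L D)) :
    Finset A :=
  S.filter fun a => ∀ v ∈ elemCube (code.loc a), v ∈ X

/-- The no-strings rule with constant `α`: for any Pauli operator supported in a
cube of linear size `Ltqo` whose syndrome is contained in two disjoint cubes of
linear size `ρ` at mutual distance at least `α·ρ`, the part of the syndrome in
each cube is neutral. -/
def noStrings (code : Code L D K A) (Ltqo α : ℝ) : Prop :=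
  ∀ (E : Pauli (Site L D × Fin K)) (ρ : ℝ) (c₁ c₂ : Site L D), 0 < ρ →
    smallSupp E Ltqo →
    Disjoint (cubeSet c₁ ρ) (cubeSet c₂ ρ) →
    (∀ u ∈ cubeSet c₁ ρ, ∀ v ∈ cubeSet c₂ ρ, α * ρ ≤ ((dist' u v : ℕ) : ℝ)) →
    (code.synSites (code.syndrome E) : Set (Site L D)) ⊆ cubeSet c₁ ρ ∪ cubeSet c₂ ρ →
    code.neutral Ltqo (code.partIn (code.syndrome E) (cubeSet c₁ ρ)) ∧
    code.neutral Ltqo (code.partIn (code.syndrome E) (cubeSet c₂ ρ))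

/-- A logical operator: commutes with all generators but is not a stabilizer. -/
def logical (code : Code L D K A) (E : Pauli (Site L D × Fin K)) : Prop :=
  (∀ a, sympForm (code.G a) E = 0) ∧ E ∉ code.stab

/-- `P` has energy barrier at least `ω`: every error path implementing `P`
passes through a syndrome with at least `ω` defects. -/
def barrierAtLeast (code : Code L D K A) (P : Pauli (Site L D × Fin K)) (ω : ℝ) : Prop :=
  ∀ (T : ℕ) (Ep : Fin T → Pauli (Site L D × Fin K)),
    (∀ t, singleQubit (Ep t)) → partialSum Ep T = P →
    ∃ t ≤ T, ω ≤ ((code.syndrome (partialSum Ep t)).card : ℝ)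

end Code

end BH

open Finset
namespace BH

/-- Abstract setting. -/
structure Sys (V A Pa : Type) [AddCommGroup Pa] where
  d : V → V → ℕ
  d_self : ∀ u, d u u = 0
  symm : ∀ u v, d u v = d v u
  tri : ∀ u v w, d u w ≤ d u v + d v w
  σ : Pa →+ (A → ZMod 2)
  loc : A → V
  B : V → ℕ → AddSubgroup Pa
  B_mono : ∀ u v ρ ρ', d u v + ρ ≤ ρ' → B u ρ ≤ B v ρ'
  stab : AddSubgroup Pa
  stab_syn : ∀ E ∈ stab, σ E = 0
  isLocal : ∀ E u ρ a, E ∈ B u ρ → σ E a ≠ 0 → d (loc a) u ≤ ρ + 1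
  W : ℕ
  β : ℕ
  H1 : ∀ E u, E ∈ B u W → σ E = 0 → E ∈ stab
  H2 : ∀ E u₀ u ρ, E ∈ B u₀ W → (∀ a, σ E a ≠ 0 → d (loc a) u ≤ ρ) → 2 ≤ ρ →
    ∃ F ∈ B u (6 * ρ), σ F = σ E
  H3 : ∀ E u₀ u₁ u₂ ρ S₁ S₂, E ∈ B u₀ W → σ E = S₁ + S₂ →
    (∀ a, S₁ a ≠ 0 → d (loc a) u₁ ≤ ρ) → (∀ a, S₂ a ≠ 0 → d (loc a) u₂ ≤ ρ) → 2 ≤ ρ →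
    β * ρ ≤ d u₁ u₂ → ∃ F ∈ B u₁ (6 * ρ), σ F = S₁

namespace Sys

variable {V A Pa : Type} [AddCommGroup Pa] (Y : Sys V A Pa)

/-! ### Components -/

/-- linking graph on a finite set of centres -/
def gr (l : ℕ) (U : Finset V) : SimpleGraph V where
  Adj p q := p ≠ q ∧ p ∈ U ∧ q ∈ U ∧ Y.d p q ≤ l
  symm := ⟨fun p q h => ⟨h.1.symm, h.2.2.1, h.2.1, by rw [Y.symm]; exact h.2.2.2⟩⟩
  loopless := ⟨fun p h => h.1 rfl⟩

open scoped Classical in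
noncomputable def comp (l : ℕ) (U : Finset V) (x : V) : Finset V :=
  U.filter fun z => (Y.gr l U).Reachable x z

open scoped Classical in
noncomputable def comps (l : ℕ) (U : Finset V) : Finset (Finset V) :=
  U.image (Y.comp l U)

variable {Y} {l : ℕ} {U U' T T' : Finset V}

lemma comps_sub (h : T ∈ Y.comps l U) : T ⊆ U := by
  classical
  obtain ⟨x, hx, rfl⟩ := Finset.mem_image.1 h
  exact Finset.filter_subset _ _

lemma comps_nonempty (h : T ∈ Y.comps l U) : T.Nonempty := by
  classical
  obtain ⟨x, hx, rfl⟩ := Finset.mem_image.1 h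
  exact ⟨x, Finset.mem_filter.2 ⟨hx, SimpleGraph.Reachable.refl _⟩⟩

lemma comp_mem (x : V) (hx : x ∈ U) : Y.comp l U x ∈ Y.comps l U := by
  classical
  exact Finset.mem_image_of_mem _ hx

lemma mem_comp_self (x : V) (hx : x ∈ U) : x ∈ Y.comp l U x := by
  classical
  exact Finset.mem_filter.2 ⟨hx, SimpleGraph.Reachable.refl _⟩

lemma comps_eq (h : T ∈ Y.comps l U) {x : V} (hx : x ∈ T) : T = Y.comp l U x := by
  classical
  obtain ⟨y, hy, rfl⟩ := Finset.mem_image.1 h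
  have h1 := (Finset.mem_filter.1 hx).2
  ext z
  simp only [comp, Finset.mem_filter]
  refine and_congr_right fun _ => ⟨fun h => h1.symm.trans h, fun h => h1.trans h⟩

lemma comps_disj (h : T ∈ Y.comps l U) (h' : T' ∈ Y.comps l U) {x : V} (hx : x ∈ T)
    (hx' : x ∈ T') : T = T' := by
  rw [comps_eq h hx, comps_eq h' hx']

/-- `T` is closed under linking inside `U`. -/
def Closed (Y : Sys V A Pa) (l : ℕ) (U T : Finset V) : Prop :=
  T ⊆ U ∧ ∀ x ∈ T, ∀ z ∈ U, Y.d x z ≤ l → z ∈ T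

lemma comps_closed (h : T ∈ Y.comps l U) : Closed Y l U T := by
  classical
  refine ⟨comps_sub h, fun x hx z hz hd => ?_⟩
  rw [comps_eq h hx]
  refine Finset.mem_filter.2 ⟨hz, ?_⟩
  by_cases hxz : x = z
  · subst hxz; exact SimpleGraph.Reachable.refl _
  · exact SimpleGraph.Adj.reachable ⟨hxz, comps_sub h hx, hz, hd⟩

lemma walk_dist {x z : V} (p : (Y.gr l U).Walk x z) : Y.d x z ≤ l * p.length := by
  induction p with
  | nil => simp [Y.d_self]
  | cons h p ih =>
    rw [SimpleGraph.Walk.length_cons]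
    refine (Y.tri _ _ _).trans (Nat.add_le_add h.2.2.2 ih) |>.trans ?_
    nlinarith

lemma walk_supp {x z : V} (p : (Y.gr l U).Walk x z) (hx : x ∈ U) : ∀ v ∈ p.support, v ∈ U := by
  induction p with
  | nil => simpa using hx
  | cons h p ih =>
    intro v hv
    rw [SimpleGraph.Walk.support_cons, List.mem_cons] at hv
    rcases hv with rfl | hv
    · exact hx
    · exact ih h.2.2.1 v hv

lemma comps_diam (h : T ∈ Y.comps l U) {x z : V} (hx : x ∈ T) (hz : z ∈ T) :
    Y.d x z ≤ l * U.card := by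
  classical
  have hz' := hz
  rw [comps_eq h hx] at hz'
  obtain ⟨p, hp⟩ := (Finset.mem_filter.1 hz').2.exists_isPath
  refine (walk_dist p).trans (Nat.mul_le_mul_left _ ?_)
  have h1 : p.support.toFinset ⊆ U := fun v hv =>
    walk_supp p (comps_sub h hx) v (List.mem_toFinset.1 hv)
  have h2 := Finset.card_le_card h1
  rw [List.toFinset_card_of_nodup hp.support_nodup, SimpleGraph.Walk.length_support] at h2
  omega

lemma gr_mono (h : U' ⊆ U) : Y.gr l U' ≤ Y.gr l U := by
  intro p q hpq
  exact ⟨hpq.1, h hpq.2.1, h hpq.2.2.1, hpq.2.2.2⟩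

lemma comps_refine (hU : U' ⊆ U) (h' : T' ∈ Y.comps l U') (h : T ∈ Y.comps l U) {x : V}
    (hx' : x ∈ T') (hx : x ∈ T) : T' ⊆ T := by
  classical
  intro z hz
  rw [comps_eq h' hx'] at hz
  rw [comps_eq h hx]
  have := Finset.mem_filter.1 hz
  exact Finset.mem_filter.2 ⟨hU this.1, this.2.mono (gr_mono hU)⟩

/-- A closed set is the union of the components it contains. -/
lemma sum_comps {M : Type*} [AddCommMonoid M] (hT : Closed Y l U T) (f : V → M) [DecidableEq V] :
    ∑ x ∈ T, f x = ∑ C ∈ (Y.comps l U).filter (· ⊆ T), ∑ x ∈ C, f x := by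
  classical
  rw [← Finset.sum_biUnion]
  · refine Finset.sum_congr ?_ fun _ _ => rfl
    ext x
    simp only [Finset.mem_biUnion, Finset.mem_filter]
    constructor
    · intro hx
      refine ⟨Y.comp l U x, ⟨comp_mem x (hT.1 hx), ?_⟩, mem_comp_self x (hT.1 hx)⟩
      intro z hz
      have hz2 := (Finset.mem_filter.1 hz).2
      clear hz
      obtain ⟨p⟩ := hz2
      induction p with
      | nil => exact hx
      | cons h p ih => exact ih (hT.2 _ hx _ h.2.2.1 h.2.2.2)
    · rintro ⟨C, ⟨_, hC⟩, hx⟩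
      exact hC hx
  · intro C hC C' hC' hne
    have hC := (Finset.mem_filter.1 hC).1
    have hC' := (Finset.mem_filter.1 hC').1
    rw [Function.onFun, Finset.disjoint_left]
    intro x hx hx'
    exact hne (comps_disj hC hC' hx hx')

end Sys
end BH

open Finset
namespace BH
namespace Sys
variable {V A Pa : Type} [AddCommGroup Pa]

/-! ### Shells and fluxes -/

structure Cfg (Y : Sys V A Pa) (X : Finset V) (E : V → Pa) (r : ℕ) (g : V → ℕ) : Prop where
  hr : 1 ≤ r
  hE : ∀ x ∈ X, E x ∈ Y.B x r
  hg : ∀ x x', g x ≤ g x' + Y.d x x'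

def near (Y : Sys V A Pa) (r : ℕ) (a : A) (x : V) : Prop := Y.d (Y.loc a) x ≤ 2 * r

def lo (Y : Sys V A Pa) (X : Finset V) (r : ℕ) (g : V → ℕ) (s : ℕ) (a : A) : Prop :=
  ∃ x ∈ X, Y.near r a x ∧ g x < s

def hi (Y : Sys V A Pa) (X : Finset V) (r : ℕ) (g : V → ℕ) (s : ℕ) (a : A) : Prop :=
  ∃ x ∈ X, Y.near r a x ∧ s ≤ g x

/-- syndrome of the part of the operator carried by `T` -/
def sy (Y : Sys V A Pa) (E : V → Pa) (T : Finset V) : A → ZMod 2 := Y.σ (∑ x ∈ T, E x)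

def shell (X : Finset V) (g : V → ℕ) (s s' : ℕ) : Finset V := X.filter fun x => s ≤ g x ∧ g x < s'

open scoped Classical in
noncomputable def bot (Y : Sys V A Pa) (X : Finset V) (E : V → Pa) (r : ℕ) (g : V → ℕ) (s : ℕ)
    (T : Finset V) : A → ZMod 2 := fun a => if Y.lo X r g s a then Y.sy E T a else 0

open scoped Classical in
noncomputable def top (Y : Sys V A Pa) (X : Finset V) (E : V → Pa) (r : ℕ) (g : V → ℕ) (s : ℕ)
    (T : Finset V) : A → ZMod 2 := fun a => if Y.hi X r g s a then Y.sy E T a else 0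

variable {Y : Sys V A Pa} {X : Finset V} {E : V → Pa} {r : ℕ} {g : V → ℕ}

lemma mem_shell {s s' : ℕ} {x : V} : x ∈ shell X g s s' ↔ x ∈ X ∧ s ≤ g x ∧ g x < s' := by
  simp [shell]

lemma sy_apply (T : Finset V) (a : A) : Y.sy E T a = ∑ x ∈ T, Y.σ (E x) a := by
  simp [sy, map_sum, Finset.sum_apply]

lemma near_of_ne (h : Cfg Y X E r g) {x : V} (hx : x ∈ X) {a : A} (ha : Y.σ (E x) a ≠ 0) :
    Y.near r a x := by
  have := Y.isLocal _ _ _ _ (h.hE x hx) ha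
  have := h.hr
  unfold near; omega

lemma near_near {x x' : V} {a : A} (h : Y.near r a x) (h' : Y.near r a x') :
    Y.d x x' ≤ 4 * r := by
  have := Y.tri x (Y.loc a) x'
  rw [Y.symm x (Y.loc a)] at this
  unfold near at h h'; omega

lemma near_g (hc : Cfg Y X E r g) {x x' : V} {a : A} (h : Y.near r a x) (h' : Y.near r a x') :
    g x ≤ g x' + 4 * r :=
  (hc.hg x x').trans (Nat.add_le_add_left (near_near h h') _)

lemma exists_near (hc : Cfg Y X E r g) {T : Finset V} (hT : T ⊆ X) {a : A} (h : Y.sy E T a ≠ 0) :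
    ∃ x ∈ T, Y.near r a x := by
  rw [sy_apply] at h
  obtain ⟨x, hx, h⟩ := Finset.exists_ne_zero_of_sum_ne_zero h
  exact ⟨x, hx, near_of_ne hc (hT hx) h⟩

lemma sy_agree (hc : Cfg Y X E r g) {T T' : Finset V} (hT : T ⊆ X) (hT' : T' ⊆ X) {a : A}
    (h : ∀ x ∈ X, Y.near r a x → (x ∈ T ↔ x ∈ T')) : Y.sy E T a = Y.sy E T' a := by
  classical
  have key : ∀ T : Finset V, T ⊆ X →
      Y.sy E T a = ∑ x ∈ T.filter (fun x => Y.near r a x), Y.σ (E x) a := by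
    intro T hT
    rw [sy_apply, Finset.sum_filter_of_ne]
    intro x hx hne
    exact near_of_ne hc (hT hx) hne
  rw [key T hT, key T' hT']
  refine Finset.sum_congr ?_ fun _ _ => rfl
  ext x
  simp only [Finset.mem_filter]
  constructor
  · rintro ⟨h1, h2⟩; exact ⟨(h x (hT h1) h2).1 h1, h2⟩
  · rintro ⟨h1, h2⟩; exact ⟨(h x (hT' h1) h2).2 h1, h2⟩

/-- no syndrome near the shell -/
def Free (Y : Sys V A Pa) (X : Finset V) (E : V → Pa) (r : ℕ) (g : V → ℕ) (s s' : ℕ) : Prop :=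
  ∀ a, ∀ x ∈ shell X g s s', Y.near r a x → Y.sy E X a = 0

lemma shell_mono {s s' u u' : ℕ} (h : s ≤ u) (h' : u' ≤ s') : shell X g u u' ⊆ shell X g s s' := by
  intro x; simp only [mem_shell]; intro hx; exact ⟨hx.1, by omega, by omega⟩

lemma shell_sub {s s' : ℕ} : shell X g s s' ⊆ X := Finset.filter_subset _ _

lemma Free.mono {s s' u u' : ℕ} (hf : Free Y X E r g s s') (h : s ≤ u) (h' : u' ≤ s') :
    Free Y X E r g u u' := fun a x hx => hf a x (shell_mono h h' hx)

lemma sy_eq_bot_add_top (hc : Cfg Y X E r g) {s s' : ℕ} (hs : s + 4 * r < s')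
    (hf : Free Y X E r g s s') {T : Finset V} (hT : Closed Y (4 * r) (shell X g s s') T) :
    Y.sy E T = Y.bot X E r g s T + Y.top X E r g s' T := by
  classical
  have hTX : T ⊆ X := hT.1.trans shell_sub
  funext a
  simp only [Pi.add_apply, bot, top]
  by_cases h0 : Y.sy E T a = 0
  · simp [h0]
  obtain ⟨x₀, hx₀, hn₀⟩ := exists_near hc hTX h0
  by_cases hlo : Y.lo X r g s a
  · have hhi : ¬ Y.hi X r g s' a := by
      rintro ⟨x, hx, hn, hg⟩
      obtain ⟨x', hx', hn', hg'⟩ := hlo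
      have := near_g hc hn hn'
      omega
    simp [hlo, hhi]
  · by_cases hhi : Y.hi X r g s' a
    · simp [hlo, hhi]
    · exfalso
      apply h0
      rw [← hf a x₀ (hT.1 hx₀) hn₀]
      refine sy_agree hc hTX (Finset.Subset.refl _) fun x hx hn => ⟨fun h => hx, fun _ => ?_⟩
      refine hT.2 x₀ hx₀ x ?_ (near_near hn₀ hn)
      rw [mem_shell]
      refine ⟨hx, ?_, ?_⟩
      · by_contra hlt; exact hlo ⟨x, hx, hn, by omega⟩
      · by_contra hlt; exact hhi ⟨x, hx, hn, by omega⟩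

lemma bot_sum (s : ℕ) {ι : Type*} (I : Finset ι) (f : ι → Finset V) (T : Finset V)
    (h : ∀ a, Y.sy E T a = ∑ i ∈ I, Y.sy E (f i) a) :
    Y.bot X E r g s T = ∑ i ∈ I, Y.bot X E r g s (f i) := by
  classical
  funext a
  simp only [bot, Finset.sum_apply]
  split_ifs
  · exact h a
  · simp

lemma top_sum (s : ℕ) {ι : Type*} (I : Finset ι) (f : ι → Finset V) (T : Finset V)
    (h : ∀ a, Y.sy E T a = ∑ i ∈ I, Y.sy E (f i) a) :
    Y.top X E r g s T = ∑ i ∈ I, Y.top X E r g s (f i) := by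
  classical
  funext a
  simp only [top, Finset.sum_apply]
  split_ifs
  · exact h a
  · simp

lemma sy_comps [DecidableEq V] {l : ℕ} {U T : Finset V} (hT : Closed Y l U T) (a : A) :
    Y.sy E T a = ∑ C ∈ (Y.comps l U).filter (· ⊆ T), Y.sy E C a := by
  simp only [sy_apply]
  exact sum_comps hT _

lemma closed_inter {l : ℕ} {U U' T : Finset V} [DecidableEq V] (hU : U' ⊆ U)
    (hT : Closed Y l U T) : Closed Y l U' (T ∩ U') := by
  refine ⟨Finset.inter_subset_right, fun x hx z hz hd => ?_⟩
  rw [Finset.mem_inter] at hx ⊢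
  exact ⟨hT.2 x hx.1 z (hU hz) hd, hz⟩

/-- the flux through the lower level of `T` differs from that through level `u` by the syndrome of
the part of `T` below `u`. -/
lemma bot_shift [DecidableEq V] (hc : Cfg Y X E r g) {s s' u u' : ℕ} (hsu : s ≤ u)
    (hu : u + 4 * r < u')
    (hus : u' ≤ s') (hf : Free Y X E r g s s') {T : Finset V}
    (hT : Closed Y (4 * r) (shell X g s s') T) :
    Y.bot X E r g s T = Y.sy E (T.filter fun x => g x < u) +
      Y.bot X E r g u (T ∩ shell X g u u') := by
  classical
  have hTX : T ⊆ X := hT.1.trans shell_sub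
  have hTl : (T.filter fun x => g x < u) ⊆ X := (Finset.filter_subset _ _).trans hTX
  have hTi : T ∩ shell X g u u' ⊆ X := Finset.inter_subset_left.trans hTX
  funext a
  have hbt := congrFun (sy_eq_bot_add_top hc (by omega) hf hT) a
  simp only [Pi.add_apply, bot, top] at hbt ⊢
  by_cases hlu : Y.lo X r g u a
  · -- no far centres
    have hfar : ∀ x ∈ X, Y.near r a x → g x < u' := by
      intro x hx hn
      obtain ⟨x', hx', hn', hg'⟩ := hlu
      have := near_g hc hn hn'
      omega
    have hhi : ¬ Y.hi X r g s' a := by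
      rintro ⟨x, hx, hn, hg⟩
      have := hfar x hx hn
      omega
    have hsum : Y.sy E T a = Y.sy E (T.filter fun x => g x < u) a +
        Y.sy E (T ∩ shell X g u u') a := by
      have h1 : Y.sy E T a = Y.sy E ((T.filter fun x => g x < u) ∪ (T ∩ shell X g u u')) a := by
        refine sy_agree hc hTX (Finset.union_subset hTl hTi) fun x hx hn => ?_
        have := hfar x hx hn
        simp only [Finset.mem_union, Finset.mem_filter, Finset.mem_inter, mem_shell]
        constructor
        · intro h
          by_cases hg : g x < u
          · exact Or.inl ⟨h, hg⟩
          · exact Or.inr ⟨h, hx, by omega, this⟩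
        · rintro (h | h) <;> exact h.1
      rw [h1, sy_apply, sy_apply, sy_apply, Finset.sum_union]
      rw [Finset.disjoint_left]
      intro x hx hx'
      have h1 := (Finset.mem_filter.1 hx).2
      have h2 := (mem_shell.1 (Finset.mem_inter.1 hx').2).2.1
      omega
    rw [if_pos hlu, ← hsum]
    rw [if_neg hhi, add_zero] at hbt
    exact hbt.symm
  · have hls : ¬ Y.lo X r g s a := by
      rintro ⟨x, hx, hn, hg⟩
      exact hlu ⟨x, hx, hn, by omega⟩
    rw [if_neg hls, if_neg hlu, add_zero]
    by_contra h0
    obtain ⟨x, hx, hn⟩ := exists_near hc hTl (Ne.symm h0)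
    exact hlu ⟨x, hTl hx, hn, (Finset.mem_filter.1 hx).2⟩

end Sys
end BH

open Finset
namespace BH
namespace Sys
variable {V A Pa : Type} [AddCommGroup Pa]

/-! ### The local lemma -/

/-- syndromes of operators supported near `u0` -/
def Ne (Y : Sys V A Pa) (u0 : V) : AddSubgroup (A → ZMod 2) := (Y.B u0 Y.W).map Y.σ

open scoped Classical in
noncomputable def charged (Y : Sys V A Pa) (X : Finset V) (E : V → Pa) (r : ℕ) (g : V → ℕ) (u0 : V)
    (s s' : ℕ) : Finset (Finset V) :=
  (Y.comps (4 * r) (shell X g s s')).filter fun T => Y.bot X E r g s T ∉ Y.Ne u0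

variable {Y : Sys V A Pa} {X : Finset V} {E : V → Pa} {r : ℕ} {g : V → ℕ} {u0 : V}

lemma mem_charged {s s' : ℕ} {T : Finset V} : T ∈ Y.charged X E r g u0 s s' ↔
    T ∈ Y.comps (4 * r) (shell X g s s') ∧ Y.bot X E r g s T ∉ Y.Ne u0 := by
  classical
  simp [charged]

lemma comps_card_le {l : ℕ} {U : Finset V} : (Y.comps l U).card ≤ U.card := by
  classical
  exact Finset.card_image_le

lemma charged_card_le {s s' : ℕ} :
    (Y.charged X E r g u0 s s').card ≤ (shell X g s s').card := by
  classical
  exact (Finset.card_le_card (Finset.filter_subset _ _)).trans comps_card_le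

lemma sy_mem (hc : Cfg Y X E r g) {s s' : ℕ}
    (hb : ∀ x ∈ shell X g s s', Y.d x u0 + r ≤ Y.W) {T : Finset V} (hT : T ⊆ shell X g s s') :
    Y.sy E T ∈ Y.Ne u0 := by
  refine AddSubgroup.mem_map_of_mem _ (AddSubgroup.sum_mem _ fun x hx => ?_)
  exact Y.B_mono _ _ _ _ (hb x (hT hx)) (hc.hE x (shell_sub (hT hx)))

lemma charged_sub [DecidableEq V] (hc : Cfg Y X E r g) {s s' u u' : ℕ} (hsu : s ≤ u)
    (hu : u + 4 * r < u') (hus : u' ≤ s') (hf : Free Y X E r g s s')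
    (hb : ∀ x ∈ shell X g s s', Y.d x u0 + r ≤ Y.W) {T : Finset V}
    (hT : T ∈ Y.charged X E r g u0 s s') :
    ∃ T' ∈ Y.charged X E r g u0 u u', T' ⊆ T := by
  rw [mem_charged] at hT
  have hcl := comps_closed hT.1
  by_contra hno
  push Not at hno
  apply hT.2
  rw [bot_shift hc hsu hu hus hf hcl]
  refine AddSubgroup.add_mem _ (sy_mem hc hb ((Finset.filter_subset _ _).trans hcl.1)) ?_
  have hcl' := closed_inter (shell_mono hsu hus) hcl
  rw [bot_sum u _ (fun C => C) _ (sy_comps hcl')]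
  refine AddSubgroup.sum_mem _ fun C hC => ?_
  rw [Finset.mem_filter] at hC
  by_contra hn
  exact hno C (mem_charged.2 ⟨hC.1, hn⟩) (hC.2.trans Finset.inter_subset_left)

lemma charged_inj [DecidableEq V] (hc : Cfg Y X E r g) {s s' u u' : ℕ} (hsu : s ≤ u)
    (hu : u + 4 * r < u') (hus : u' ≤ s') (hf : Free Y X E r g s s')
    (hb : ∀ x ∈ shell X g s s', Y.d x u0 + r ≤ Y.W) :
    (Y.charged X E r g u0 s s').card ≤ (Y.charged X E r g u0 u u').card ∧
    ((Y.charged X E r g u0 u u').card ≤ (Y.charged X E r g u0 s s').card →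
      ∀ T ∈ Y.charged X E r g u0 s s', ∀ T₁ ∈ Y.charged X E r g u0 u u', T₁ ⊆ T →
      ∀ T₂ ∈ Y.charged X E r g u0 u u', T₂ ⊆ T → T₁ = T₂) := by
  have h1 : ∀ T : Finset V, ∃ T', T ∈ Y.charged X E r g u0 s s' →
      T' ∈ Y.charged X E r g u0 u u' ∧ T' ⊆ T := by
    intro T
    by_cases hT : T ∈ Y.charged X E r g u0 s s'
    · obtain ⟨T', h, h'⟩ := charged_sub hc hsu hu hus hf hb hT
      exact ⟨T', fun _ => ⟨h, h'⟩⟩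
    · exact ⟨∅, fun h => absurd h hT⟩
  choose ψ hψ using h1
  have key : ∀ T₁ ∈ Y.charged X E r g u0 s s', ∀ T₂ ∈ Y.charged X E r g u0 s s', ∀ C ∈
      Y.charged X E r g u0 u u', C ⊆ T₁ → C ⊆ T₂ → T₁ = T₂ := by
    intro T₁ h₁ T₂ h₂ C hC hC₁ hC₂
    obtain ⟨x, hx⟩ := comps_nonempty (mem_charged.1 hC).1
    exact comps_disj (mem_charged.1 h₁).1 (mem_charged.1 h₂).1 (hC₁ hx) (hC₂ hx)
  have hinj : Set.InjOn ψ (Y.charged X E r g u0 s s' : Set (Finset V)) := by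
    intro T₁ h₁ T₂ h₂ he
    refine key T₁ h₁ T₂ h₂ (ψ T₁) (hψ _ h₁).1 (hψ _ h₁).2 ?_
    rw [he]; exact (hψ _ h₂).2
  refine ⟨Finset.card_le_card_of_injOn ψ (fun T hT => (hψ T hT).1) hinj, ?_⟩
  intro hle
  have hsurj := Finset.surj_on_of_inj_on_of_card_le (fun T _ => ψ T) (fun T hT => (hψ T hT).1)
    (fun a b ha hb h => hinj ha hb h) hle
  have h2 : ∀ T ∈ Y.charged X E r g u0 s s', ∀ C ∈ Y.charged X E r g u0 u u', C ⊆ T → C = ψ T := by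
    intro T hT C hC hCT
    obtain ⟨T', hT', rfl⟩ := hsurj C hC
    rw [key T hT T' hT' _ hC hCT (hψ _ hT').2]
  intro T hT T₁ h₁ h₁' T₂ h₂ h₂'
  rw [h2 T hT T₁ h₁ h₁', h2 T hT T₂ h₂ h₂']

lemma top_inter [DecidableEq V] (hc : Cfg Y X E r g) {s s' u : ℕ} (hu : u + 4 * r < s')
    {T : Finset V} (hT : T ⊆ shell X g s s') (hsu : s ≤ u) :
    Y.top X E r g s' T = Y.top X E r g s' (T ∩ shell X g u s') := by
  classical
  funext a
  simp only [top]
  split_ifs with h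
  · refine sy_agree hc (hT.trans shell_sub) (Finset.inter_subset_left.trans (hT.trans shell_sub)) ?_
    intro x hx hn
    obtain ⟨x', hx', hn', hg'⟩ := h
    have := near_g hc hn' hn
    simp only [Finset.mem_inter, mem_shell]
    refine ⟨fun h => ⟨h, hx, by omega, (mem_shell.1 (hT h)).2.2⟩, fun h => h.1⟩
  · rfl

/-- If a charged component meets two far apart subshells, each with few centres, then one of the
subshells has more charged components. -/
lemma two_shells [DecidableEq V] (hc : Cfg Y X E r g) {s s' sa sa' sc sc' n : ℕ}
    (h1 : s ≤ sa) (h2 : sa + 4 * r < sa') (h3 : sa' ≤ sc) (h4 : sc + 4 * r < sc') (h5 : sc' ≤ s')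
    (hf : Free Y X E r g s s')
    (hb : ∀ x ∈ shell X g s s', Y.d x u0 + 6 * (2 * r + 4 * r * n) ≤ Y.W)
    (hna : (shell X g sa sa').card ≤ n) (hnc : (shell X g sc sc').card ≤ n)
    (hfar : Y.β * (2 * r + 4 * r * n) ≤ sc - sa')
    (hch : (Y.charged X E r g u0 s s').Nonempty) :
    (Y.charged X E r g u0 s s').card < (Y.charged X E r g u0 sa sa').card ∨
    (Y.charged X E r g u0 s s').card < (Y.charged X E r g u0 sc sc').card := by
  have hr := hc.hr
  have hb' : ∀ x ∈ shell X g s s', Y.d x u0 + r ≤ Y.W := by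
    intro x hx
    have := hb x hx
    have := Nat.zero_le (4 * r * n)
    omega
  obtain ⟨ia, ua⟩ := charged_inj hc (u0 := u0) h1 h2 (by omega) hf hb'
  obtain ⟨ic, uc⟩ := charged_inj hc (u0 := u0) (by omega) h4 h5 hf hb'
  by_contra hno
  push Not at hno
  have ua := ua hno.1
  have uc := uc hno.2
  obtain ⟨T, hT⟩ := hch
  obtain ⟨a₁, ha₁, ha₁T⟩ := charged_sub hc h1 h2 (by omega) hf hb' hT
  obtain ⟨c₁, hc₁, hc₁T⟩ := charged_sub hc (by omega) h4 h5 hf hb' hT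
  have hTc := comps_closed (mem_charged.1 hT).1
  have hma := (mem_charged.1 ha₁).1
  have hmc := (mem_charged.1 hc₁).1
  have hsa : shell X g sa sa' ⊆ shell X g s s' := shell_mono h1 (by omega)
  have hsc : shell X g sc sc' ⊆ shell X g s s' := shell_mono (by omega) h5
  have hsm : shell X g sa sc' ⊆ shell X g s s' := shell_mono h1 h5
  have ha₁' : a₁ ⊆ T ∩ shell X g sa sa' := Finset.subset_inter ha₁T (comps_sub hma)
  have hc₁' : c₁ ⊆ T ∩ shell X g sc sc' := Finset.subset_inter hc₁T (comps_sub hmc)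
  -- the lower flux
  have hA : Y.bot X E r g sa (T ∩ shell X g sa sa') - Y.bot X E r g sa a₁ ∈ Y.Ne u0 := by
    have hcl := closed_inter hsa hTc
    rw [bot_sum sa _ (fun C => C) _ (sy_comps hcl),
      ← Finset.add_sum_erase _ _ (Finset.mem_filter.2 ⟨hma, ha₁'⟩), add_sub_cancel_left]
    refine AddSubgroup.sum_mem _ fun C hC => ?_
    rw [Finset.mem_erase, Finset.mem_filter] at hC
    by_contra hn
    exact hC.1 (ua T hT C (mem_charged.2 ⟨hC.2.1, hn⟩) (hC.2.2.trans Finset.inter_subset_left)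
      a₁ ha₁ ha₁T)
  have hC : Y.top X E r g sc' (T ∩ shell X g sc sc') - Y.top X E r g sc' c₁ ∈ Y.Ne u0 := by
    have hcl := closed_inter hsc hTc
    rw [top_sum sc' _ (fun C => C) _ (sy_comps hcl),
      ← Finset.add_sum_erase _ _ (Finset.mem_filter.2 ⟨hmc, hc₁'⟩), add_sub_cancel_left]
    refine AddSubgroup.sum_mem _ fun C hC => ?_
    rw [Finset.mem_erase, Finset.mem_filter] at hC
    have hbt := sy_eq_bot_add_top hc h4 (hf.mono (by omega) h5) (comps_closed hC.2.1)
    have : Y.top X E r g sc' C = Y.sy E C - Y.bot X E r g sc C := by rw [hbt]; abel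
    rw [this]
    refine AddSubgroup.sub_mem _ (sy_mem hc hb' ((comps_sub hC.2.1).trans hsc)) ?_
    by_contra hn
    exact hC.1 (uc T hT C (mem_charged.2 ⟨hC.2.1, hn⟩) (hC.2.2.trans Finset.inter_subset_left)
      c₁ hc₁ hc₁T)
  have hmid := closed_inter hsm hTc
  have hfm := hf.mono h1 h5
  have hsum := sy_eq_bot_add_top hc (by omega) hfm hmid
  have hbm : Y.bot X E r g sa (T ∩ shell X g sa sc') = Y.bot X E r g sa (T ∩ shell X g sa sa') := by
    rw [bot_shift hc (le_refl sa) h2 (by omega) hfm hmid]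
    have e1 : (T ∩ shell X g sa sc').filter (fun x => g x < sa) = ∅ := by
      ext x
      simp only [Finset.mem_filter, Finset.mem_inter, mem_shell, Finset.notMem_empty, iff_false]
      omega
    have e2 : T ∩ shell X g sa sc' ∩ shell X g sa sa' = T ∩ shell X g sa sa' := by
      rw [Finset.inter_assoc, Finset.inter_eq_right.2 (shell_mono (le_refl _) (by omega))]
    rw [e1, e2]
    have : Y.sy E ∅ = 0 := by simp [sy]
    rw [this, zero_add]
  have htm : Y.top X E r g sc' (T ∩ shell X g sa sc') = Y.top X E r g sc' (T ∩ shell X g sc sc') := by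
    rw [top_inter hc h4 Finset.inter_subset_right (by omega), Finset.inter_assoc,
      Finset.inter_eq_right.2 (shell_mono (by omega) (le_refl _))]
  rw [hbm, htm] at hsum
  have hN : Y.bot X E r g sa a₁ + Y.top X E r g sc' c₁ ∈ Y.Ne u0 := by
    have h := AddSubgroup.sub_mem _ (AddSubgroup.sub_mem _
      (sy_mem hc hb' (hmid.1.trans hsm)) hA) hC
    rw [hsum] at h
    convert h using 1
    abel
  obtain ⟨F, hF, hFs⟩ := hN
  obtain ⟨u₁, hu₁⟩ := comps_nonempty hma
  obtain ⟨u₂, hu₂⟩ := comps_nonempty hmc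
  have hloc : ∀ (C U : Finset V), C ∈ Y.comps (4 * r) U → U ⊆ X → U.card ≤ n → ∀ u ∈ C, ∀ a,
      Y.sy E C a ≠ 0 → Y.d (Y.loc a) u ≤ 2 * r + 4 * r * n := by
    intro C U hC hU hn u hu a ha
    obtain ⟨x, hx, hnx⟩ := exists_near hc ((comps_sub hC).trans hU) ha
    refine (Y.tri _ x _).trans (Nat.add_le_add hnx ?_)
    exact (comps_diam hC hx hu).trans (Nat.mul_le_mul_left _ hn)
  obtain ⟨F', hF', hFs'⟩ := Y.H3 F u0 u₁ u₂ (2 * r + 4 * r * n) _ _ hF hFs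
    (by
      intro a ha
      refine hloc a₁ _ hma shell_sub hna u₁ hu₁ a ?_
      intro h; apply ha; simp [bot, h])
    (by
      intro a ha
      refine hloc c₁ _ hmc shell_sub hnc u₂ hu₂ a ?_
      intro h; apply ha; simp [top, h])
    (by omega)
    (by
      have g1 := (mem_shell.1 (comps_sub hma hu₁)).2.2
      have g2 := (mem_shell.1 (comps_sub hmc hu₂)).2.1
      have g3 := hc.hg u₂ u₁
      rw [Y.symm] at g3
      omega)
  apply (mem_charged.1 ha₁).2
  refine ⟨F', Y.B_mono _ _ _ _ (hb u₁ (hsa (comps_sub hma hu₁))) hF', hFs'⟩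

lemma exists_pair (Gd : Finset ℕ) (m : ℕ) (h : m + 1 ≤ Gd.card) :
    ∃ a ∈ Gd, ∃ c ∈ Gd, a + m ≤ c := by
  have hne : Gd.Nonempty := Finset.card_pos.1 (by omega)
  refine ⟨Gd.min' hne, Gd.min'_mem hne, Gd.max' hne, Gd.max'_mem hne, ?_⟩
  have : Gd ⊆ Finset.Icc (Gd.min' hne) (Gd.max' hne) := fun x hx =>
    Finset.mem_Icc.2 ⟨Gd.min'_le x hx, Gd.le_max' x hx⟩
  have := Finset.card_le_card this
  rw [Nat.card_Icc] at this
  omega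

/-- one descent step -/
lemma descent [DecidableEq V] (hc : Cfg Y X E r g) {s J b m i : ℕ} (hJ : 1 ≤ J) (hi : i + 1 ≤ J)
    (hm : m = Y.β * J + 1) (hbm : b = 2 * J * (m + 1))
    (hf : Free Y X E r g s (s + 8 * r * b ^ (i + 1)))
    (hb : ∀ x ∈ shell X g s (s + 8 * r * b ^ (i + 1)), Y.d x u0 + 36 * r * J * b ^ J ≤ Y.W)
    (hcard : 2 * (shell X g s (s + 8 * r * b ^ (i + 1))).card ≤ b ^ (i + 1) * (2 * J - (i + 1)))
    (hch : (Y.charged X E r g u0 s (s + 8 * r * b ^ (i + 1))).Nonempty) :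
    ∃ t, s ≤ t ∧ t + 8 * r * b ^ i ≤ s + 8 * r * b ^ (i + 1) ∧
      2 * (shell X g t (t + 8 * r * b ^ i)).card ≤ b ^ i * (2 * J - i) ∧
      (Y.charged X E r g u0 s (s + 8 * r * b ^ (i + 1))).card <
        (Y.charged X E r g u0 t (t + 8 * r * b ^ i)).card := by
  have hr := hc.hr
  have hbpos : 1 ≤ b := by rw [hbm]; nlinarith [Nat.zero_le (J * m)]
  have hbi : 1 ≤ b ^ i := Nat.one_le_pow _ _ hbpos
  set th := 8 * r * b ^ i with hth
  have hth8 : 8 * r ≤ th := by rw [hth]; nlinarith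
  have hthb : 8 * r * b ^ (i + 1) = b * th := by rw [hth, pow_succ]; ring
  rw [hthb] at hf hb hcard hch ⊢
  set f : ℕ → Finset V := fun j => shell X g (s + j * th) (s + j * th + th) with hfdef
  have hsub : ∀ j ∈ Finset.range b, f j ⊆ shell X g s (s + b * th) := by
    intro j hj
    rw [Finset.mem_range] at hj
    have : (j + 1) * th ≤ b * th := Nat.mul_le_mul_right _ hj
    exact shell_mono (by omega) (by rw [add_mul] at this; omega)
  have hsumcard : ∑ j ∈ Finset.range b, (f j).card ≤ (shell X g s (s + b * th)).card := by
    rw [← Finset.card_biUnion]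
    · exact Finset.card_le_card (Finset.biUnion_subset.2 hsub)
    · intro j hj j' hj' hne
      rw [Function.onFun, Finset.disjoint_left]
      intro x hx hx'
      rw [hfdef] at hx hx'
      have h1 := (mem_shell.1 hx).2
      have h2 := (mem_shell.1 hx').2
      rcases Nat.lt_or_gt_of_ne hne with h | h
      · have := Nat.mul_le_mul_right th (Nat.succ_le_of_lt h)
        rw [Nat.succ_mul] at this; omega
      · have := Nat.mul_le_mul_right th (Nat.succ_le_of_lt h)
        rw [Nat.succ_mul] at this; omega
  set Gd := (Finset.range b).filter fun j => 2 * (f j).card ≤ b ^ i * (2 * J - i) with hGd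
  set Bd := (Finset.range b).filter fun j => ¬ 2 * (f j).card ≤ b ^ i * (2 * J - i) with hBd
  have hGB : Gd.card + Bd.card = b := by
    rw [hGd, hBd, Finset.card_filter_add_card_filter_not, Finset.card_range]
  have hBdc : Bd.card * (b ^ i * (2 * J - i)) ≤ b ^ (i + 1) * (2 * J - (i + 1)) := by
    refine le_trans ?_ hcard
    refine le_trans ?_ (Nat.mul_le_mul_left 2 hsumcard)
    rw [Finset.mul_sum]
    refine le_trans ?_ (Finset.sum_le_sum_of_subset (Finset.filter_subset _ _ : Bd ⊆ _))
    rw [← smul_eq_mul]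
    refine Finset.card_nsmul_le_sum _ _ _ fun j hj => ?_
    have := (Finset.mem_filter.1 hj).2
    omega
  have hBdc' : Bd.card * (2 * J - i) ≤ b * (2 * J - (i + 1)) := by
    refine Nat.le_of_mul_le_mul_left ?_ (show 0 < b ^ i from hbi)
    calc b ^ i * (Bd.card * (2 * J - i)) = Bd.card * (b ^ i * (2 * J - i)) := by ring
      _ ≤ _ := hBdc
      _ = _ := by rw [pow_succ]; ring
  have hGdc : m + 1 ≤ Gd.card := by
    obtain ⟨k, hk⟩ : ∃ k, 2 * J = i + 1 + k := ⟨2 * J - (i + 1), by omega⟩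
    have e1 : 2 * J - i = k + 1 := by omega
    have e2 : 2 * J - (i + 1) = k := by omega
    rw [e1, e2] at hBdc'
    have h3 : b ≤ Gd.card * (k + 1) := by
      rw [← hGB] at hBdc' ⊢
      nlinarith
    have h4 : Gd.card * (k + 1) ≤ Gd.card * (2 * J) := Nat.mul_le_mul_left _ (by omega)
    have h5 : (m + 1) * (2 * J) ≤ Gd.card * (2 * J) := by
      calc (m + 1) * (2 * J) = b := by rw [hbm]; ring
        _ ≤ _ := h3.trans h4
    exact Nat.le_of_mul_le_mul_right h5 (by omega)
  obtain ⟨a, ha, c, hcc, hac⟩ := exists_pair Gd m hGdc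
  have ha' := Finset.mem_filter.1 ha
  have hc' := Finset.mem_filter.1 hcc
  have hn : ∀ j, 2 * (f j).card ≤ b ^ i * (2 * J - i) → (f j).card ≤ b ^ i * J := by
    intro j hj
    have : b ^ i * (2 * J - i) ≤ b ^ i * (2 * J) := Nat.mul_le_mul_left _ (by omega)
    nlinarith
  have hac1 : a * th + m * th ≤ c * th := by rw [← add_mul]; exact Nat.mul_le_mul_right _ hac
  have hcb : c * th + th ≤ b * th := by
    have := Nat.mul_le_mul_right th (Nat.succ_le_of_lt (Finset.mem_range.1 hc'.1))
    rwa [Nat.succ_mul] at this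
  have hm1 : m * th = Y.β * J * th + th := by rw [hm]; ring
  have hρ : 2 * r + 4 * r * (b ^ i * J) ≤ 6 * r * J * b ^ i := by
    have : r ≤ r * (J * b ^ i) := Nat.le_mul_of_pos_right _ (Nat.mul_pos hJ hbi)
    calc 2 * r + 4 * r * (b ^ i * J) ≤ 2 * (r * (J * b ^ i)) + 4 * r * (b ^ i * J) := by omega
      _ = 6 * r * J * b ^ i := by ring
  have h36 : 6 * (6 * r * J * b ^ i) ≤ 36 * r * J * b ^ J := by
    have : b ^ i ≤ b ^ J := Nat.pow_le_pow_right hbpos (by omega)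
    calc 6 * (6 * r * J * b ^ i) = 36 * r * J * b ^ i := by ring
      _ ≤ _ := Nat.mul_le_mul_left _ this
  have hres := two_shells hc (u0 := u0) (s := s) (s' := s + b * th) (sa := s + a * th)
    (sa' := s + a * th + th) (sc := s + c * th) (sc' := s + c * th + th) (n := b ^ i * J)
    (by omega) (by omega) (by omega) (by omega) (by omega) hf
    (by intro x hx; have := hb x hx; omega) (hn a ha'.2) (hn c hc'.2)
    (by
      refine (Nat.mul_le_mul_left _ hρ).trans ?_
      have : Y.β * (6 * r * J * b ^ i) ≤ Y.β * J * th := by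
        calc Y.β * (6 * r * J * b ^ i) = 6 * (Y.β * r * J * b ^ i) := by ring
          _ ≤ 8 * (Y.β * r * J * b ^ i) := Nat.mul_le_mul_right _ (by norm_num)
          _ = _ := by rw [hth]; ring
      omega) hch
  rcases hres with h | h
  · exact ⟨s + a * th, by omega, by omega, ha'.2, h⟩
  · exact ⟨s + c * th, by omega, by omega, hc'.2, h⟩

/-- The local lemma: all fluxes of components of a sparse shell are neutral. -/
lemma local_lemma [DecidableEq V] (hc : Cfg Y X E r g) {s J b : ℕ} (hJ : 1 ≤ J)
    (hbm : b = 2 * J * (Y.β * J + 2))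
    (hf : Free Y X E r g s (s + 8 * r * b ^ J))
    (hb : ∀ x ∈ shell X g s (s + 8 * r * b ^ J), Y.d x u0 + 36 * r * J * b ^ J ≤ Y.W)
    (hcard : 2 * (shell X g s (s + 8 * r * b ^ J)).card ≤ b ^ J * J) :
    ∀ T ∈ Y.comps (4 * r) (shell X g s (s + 8 * r * b ^ J)),
      Y.top X E r g (s + 8 * r * b ^ J) T ∈ Y.Ne u0 := by
  have hr := hc.hr
  have hbpos : 1 ≤ b := by rw [hbm]; nlinarith [Nat.zero_le (J * (Y.β * J))]
  have hbJ : 1 ≤ b ^ J := Nat.one_le_pow _ _ hbpos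
  have hemp : Y.charged X E r g u0 s (s + 8 * r * b ^ J) = ∅ := by
    by_contra hne
    have hne := Finset.nonempty_iff_ne_empty.2 hne
    have key : ∀ n ≤ J, ∃ t, s ≤ t ∧ t + 8 * r * b ^ (J - n) ≤ s + 8 * r * b ^ J ∧
        2 * (shell X g t (t + 8 * r * b ^ (J - n))).card ≤ b ^ (J - n) * (2 * J - (J - n)) ∧
        n + 1 ≤ (Y.charged X E r g u0 t (t + 8 * r * b ^ (J - n))).card := by
      intro n
      induction n with
      | zero =>
        intro _
        refine ⟨s, le_refl _, by simp, ?_, ?_⟩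
        · have : 2 * J - J = J := by omega
          simpa [this] using hcard
        · simpa using Finset.card_pos.2 hne
      | succ n ih =>
        intro hn
        obtain ⟨t, ht1, ht2, ht3, ht4⟩ := ih (by omega)
        have e : J - n = (J - (n + 1)) + 1 := by omega
        rw [e] at ht2 ht3 ht4
        obtain ⟨t', h1, h2, h3, h4⟩ := descent hc (u0 := u0) hJ (i := J - (n + 1)) (by omega) rfl
          (by rw [hbm]) (hf.mono ht1 ht2) (fun x hx => hb x (shell_mono ht1 ht2 hx)) ht3
          (Finset.card_pos.1 (by omega))
        exact ⟨t', by omega, by omega, h3, by omega⟩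
    obtain ⟨t, _, _, h3, h4⟩ := key J le_rfl
    simp only [Nat.sub_self, pow_zero, one_mul, mul_one, Nat.sub_zero] at h3 h4
    have h5 : (Y.charged X E r g u0 t (t + 8 * r)).card ≤ (shell X g t (t + 8 * r)).card :=
      charged_card_le
    omega
  intro T hT
  have hbt := sy_eq_bot_add_top hc (by nlinarith) hf (comps_closed hT)
  have : Y.top X E r g (s + 8 * r * b ^ J) T = Y.sy E T - Y.bot X E r g s T := by rw [hbt]; abel
  rw [this]
  refine AddSubgroup.sub_mem _ (sy_mem hc ?_ (comps_sub hT)) ?_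
  · intro x hx
    have := hb x hx
    have : r * 1 ≤ r * (36 * J * b ^ J) := Nat.mul_le_mul_left _ (by nlinarith)
    nlinarith
  · by_contra hn
    have : T ∈ Y.charged X E r g u0 s (s + 8 * r * b ^ J) := mem_charged.2 ⟨hT, hn⟩
    rw [hemp] at this
    exact absurd this (Finset.notMem_empty _)

end Sys
end BH

open Finset
namespace BH
namespace Sys
variable {V A Pa : Type} [AddCommGroup Pa]

/-! ### Cleaning out a ball -/

/-- Numerical parameters of the cleaning step. -/
structure Par (Y : Sys V A Pa) (r J b w q k ρ e E0 n Np M : ℕ) : Prop where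
  hr : 1 ≤ r
  hJ : 1 ≤ J
  hb : b = 2 * J * (Y.β * J + 2)
  hw : w = 8 * r * b ^ J
  hk : 2 * k ≤ b ^ J * J
  hq : q = n * w
  hρ : 6 * (2 * r + 4 * r * k) ≤ ρ
  he : ρ + 10 * r ≤ e
  heq : e ≤ q
  heE : e ≤ E0 * w
  hn : 2 * (Np * k * (2 * E0 + 2)) < n
  hM : 2 * M ≤ n * (k + 1)
  hW : 2 * q + ρ + 36 * r * J * b ^ J ≤ Y.W
  pack : ∀ (Ys : Finset V) (y : V), (∀ u ∈ Ys, Y.d u y ≤ 8 * q) →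
    (∀ u ∈ Ys, ∀ v ∈ Ys, u ≠ v → q ≤ Y.d u v) → Ys.card ≤ Np

/-- State of the sequential cleaning. -/
structure Inv [DecidableEq V] (Y : Sys V A Pa) (P : Pa) (X : Finset V) (E : V → Pa)
    (r q k ρ : ℕ) (Xt : Finset V)
    (Jk : Finset (V × V)) (F : V × V → Pa) : Prop where
  sub : Xt ⊆ X
  dz : ∀ p ∈ Jk, Y.d p.1 p.2 ≤ 4 * q
  FB : ∀ p ∈ Jk, F p ∈ Y.B p.2 ρ
  nr : ∀ p ∈ Jk, ∀ a, Y.σ (F p) a ≠ 0 → ∃ x ∈ Xt, Y.near r a x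
  sep : ∀ p ∈ Jk, ∀ p' ∈ Jk, p.1 ≠ p'.1 → q ≤ Y.d p.1 p'.1
  sepX : ∀ p ∈ Jk, ∀ x ∈ Xt, q ≤ Y.d p.1 x
  few : ∀ y, (Jk.filter fun p => p.1 = y).card ≤ k
  eqv : P - ∑ x ∈ Xt, E x - ∑ p ∈ Jk, F p ∈ Y.stab

variable {Y : Sys V A Pa} {X : Finset V} {E : V → Pa} {P : Pa}
  {r J b w q k ρ e E0 n Np M : ℕ}

/-- number of multiples of `w` in an interval -/
lemma slot_count (w q c E0 e n : ℕ) (hw : 1 ≤ w) (he : e ≤ E0 * w) :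
    ((Finset.range n).filter fun j => ¬ (c + e < q + j * w ∨ q + j * w + w + e < c)).card
      ≤ 2 * E0 + 2 := by
  set Sx := (Finset.range n).filter fun j => ¬ (c + e < q + j * w ∨ q + j * w + w + e < c)
  by_cases hne : Sx.Nonempty
  · have h0 := (Finset.mem_filter.1 (Sx.min'_mem hne)).2
    have : Sx ⊆ Finset.Icc (Sx.min' hne) (Sx.min' hne + (2 * E0 + 1)) := by
      intro j hj
      rw [Finset.mem_Icc]
      refine ⟨Sx.min'_le j hj, ?_⟩
      have h1 := (Finset.mem_filter.1 hj).2
      push Not at h0 h1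
      have h2 : j * w ≤ Sx.min' hne * w + w + 2 * (E0 * w) := by omega
      have h3 : j * w ≤ (Sx.min' hne + (2 * E0 + 1)) * w := by
        refine h2.trans (le_of_eq ?_); ring
      exact Nat.le_of_mul_le_mul_right h3 hw
    have := Finset.card_le_card this
    rw [Nat.card_Icc] at this
    omega
  · rw [Finset.not_nonempty_iff_eq_empty.1 hne]; simp

/-- choice of a good slot -/
lemma exists_slot [DecidableEq V] (hp : Par Y r J b w q k ρ e E0 n Np M) {Xt : Finset V}
    {Jk : Finset (V × V)} {F : V × V → Pa} (hI : Inv Y P X E r q k ρ Xt Jk F) (y : V)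
    (hl : (X.filter fun x => Y.d x y ≤ 4 * q).card < M) :
    ∃ s, q ≤ s ∧ s + w ≤ 2 * q ∧ (shell Xt (fun x => Y.d x y) s (s + w)).card ≤ k ∧
      ∀ p ∈ Jk, Y.d p.2 y + e < s ∨ s + w + e < Y.d p.2 y := by
  classical
  have hbpos : 1 ≤ b := by
    rw [hp.hb]; nlinarith [Nat.zero_le (J * (Y.β * J)), hp.hJ]
  have hw1 : 1 ≤ w := by
    rw [hp.hw]; have := Nat.one_le_pow J _ hbpos; nlinarith [hp.hr]
  have heq := hp.heq
  set f : ℕ → Finset V := fun j => shell Xt (fun x => Y.d x y) (q + j * w) (q + j * w + w)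
    with hf
  have hjw : ∀ j < n, j * w + w ≤ q := by
    intro j hj
    rw [hp.hq]
    have := Nat.mul_le_mul_right w (Nat.succ_le_of_lt hj)
    rwa [Nat.succ_mul] at this
  -- crowded slots
  set B1 := (Finset.range n).filter fun j => ¬ (f j).card ≤ k with hB1
  have hB1c : 2 * B1.card < n := by
    have h1 : ∑ j ∈ B1, (f j).card ≤ (X.filter fun x => Y.d x y ≤ 4 * q).card := by
      rw [← Finset.card_biUnion]
      · refine Finset.card_le_card (Finset.biUnion_subset.2 fun j hj x hx => ?_)
        have h2 := mem_shell.1 hx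
        have h3 := hjw j (Finset.mem_range.1 (Finset.mem_filter.1 hj).1)
        exact Finset.mem_filter.2 ⟨hI.sub h2.1, by omega⟩
      · intro j hj j' hj' hne
        rw [Function.onFun, Finset.disjoint_left]
        intro x hx hx'
        rw [hf] at hx hx'
        have h1 := (mem_shell.1 hx).2
        have h2 := (mem_shell.1 hx').2
        rcases Nat.lt_or_gt_of_ne hne with h | h
        · have := Nat.mul_le_mul_right w (Nat.succ_le_of_lt h)
          rw [Nat.succ_mul] at this; omega
        · have := Nat.mul_le_mul_right w (Nat.succ_le_of_lt h)
          rw [Nat.succ_mul] at this; omega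
    have h2 : B1.card * (k + 1) ≤ ∑ j ∈ B1, (f j).card := by
      rw [← smul_eq_mul]
      refine Finset.card_nsmul_le_sum _ _ _ fun j hj => ?_
      have := (Finset.mem_filter.1 hj).2
      omega
    have h3 := hp.hM
    have h4 : 2 * B1.card * (k + 1) < n * (k + 1) := by
      have : 2 * B1.card * (k + 1) = 2 * (B1.card * (k + 1)) := by ring
      omega
    exact Nat.lt_of_mul_lt_mul_right h4
  -- relevant junk
  set Jr := Jk.filter fun p => Y.d p.2 y ≤ 3 * q with hJr
  have hJrc : Jr.card ≤ Np * k := by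
    have h1 : (Jr.image Prod.fst).card ≤ Np := by
      refine hp.pack _ y ?_ ?_
      · intro u hu
        obtain ⟨p, hpm, rfl⟩ := Finset.mem_image.1 hu
        have hpm := Finset.mem_filter.1 hpm
        have := Y.tri p.1 p.2 y
        have := hI.dz p hpm.1
        omega
      · intro u hu v hv hne
        obtain ⟨p, hpm, rfl⟩ := Finset.mem_image.1 hu
        obtain ⟨p', hpm', rfl⟩ := Finset.mem_image.1 hv
        exact hI.sep p (Finset.mem_filter.1 hpm).1 p' (Finset.mem_filter.1 hpm').1 hne
    have h2 := Finset.card_le_mul_card_image (f := Prod.fst) Jr k (fun y' _ =>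
      (Finset.card_le_card (Finset.filter_subset_filter _ (Finset.filter_subset _ _))).trans
        (hI.few y'))
    calc Jr.card ≤ k * (Jr.image Prod.fst).card := h2
      _ ≤ k * Np := Nat.mul_le_mul_left _ h1
      _ = _ := mul_comm _ _
  set B2 := Jr.biUnion fun p => (Finset.range n).filter fun j =>
    ¬ (Y.d p.2 y + e < q + j * w ∨ q + j * w + w + e < Y.d p.2 y) with hB2
  have hB2c : 2 * B2.card < n := by
    refine lt_of_le_of_lt (Nat.mul_le_mul_left 2 ?_) hp.hn
    exact (Finset.card_biUnion_le_card_mul _ _ _ fun p _ =>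
      slot_count w q _ E0 e n hw1 hp.heE).trans (Nat.mul_le_mul_right _ hJrc)
  obtain ⟨j, hj, hjB⟩ : ∃ j ∈ Finset.range n, j ∉ B1 ∪ B2 := by
    by_contra hno
    push Not at hno
    have h1 := Finset.card_le_card (show Finset.range n ⊆ B1 ∪ B2 from hno)
    have h2 := Finset.card_union_le B1 B2
    rw [Finset.card_range] at h1
    omega
  rw [Finset.mem_union, not_or] at hjB
  have hjn := hjw j (Finset.mem_range.1 hj)
  refine ⟨q + j * w, by omega, by omega, ?_, ?_⟩
  · by_contra hcon
    exact hjB.1 (Finset.mem_filter.2 ⟨hj, hcon⟩)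
  · intro p hpm
    by_contra hcon
    by_cases hfar : Y.d p.2 y ≤ 3 * q
    · exact hjB.2 (Finset.mem_biUnion.2 ⟨p, Finset.mem_filter.2 ⟨hpm, hfar⟩,
        Finset.mem_filter.2 ⟨hj, hcon⟩⟩)
    · apply hcon; right; omega

lemma sum_top [DecidableEq V] {g : V → ℕ} {l : ℕ} {U : Finset V} (s : ℕ) :
    ∑ T ∈ Y.comps l U, Y.top X E r g s T = Y.top X E r g s U := by
  classical
  have hcl : Closed Y l U U := ⟨Finset.Subset.refl _, fun _ _ z hz _ => hz⟩
  rw [top_sum s _ (fun C => C) _ (sy_comps hcl)]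
  refine Finset.sum_congr ?_ fun _ _ => rfl
  rw [Finset.filter_true_of_mem]
  intro T hT
  exact comps_sub hT

/-- one cleaning step -/
lemma clean_one [DecidableEq V] (hp : Par Y r J b w q k ρ e E0 n Np M) (hP : Y.σ P = 0)
    (hE : ∀ x ∈ X, E x ∈ Y.B x r) {Xt : Finset V}
    {Jk : Finset (V × V)} {F : V × V → Pa} (hI : Inv Y P X E r q k ρ Xt Jk F) (y : V)
    (hy : y ∈ Xt) (hl : (X.filter fun x => Y.d x y ≤ 4 * q).card < M) :
    ∃ Xt' Jk' F', Inv Y P X E r q k ρ Xt' Jk' F' ∧ Xt'.card < Xt.card := by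
  classical
  obtain ⟨s, hs1, hs2, hsc, hsj⟩ := exists_slot hp hI y hl
  have hr := hp.hr
  have he := hp.he
  have heq := hp.heq
  have hW := hp.hW
  have hρ := hp.hρ
  have hbpos : 1 ≤ b := by
    rw [hp.hb]; nlinarith [Nat.zero_le (J * (Y.β * J)), hp.hJ]
  have hw8 : 8 * r ≤ w := by
    rw [hp.hw]; exact Nat.le_mul_of_pos_right _ (Nat.one_le_pow J _ hbpos)
  set g : V → ℕ := fun x => Y.d x y with hg
  have hc : Cfg Y Xt E r g := by
    refine ⟨hr, fun x hx => hE x (hI.sub hx), fun x x' => ?_⟩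
    have := Y.tri x x' y
    simp only [hg]; omega
  -- positions of defects of junk
  have hjd : ∀ p ∈ Jk, ∀ a, Y.σ (F p) a ≠ 0 → ∀ x, Y.near r a x →
      g x ≤ Y.d p.2 y + ρ + 1 + 2 * r ∧ Y.d p.2 y ≤ g x + ρ + 1 + 2 * r := by
    intro p hpm a ha x hx
    have h1 := Y.isLocal _ _ _ _ (hI.FB p hpm) ha
    have h2 : Y.d (Y.loc a) x ≤ 2 * r := hx
    have h3 := Y.tri x (Y.loc a) y
    have h4 := Y.tri (Y.loc a) p.2 y
    have h5 := Y.tri p.2 (Y.loc a) y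
    have h6 := Y.tri (Y.loc a) x y
    rw [Y.symm x (Y.loc a)] at h3
    rw [Y.symm p.2 (Y.loc a)] at h5
    simp only [hg]; omega
  have hPa : ∀ a, Y.sy E Xt a + ∑ p ∈ Jk, Y.σ (F p) a = 0 := by
    intro a
    have h := congrFun (Y.stab_syn _ hI.eqv) a
    rw [map_sub, map_sub, hP, map_sum Y.σ F] at h
    simp only [Pi.sub_apply, Pi.zero_apply, Finset.sum_apply] at h
    have h' : Y.sy E Xt a + ∑ p ∈ Jk, Y.σ (F p) a =
      - (0 - Y.σ (∑ x ∈ Xt, E x) a - ∑ p ∈ Jk, Y.σ (F p) a) := by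
      simp only [sy]; ring
    rw [h', h, neg_zero]
  have hf : Free Y Xt E r g s (s + w) := by
    intro a x hx hn
    have h := hPa a
    rw [Finset.sum_eq_zero, add_zero] at h
    · exact h
    · intro p hpm
      by_contra hne
      have h1 := hjd p hpm a hne x hn
      have h2 := mem_shell.1 hx
      rcases hsj p hpm with h3 | h3 <;> omega
  set U := shell Xt g s (s + w) with hU
  have hUy : ∀ x ∈ U, Y.d x y < s + w := fun x hx => (mem_shell.1 hx).2.2
  have htop : ∀ T ∈ Y.comps (4 * r) U, Y.top Xt E r g (s + w) T ∈ Y.Ne y := by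
    have := local_lemma hc (u0 := y) (s := s) hp.hJ hp.hb
    rw [← hp.hw] at this
    refine this hf ?_ ?_
    · intro x hx
      have := hUy x hx
      omega
    · exact (Nat.mul_le_mul_left 2 hsc).trans hp.hk
  have hch : ∀ T : Finset V, ∃ z : V, ∃ f : Pa, T ∈ Y.comps (4 * r) U →
      z ∈ T ∧ f ∈ Y.B z ρ ∧ Y.σ f = Y.top Xt E r g (s + w) T := by
    intro T
    by_cases hT : T ∈ Y.comps (4 * r) U
    · obtain ⟨z, hz⟩ := comps_nonempty hT
      obtain ⟨f0, hf0, hf0s⟩ := htop T hT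
      obtain ⟨f, hfB, hfs⟩ := Y.H2 f0 y z (2 * r + 4 * r * k) hf0 (by
        intro a ha
        rw [hf0s] at ha
        have ha' : Y.sy E T a ≠ 0 := by
          intro h; apply ha; simp [top, h]
        obtain ⟨x, hx, hnx⟩ := exists_near hc ((comps_sub hT).trans shell_sub) ha'
        refine (Y.tri _ x _).trans (Nat.add_le_add hnx ?_)
        exact (comps_diam hT hx hz).trans (Nat.mul_le_mul_left _ hsc)) (by omega)
      refine ⟨z, f, fun _ => ⟨hz, ?_, hfs.trans hf0s⟩⟩
      exact Y.B_mono z z _ _ (by rw [Y.d_self]; omega) hfB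
    · exact ⟨y, 0, fun h => absurd h hT⟩
  choose zT fT hzf using hch
  set cell := Xt.filter fun x => g x < s + w with hcell
  set rest := Xt.filter fun x => ¬ g x < s + w with hrest
  set inn := Jk.filter fun p => Y.d p.2 y + e < s with hinn
  set out := Jk.filter fun p => ¬ Y.d p.2 y + e < s with hout
  have houtd : ∀ p ∈ out, p ∈ Jk ∧ s + w + e < Y.d p.2 y := by
    intro p hpm
    have h := Finset.mem_filter.1 hpm
    rcases hsj p h.1 with h3 | h3
    · exact absurd h3 h.2
    · exact ⟨h.1, h3⟩
  -- the inner operator is a stabilizer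
  set O := ∑ x ∈ cell, E x + ∑ p ∈ inn, F p - ∑ T ∈ Y.comps (4 * r) U, fT T with hO
  have hOsyn : Y.σ O = 0 := by
    funext a
    have e1 : Y.σ O a = Y.sy E cell a + ∑ p ∈ inn, Y.σ (F p) a - Y.top Xt E r g (s + w) U a := by
      rw [hO, map_sub, map_add, map_sum Y.σ F, map_sum Y.σ fT, ← sum_top (l := 4 * r)]
      simp only [Pi.sub_apply, Pi.add_apply, Finset.sum_apply]
      rw [Finset.sum_congr rfl fun T hT => congrFun (hzf T hT).2.2 a]
      rfl
    rw [e1]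
    by_cases hhi : Y.hi Xt r g (s + w) a
    · have e2 : Y.top Xt E r g (s + w) U a = Y.sy E U a := by simp [top, hhi]
      obtain ⟨x, hx, hn, hgx⟩ := hhi
      have e3 : Y.sy E cell a = Y.sy E U a := by
        refine sy_agree hc (Finset.filter_subset _ _) shell_sub fun x' hx' hn' => ?_
        have := near_g hc hn hn'
        rw [mem_shell, Finset.mem_filter]
        constructor
        · rintro ⟨h1, h2⟩; exact ⟨h1, by omega, h2⟩
        · rintro ⟨h1, _, h2⟩; exact ⟨h1, h2⟩
      have e4 : ∑ p ∈ inn, Y.σ (F p) a = 0 := by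
        refine Finset.sum_eq_zero fun p hpm => ?_
        by_contra hne
        have h := Finset.mem_filter.1 hpm
        have h1 := hjd p h.1 a hne x hn
        omega
      rw [e2, e3, e4]; simp
    · have e2 : Y.top Xt E r g (s + w) U a = 0 := by simp [top, hhi]
      have e3 : Y.sy E cell a = Y.sy E Xt a := by
        refine sy_agree hc (Finset.filter_subset _ _) (Finset.Subset.refl _) fun x' hx' hn' => ?_
        rw [Finset.mem_filter]
        refine ⟨fun h => h.1, fun h => ⟨h, ?_⟩⟩
        by_contra hlt
        exact hhi ⟨x', h, hn', by omega⟩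
      have e4 : ∑ p ∈ inn, Y.σ (F p) a = ∑ p ∈ Jk, Y.σ (F p) a := by
        refine Finset.sum_filter_of_ne fun p hpm hne => ?_
        rcases hsj p hpm with h3 | h3
        · exact h3
        · exfalso
          obtain ⟨x, hx, hn⟩ := hI.nr p hpm a hne
          have h1 := hjd p hpm a hne x hn
          have : g x < s + w := by
            by_contra hlt
            exact hhi ⟨x, hx, hn, by omega⟩
          omega
      rw [e2, e3, e4, sub_zero, hPa a]; rfl
  have hOB : O ∈ Y.B y Y.W := by
    refine AddSubgroup.sub_mem _ (AddSubgroup.add_mem _ ?_ ?_) ?_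
    · refine AddSubgroup.sum_mem _ fun x hx => ?_
      have h := Finset.mem_filter.1 hx
      refine Y.B_mono _ _ _ _ ?_ (hc.hE x h.1)
      have h2 : Y.d x y < s + w := h.2
      omega
    · refine AddSubgroup.sum_mem _ fun p hpm => ?_
      have h := Finset.mem_filter.1 hpm
      exact Y.B_mono _ _ _ _ (by omega) (hI.FB p h.1)
    · refine AddSubgroup.sum_mem _ fun T hT => ?_
      have h := hzf T hT
      refine Y.B_mono _ _ _ _ ?_ h.2.1
      have := hUy _ (comps_sub hT h.1)
      omega
  have hOst := Y.H1 O y hOB hOsyn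
  -- new state
  have hyJ : ∀ p ∈ Jk, p.1 ≠ y := by
    intro p hpm h
    have h1 := hI.sepX p hpm y hy
    rw [h, Y.d_self] at h1
    omega
  set F' : V × V → Pa := fun p => if p.1 = y then fT (Y.comp (4 * r) U p.2) else F p with hF'
  set nw := (Y.comps (4 * r) U).image fun T => (y, zT T) with hnw
  have hnwm : ∀ p ∈ nw, ∃ T ∈ Y.comps (4 * r) U, p = (y, zT T) ∧ F' p = fT T := by
    intro p hpm
    obtain ⟨T, hT, rfl⟩ := Finset.mem_image.1 hpm
    refine ⟨T, hT, rfl, ?_⟩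
    simp only [hF', if_true]
    rw [← comps_eq hT (hzf T hT).1]
  have hrestm : ∀ x ∈ rest, x ∈ Xt ∧ s + w ≤ Y.d x y := by
    intro x hx
    have h := Finset.mem_filter.1 hx
    exact ⟨h.1, not_lt.1 h.2⟩
  have houtF : ∀ p ∈ out, F' p = F p := by
    intro p hpm
    simp only [hF', if_neg (hyJ p (houtd p hpm).1)]
  refine ⟨rest, out ∪ nw, F', ⟨(Finset.filter_subset _ _).trans hI.sub, ?_, ?_, ?_, ?_, ?_, ?_, ?_⟩,
    ?_⟩
  · intro p hpm
    rcases Finset.mem_union.1 hpm with h | h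
    · exact hI.dz p (houtd p h).1
    · obtain ⟨T, hT, rfl, _⟩ := hnwm p h
      have := hUy _ (comps_sub hT (hzf T hT).1)
      rw [Y.symm] at this
      simp only
      omega
  · intro p hpm
    rcases Finset.mem_union.1 hpm with h | h
    · rw [houtF p h]; exact hI.FB p (houtd p h).1
    · obtain ⟨T, hT, rfl, h2⟩ := hnwm p h
      rw [h2]; exact (hzf T hT).2.1
  · intro p hpm a ha
    rcases Finset.mem_union.1 hpm with h | h
    · rw [houtF p h] at ha
      obtain ⟨h1, h2⟩ := houtd p h
      obtain ⟨x, hx, hn⟩ := hI.nr p h1 a ha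
      have h3 := hjd p h1 a ha x hn
      exact ⟨x, Finset.mem_filter.2 ⟨hx, by omega⟩, hn⟩
    · obtain ⟨T, hT, rfl, h2⟩ := hnwm p h
      rw [h2, (hzf T hT).2.2] at ha
      have hhi : Y.hi Xt r g (s + w) a := by
        by_contra hhi; apply ha; simp [top, hhi]
      obtain ⟨x, hx, hn, hgx⟩ := hhi
      exact ⟨x, Finset.mem_filter.2 ⟨hx, by omega⟩, hn⟩
  · intro p hpm p' hpm' hne
    rcases Finset.mem_union.1 hpm with h | h <;> rcases Finset.mem_union.1 hpm' with h' | h'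
    · exact hI.sep p (houtd p h).1 p' (houtd p' h').1 hne
    · obtain ⟨T, hT, rfl, _⟩ := hnwm p' h'
      exact hI.sepX p (houtd p h).1 y hy
    · obtain ⟨T, hT, rfl, _⟩ := hnwm p h
      rw [Y.symm]
      exact hI.sepX p' (houtd p' h').1 y hy
    · obtain ⟨T, hT, rfl, _⟩ := hnwm p h
      obtain ⟨T', hT', rfl, _⟩ := hnwm p' h'
      exact absurd rfl hne
  · intro p hpm x hx
    rcases Finset.mem_union.1 hpm with h | h
    · exact hI.sepX p (houtd p h).1 x (hrestm x hx).1
    · obtain ⟨T, hT, rfl, _⟩ := hnwm p h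
      have := (hrestm x hx).2
      rw [Y.symm] at this
      simp only
      omega
  · intro y'
    rw [Finset.filter_union]
    by_cases hyy : y' = y
    · subst hyy
      have e1 : out.filter (fun p => p.1 = y') = ∅ := by
        rw [Finset.filter_eq_empty_iff]
        intro p hpm
        exact hyJ p (houtd p hpm).1
      rw [e1, Finset.empty_union]
      refine (Finset.card_le_card (Finset.filter_subset _ _)).trans ?_
      exact Finset.card_image_le.trans (comps_card_le.trans hsc)
    · have e1 : nw.filter (fun p => p.1 = y') = ∅ := by
        rw [Finset.filter_eq_empty_iff]
        intro p hpm
        obtain ⟨T, hT, rfl, _⟩ := hnwm p hpm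
        exact fun h => hyy h.symm
      rw [e1, Finset.union_empty]
      exact (Finset.card_le_card (Finset.filter_subset_filter _ (Finset.filter_subset _ _))).trans
        (hI.few y')
  · have e1 : ∑ p ∈ out ∪ nw, F' p = ∑ p ∈ out, F p + ∑ T ∈ Y.comps (4 * r) U, fT T := by
      rw [Finset.sum_union, Finset.sum_congr rfl houtF, hnw, Finset.sum_image]
      · congr 1
        refine Finset.sum_congr rfl fun T hT => ?_
        simp only [hF', if_true]
        rw [← comps_eq hT (hzf T hT).1]
      · intro T hT T' hT' he
        have he' : zT T = zT T' := (Prod.mk.inj he).2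
        refine comps_disj hT hT' (hzf T hT).1 ?_
        rw [he']; exact (hzf T' hT').1
      · rw [Finset.disjoint_left]
        intro p h h'
        obtain ⟨T, hT, rfl, _⟩ := hnwm p h'
        exact hyJ _ (houtd _ h).1 rfl
    have e2 : ∑ x ∈ Xt, E x = ∑ x ∈ cell, E x + ∑ x ∈ rest, E x :=
      (Finset.sum_filter_add_sum_filter_not _ _ _).symm
    have e3 : ∑ p ∈ Jk, F p = ∑ p ∈ inn, F p + ∑ p ∈ out, F p :=
      (Finset.sum_filter_add_sum_filter_not _ _ _).symm
    have := AddSubgroup.add_mem _ hI.eqv hOst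
    rw [e2, e3, hO] at this
    rw [e1]
    convert this using 1
    abel
  · refine Finset.card_lt_card ⟨Finset.filter_subset _ _, fun h => ?_⟩
    have := (hrestm y (h hy)).2
    rw [Y.d_self] at this
    omega

/-- Sequential cleaning: only heavy centres survive. -/
lemma clean_all [DecidableEq V] (hp : Par Y r J b w q k ρ e E0 n Np M) (hP : Y.σ P = 0)
    (hE : ∀ x ∈ X, E x ∈ Y.B x r) (hPX : P - ∑ x ∈ X, E x ∈ Y.stab) :
    ∃ Xt Jk F, Inv Y P X E r q k ρ Xt Jk F ∧
      ∀ y ∈ Xt, M ≤ (X.filter fun x => Y.d x y ≤ 4 * q).card := by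
  have key : ∀ N, ∀ Xt Jk F, Inv Y P X E r q k ρ Xt Jk F → Xt.card ≤ N →
      ∃ Xt Jk F, Inv Y P X E r q k ρ Xt Jk F ∧
      ∀ y ∈ Xt, M ≤ (X.filter fun x => Y.d x y ≤ 4 * q).card := by
    intro N
    induction N with
    | zero =>
      intro Xt Jk F hI hN
      refine ⟨Xt, Jk, F, hI, fun y hy => ?_⟩
      have := Finset.card_pos.2 ⟨y, hy⟩
      omega
    | succ N ih =>
      intro Xt Jk F hI hN
      by_cases h : ∀ y ∈ Xt, M ≤ (X.filter fun x => Y.d x y ≤ 4 * q).card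
      · exact ⟨Xt, Jk, F, hI, h⟩
      · push Not at h
        obtain ⟨y, hy, hl⟩ := h
        obtain ⟨Xt', Jk', F', hI', hlt⟩ := clean_one hp hP hE hI y hy hl
        exact ih Xt' Jk' F' hI' (by omega)
  refine key X.card X ∅ (fun _ => 0) ?_ le_rfl
  exact ⟨Finset.Subset.refl _, by simp, by simp, by simp, by simp, by simp, by simp, by simpa using hPX⟩

end Sys
end BH

open Finset
namespace BH
namespace Sys
variable {V A Pa : Type} [AddCommGroup Pa]

/-- `P` is, up to stabilizers, a sum of at most `N` operators supported in balls of radius `r`. -/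
def Cov (Y : Sys V A Pa) (P : Pa) (N r : ℕ) : Prop :=
  ∃ (X : Finset V) (E : V → Pa), X.card ≤ N ∧ (∀ x ∈ X, E x ∈ Y.B x r) ∧
    P - ∑ x ∈ X, E x ∈ Y.stab

variable {Y : Sys V A Pa} {P : Pa} {r J b w q k ρ e E0 n Np M : ℕ}

lemma vitali [DecidableEq V] (Y : Sys V A Pa) (X : Finset V) (R M : ℕ) (hM : 1 ≤ M) :
    ∃ H : Finset V, H.card * M ≤ X.card ∧
      ∀ y ∈ X, M ≤ (X.filter fun x => Y.d x y ≤ R).card → ∃ h ∈ H, Y.d y h ≤ 2 * R := by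
  classical
  set bl : V → Finset V := fun y => X.filter fun x => Y.d x y ≤ R with hbl
  set heavy := X.filter fun y => M ≤ (bl y).card with hheavy
  obtain ⟨good, hgood⟩ : ∃ good : Finset V → Prop, ∀ H, good H ↔
      ∀ y ∈ H, ∀ y' ∈ H, y ≠ y' → Disjoint (bl y) (bl y') := ⟨_, fun _ => Iff.rfl⟩
  set fam := heavy.powerset.filter fun H => good H with hfam
  have hne : fam.Nonempty := ⟨∅, by simp [hfam, hgood]⟩
  obtain ⟨H, hH, hmax⟩ := Finset.exists_max_image fam Finset.card hne
  have hH' := Finset.mem_filter.1 hH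
  rw [hgood] at hH'
  have hHs := Finset.mem_powerset.1 hH'.1
  refine ⟨H, ?_, ?_⟩
  · calc H.card * M ≤ ∑ y ∈ H, (bl y).card := by
          rw [← smul_eq_mul]
          exact Finset.card_nsmul_le_sum _ _ _ fun y hy => (Finset.mem_filter.1 (hHs hy)).2
      _ = (H.biUnion bl).card := by
          rw [Finset.card_biUnion]
          intro y hy y' hy' hn
          exact hH'.2 y hy y' hy' hn
      _ ≤ X.card := Finset.card_le_card (Finset.biUnion_subset.2 fun y _ => Finset.filter_subset _ _)
  · intro y hy hyM
    by_cases hyH : y ∈ H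
    · exact ⟨y, hyH, by rw [Y.d_self]; omega⟩
    by_contra hno
    push Not at hno
    have hdis : ∀ h ∈ H, Disjoint (bl y) (bl h) := by
      intro h hh
      rw [Finset.disjoint_left]
      intro x hx hx'
      have h1 := (Finset.mem_filter.1 hx).2
      have h2 := (Finset.mem_filter.1 hx').2
      have h3 := hno h hh
      have h4 := Y.tri y x h
      rw [Y.symm y x] at h4
      omega
    have hmem : insert y H ∈ fam := by
      refine Finset.mem_filter.2 ⟨Finset.mem_powerset.2 (Finset.insert_subset
        (Finset.mem_filter.2 ⟨hy, hyM⟩) hHs), ?_⟩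
      rw [hgood]
      intro a ha c hc hac
      rcases Finset.mem_insert.1 ha with h | ha <;> rcases Finset.mem_insert.1 hc with h' | hc
      · rw [h, h'] at hac; exact absurd rfl hac
      · rw [h]; exact hdis c hc
      · rw [h']; exact (hdis a ha).symm
      · exact hH'.2 a ha c hc hac
    have := hmax _ hmem
    rw [Finset.card_insert_of_notMem hyH] at this
    omega

lemma coarsen [DecidableEq V] (hp : Par Y r J b w q k ρ e E0 n Np M) (hM : 1 ≤ M)
    (hP : Y.σ P = 0) {N : ℕ} (hcov : Cov Y P N r) : Cov Y P (N / M) (16 * q) := by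
  classical
  obtain ⟨X, E, hXN, hE, hPX⟩ := hcov
  obtain ⟨Xt, Jk, F, hI, hheavy⟩ := clean_all hp hP hE hPX
  obtain ⟨H, hHc, hH⟩ := vitali Y X (4 * q) M hM
  have he := hp.he
  have heq := hp.heq
  have hr := hp.hr
  have hW := hp.hW
  have h1 : ∀ x : V, ∃ h : V, x ∈ Xt → h ∈ H ∧ Y.d x h ≤ 8 * q := by
    intro x
    by_cases hx : x ∈ Xt
    · obtain ⟨h, hh, hd⟩ := hH x (hI.sub hx) (hheavy x hx)
      exact ⟨h, fun _ => ⟨hh, by omega⟩⟩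
    · exact ⟨x, fun h => absurd h hx⟩
  choose φ hφ using h1
  set Jn := Jk.filter fun p => Y.σ (F p) ≠ 0 with hJn
  have h2 : ∀ p : V × V, ∃ h : V, p ∈ Jn → h ∈ H ∧ Y.d p.2 h + ρ ≤ 16 * q := by
    intro p
    by_cases hpm : p ∈ Jn
    · have h := Finset.mem_filter.1 hpm
      obtain ⟨a, ha⟩ := Function.ne_iff.1 h.2
      obtain ⟨x, hx, hn⟩ := hI.nr p h.1 a ha
      refine ⟨φ x, fun _ => ⟨(hφ x hx).1, ?_⟩⟩
      have h3 := (hφ x hx).2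
      have h4 := Y.isLocal _ _ _ _ (hI.FB p h.1) ha
      have h5 : Y.d (Y.loc a) x ≤ 2 * r := hn
      have h6 := Y.tri p.2 (Y.loc a) x
      have h7 := Y.tri p.2 x (φ x)
      rw [Y.symm p.2 (Y.loc a)] at h6
      omega
    · exact ⟨p.1, fun h => absurd h hpm⟩
  choose ψ hψ using h2
  refine ⟨H, fun h => ∑ x ∈ Xt.filter (fun x => φ x = h), E x +
    ∑ p ∈ Jn.filter (fun p => ψ p = h), F p, ?_, ?_, ?_⟩
  · rw [Nat.le_div_iff_mul_le hM]
    exact hHc.trans hXN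
  · intro h hh
    refine AddSubgroup.add_mem _ (AddSubgroup.sum_mem _ fun x hx => ?_)
      (AddSubgroup.sum_mem _ fun p hpm => ?_)
    · have hx := Finset.mem_filter.1 hx
      have h3 := (hφ x hx.1).2
      rw [hx.2] at h3
      exact Y.B_mono _ _ _ _ (by omega) (hE x (hI.sub hx.1))
    · have hpm := Finset.mem_filter.1 hpm
      have h3 := (hψ p hpm.1).2
      rw [hpm.2] at h3
      exact Y.B_mono _ _ _ _ h3 (hI.FB p (Finset.mem_filter.1 hpm.1).1)
  · rw [Finset.sum_add_distrib, Finset.sum_fiberwise_of_maps_to (fun x hx => (hφ x hx).1),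
      Finset.sum_fiberwise_of_maps_to (fun p hpm => (hψ p hpm).1)]
    have e3 : ∑ p ∈ Jk, F p = ∑ p ∈ Jn, F p + ∑ p ∈ Jk.filter (fun p => ¬ Y.σ (F p) ≠ 0), F p :=
      (Finset.sum_filter_add_sum_filter_not _ _ _).symm
    have e4 : ∑ p ∈ Jk.filter (fun p => ¬ Y.σ (F p) ≠ 0), F p ∈ Y.stab := by
      refine AddSubgroup.sum_mem _ fun p hpm => ?_
      have h := Finset.mem_filter.1 hpm
      refine Y.H1 _ p.2 ?_ (not_not.1 h.2)
      exact Y.B_mono _ _ _ _ (by rw [Y.d_self]; omega) (hI.FB p h.1)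
    have := AddSubgroup.add_mem _ hI.eqv e4
    rw [e3] at this
    convert this using 1
    abel

/-! ### Iteration -/

/-- thickness constant -/
def cK (β : ℕ) : ℕ := (2 * 1024 * (β * 1024 + 2)) ^ 1024
/-- number of slots -/
def cn (β Np : ℕ) : ℕ := 2 * (Np * (512 * cK β) * 3080) + 1539
/-- radius growth -/
def cL (β Np : ℕ) : ℕ := 128 * cn β Np * cK β
/-- required room -/
def cC (β Np : ℕ) : ℕ := 16 * cn β Np * cK β + 60000 * cK β

lemma cK_pos (β : ℕ) : 1 ≤ cK β := Nat.one_le_pow _ _ (by positivity)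

lemma mkPar {r Np : ℕ} (hr : 1 ≤ r) (hW : cC Y.β Np * r ≤ Y.W)
    (pack : ∀ q, 1 ≤ q → ∀ (Ys : Finset V) (y : V), (∀ u ∈ Ys, Y.d u y ≤ 8 * q) →
      (∀ u ∈ Ys, ∀ v ∈ Ys, u ≠ v → q ≤ Y.d u v) → Ys.card ≤ Np) :
    Par Y r 1024 (2 * 1024 * (Y.β * 1024 + 2)) (8 * r * cK Y.β) (cn Y.β Np * (8 * r * cK Y.β))
      (512 * cK Y.β) (12300 * r * cK Y.β) (12312 * r * cK Y.β) 1539 (cn Y.β Np) Np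
      (256 * cn Y.β Np * cK Y.β) := by
  have hK := cK_pos Y.β
  have hrK : r ≤ r * cK Y.β := Nat.le_mul_of_pos_right _ hK
  have hn : 1539 ≤ cn Y.β Np := by unfold cn; omega
  refine ⟨hr, by norm_num, rfl, rfl, ?_, rfl, ?_, ?_, ?_, ?_, ?_, ?_, ?_, ?_⟩
  · change 2 * (512 * cK Y.β) ≤ cK Y.β * 1024
    omega
  · calc 6 * (2 * r + 4 * r * (512 * cK Y.β)) = 12 * r + 12288 * (r * cK Y.β) := by ring
      _ ≤ 12 * (r * cK Y.β) + 12288 * (r * cK Y.β) := by omega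
      _ = _ := by ring
  · calc 12300 * r * cK Y.β + 10 * r = 12300 * (r * cK Y.β) + 10 * r := by ring
      _ ≤ 12312 * (r * cK Y.β) := by omega
      _ = _ := by ring
  · calc 12312 * r * cK Y.β = 1539 * (8 * r * cK Y.β) := by ring
      _ ≤ _ := Nat.mul_le_mul_right _ hn
  · exact le_of_eq (by ring)
  · unfold cn; norm_num
  · calc 2 * (256 * cn Y.β Np * cK Y.β) = cn Y.β Np * (512 * cK Y.β) := by ring
      _ ≤ _ := Nat.mul_le_mul_left _ (by omega)
  · change 2 * (cn Y.β Np * (8 * r * cK Y.β)) + 12300 * r * cK Y.β + 36 * r * 1024 * cK Y.β ≤ Y.W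
    refine le_trans ?_ hW
    unfold cC
    calc _ = 16 * cn Y.β Np * cK Y.β * r + 49164 * (r * cK Y.β) := by ring
      _ ≤ 16 * cn Y.β Np * cK Y.β * r + 60000 * (r * cK Y.β) := by omega
      _ = _ := by ring
  · refine pack _ ?_
    exact Nat.mul_pos (by omega) (Nat.mul_pos (by omega) hK)

lemma iterate {Np : ℕ}
    (pack : ∀ q, 1 ≤ q → ∀ (Ys : Finset V) (y : V), (∀ u ∈ Ys, Y.d u y ≤ 8 * q) →
      (∀ u ∈ Ys, ∀ v ∈ Ys, u ≠ v → q ≤ Y.d u v) → Ys.card ≤ Np)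
    (hP : Y.σ P = 0) {N : ℕ} (hcov : Cov Y P N 1) (t : ℕ)
    (hW : cC Y.β Np * cL Y.β Np ^ t ≤ Y.W) :
    Cov Y P (N / (2 * cL Y.β Np) ^ (t + 1)) (cL Y.β Np ^ (t + 1)) := by
  classical
  have hK := cK_pos Y.β
  have hn : 1539 ≤ cn Y.β Np := by unfold cn; omega
  have hL : 1 ≤ cL Y.β Np := Nat.mul_pos (by omega) hK
  have step : ∀ r N', 1 ≤ r → cC Y.β Np * r ≤ Y.W → Cov Y P N' r →
      Cov Y P (N' / (2 * cL Y.β Np)) (cL Y.β Np * r) := by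
    intro r N' hr hW hc
    have := coarsen (mkPar hr hW pack) (Nat.mul_pos (by omega) hK) hP hc
    have e1 : 256 * cn Y.β Np * cK Y.β = 2 * cL Y.β Np := by unfold cL; ring
    have e2 : 16 * (cn Y.β Np * (8 * r * cK Y.β)) = cL Y.β Np * r := by unfold cL; ring
    rwa [e1, e2] at this
  induction t with
  | zero =>
    have := step 1 N le_rfl (by simpa using hW) hcov
    simpa using this
  | succ t ih =>
    have h1 : cC Y.β Np * cL Y.β Np ^ t ≤ Y.W := by
      refine le_trans (Nat.mul_le_mul_left _ ?_) hW
      exact Nat.pow_le_pow_right hL (by omega)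
    have := step _ _ (Nat.one_le_pow _ _ hL) hW (ih h1)
    rw [Nat.div_div_eq_div_mul, ← pow_succ, ← pow_succ'] at this
    exact this

lemma weight_bound {Np : ℕ}
    (pack : ∀ q, 1 ≤ q → ∀ (Ys : Finset V) (y : V), (∀ u ∈ Ys, Y.d u y ≤ 8 * q) →
      (∀ u ∈ Ys, ∀ v ∈ Ys, u ≠ v → q ≤ Y.d u v) → Ys.card ≤ Np)
    (hP : Y.σ P = 0) (hPs : P ∉ Y.stab) {N : ℕ} (hcov : Cov Y P N 1) (t : ℕ)
    (hW : cC Y.β Np * cL Y.β Np ^ t ≤ Y.W) :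
    (2 * cL Y.β Np) ^ (t + 1) ≤ N := by
  by_contra hlt
  obtain ⟨X, E, hX, _, h⟩ := iterate pack hP hcov t hW
  rw [Nat.div_eq_of_lt (not_le.1 hlt)] at hX
  rw [Finset.card_eq_zero.1 (Nat.le_zero.1 hX)] at h
  simp only [Finset.sum_empty, sub_zero] at h
  exact hPs h

end Sys
end BH

open Finset
namespace BH

/-! ### Lattice geometry -/
section Geometry

lemma cDist_le_iff {L : ℕ} {a b : ZMod L} {n : ℕ} :
    cDist a b ≤ n ↔ (a - b).val ≤ n ∨ (b - a).val ≤ n := min_le_iff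

lemma cDist_comm {L : ℕ} (a b : ZMod L) : cDist a b = cDist b a := min_comm _ _

lemma cDist_sub {L : ℕ} [NeZero L] (a b c : ZMod L) {n : ℕ} (h1 : (a - c).val ≤ (b - c).val + n)
    (h2 : (b - c).val ≤ (a - c).val + n) : cDist a b ≤ n := by
  rw [cDist_le_iff]
  rcases le_total (b - c).val (a - c).val with h | h
  · left
    have := ZMod.val_sub h
    rw [sub_sub_sub_cancel_right] at this
    omega
  · right
    have := ZMod.val_sub h
    rw [sub_sub_sub_cancel_right] at this
    omega

lemma cDist_tri {L : ℕ} [NeZero L] (a b c : ZMod L) : cDist a c ≤ cDist a b + cDist b c := by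
  have hab : (a - b).val ≤ cDist a b ∨ (b - a).val ≤ cDist a b := cDist_le_iff.1 le_rfl
  have hbc : (b - c).val ≤ cDist b c ∨ (c - b).val ≤ cDist b c := cDist_le_iff.1 le_rfl
  rcases hab with h1 | h1 <;> rcases hbc with h2 | h2
  · rw [cDist_le_iff]; left
    have := ZMod.val_add_le (a - b) (b - c)
    rw [sub_add_sub_cancel] at this
    omega
  · exact cDist_sub a c b (by omega) (by omega)
  · rw [cDist_comm a c, cDist_le_iff]
    rcases le_total (b - a).val (b - c).val with h | h
    · have := ZMod.val_sub h
      have e : b - c - (b - a) = a - c := by ring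
      rw [e] at this
      right; omega
    · have := ZMod.val_sub h
      have e : b - a - (b - c) = c - a := by ring
      rw [e] at this
      left; omega
  · rw [cDist_le_iff]; right
    have := ZMod.val_add_le (c - b) (b - a)
    rw [sub_add_sub_cancel] at this
    omega

variable {L D : ℕ} [NeZero L]

lemma dist_le_iff {u v : Site L D} {n : ℕ} : dist' u v ≤ n ↔ ∀ i, cDist (u i) (v i) ≤ n := by
  simp [dist', Finset.sup_le_iff]

lemma dist_self' (u : Site L D) : dist' u u = 0 := by
  rw [← Nat.le_zero, dist_le_iff]
  intro i
  simp [cDist]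

lemma dist_symm' (u v : Site L D) : dist' u v = dist' v u := by
  simp only [dist', cDist_comm]

lemma dist_tri' (u v x : Site L D) : dist' u x ≤ dist' u v + dist' v x := by
  rw [dist_le_iff]
  intro i
  exact (cDist_tri _ (v i) _).trans
    (Nat.add_le_add (dist_le_iff.1 le_rfl i) (dist_le_iff.1 le_rfl i))

lemma cDist_val {a b : ZMod L} {n : ℕ} (h : cDist a b ≤ n) : (b - (a - (n : ZMod L))).val ≤ 2 * n := by
  have hcast : ∀ m : ℕ, ((m : ZMod L)).val ≤ m := fun m => by
    rw [ZMod.val_natCast]; exact Nat.mod_le _ _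
  rcases cDist_le_iff.1 h with h | h
  · have e : b - (a - (n : ZMod L)) = ((n - (a - b).val : ℕ) : ZMod L) := by
      rw [Nat.cast_sub h, ZMod.natCast_zmod_val]; ring
    rw [e]
    exact (hcast _).trans (by omega)
  · have e : b - (a - (n : ZMod L)) = (b - a) + (n : ZMod L) := by ring
    rw [e]
    have := ZMod.val_add_le (b - a) (n : ZMod L)
    have := hcast n
    omega

/-- corner of the cube containing a ball -/
def corner (u : Site L D) (n : ℕ) : Site L D := fun i => u i - (n : ZMod L)

lemma mem_cube_of_dist {u v : Site L D} {n : ℕ} (h : dist' u v ≤ n) {ℓ : ℝ}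
    (hl : (2 * n : ℝ) ≤ ℓ) : v ∈ cubeSet (corner u n) ℓ := by
  intro i
  have := cDist_val (dist_le_iff.1 h i)
  refine le_trans ?_ hl
  exact_mod_cast this

lemma cube_dist {c u v : Site L D} {n : ℕ} (hu : u ∈ cubeSet c (n : ℝ))
    (hv : v ∈ cubeSet c (n : ℝ)) : dist' u v ≤ n := by
  rw [dist_le_iff]
  intro i
  have h1 : (u i - c i).val ≤ n := by exact_mod_cast hu i
  have h2 : (v i - c i).val ≤ n := by exact_mod_cast hv i
  exact cDist_sub _ _ (c i) (by omega) (by omega)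

lemma elem_dist {c v : Site L D} (h : v ∈ elemCube c) : dist' c v ≤ 1 := by
  rw [dist_le_iff]
  intro i
  rw [cDist_le_iff]
  right
  exact (Finset.mem_filter.1 h).2 i

lemma self_mem_elem (c : Site L D) : c ∈ elemCube c := by
  simp [elemCube]

lemma packing (q : ℕ) (hq : 1 ≤ q) (Ys : Finset (Site L D)) (y : Site L D)
    (h8 : ∀ u ∈ Ys, dist' u y ≤ 8 * q) (hsep : ∀ u ∈ Ys, ∀ v ∈ Ys, u ≠ v → q ≤ dist' u v) :
    Ys.card ≤ 17 ^ D := by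
  classical
  have hval : ∀ u ∈ Ys, ∀ i, (u i - (y i - ((8 * q : ℕ) : ZMod L))).val ≤ 2 * (8 * q) := by
    intro u hu i
    refine cDist_val ?_
    rw [cDist_comm]
    exact dist_le_iff.1 (h8 u hu) i
  have hmap : ∀ u ∈ Ys, (fun i => (u i - (y i - ((8 * q : ℕ) : ZMod L))).val / q) ∈
      Fintype.piFinset fun _ : Fin D => Finset.range 17 := by
    intro u hu
    rw [Fintype.mem_piFinset]
    intro i
    rw [Finset.mem_range, Nat.div_lt_iff_lt_mul hq]
    have := hval u hu i
    omega
  have hinj : Set.InjOn (fun (u : Site L D) i => (u i - (y i - ((8 * q : ℕ) : ZMod L))).val / q)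
      (Ys : Set (Site L D)) := by
    intro u hu v hv he
    by_contra hne
    have h1 := hsep u hu v hv hne
    have h2 : dist' u v ≤ q - 1 := by
      rw [dist_le_iff]
      intro i
      have h3 := congrFun he i
      simp only at h3
      have h4 := Nat.div_add_mod (u i - (y i - ((8 * q : ℕ) : ZMod L))).val q
      have h5 := Nat.div_add_mod (v i - (y i - ((8 * q : ℕ) : ZMod L))).val q
      have h6 := Nat.mod_lt (u i - (y i - ((8 * q : ℕ) : ZMod L))).val hq
      have h7 := Nat.mod_lt (v i - (y i - ((8 * q : ℕ) : ZMod L))).val hq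
      rw [h3] at h4
      exact cDist_sub _ _ (y i - ((8 * q : ℕ) : ZMod L)) (by omega) (by omega)
    omega
  have := Finset.card_le_card_of_injOn _ hmap hinj
  simpa using this

lemma exists_minEnclosing (S : Set (Site L D)) (c : Site L D) (n : ℕ)
    (h : S ⊆ cubeSet c (n : ℝ)) :
    ∃ (c' : Site L D) (m : ℕ), m ≤ n ∧ minEnclosing c' (m : ℝ) S := by
  classical
  have hex : ∃ m : ℕ, ∃ c : Site L D, S ⊆ cubeSet c (m : ℝ) := ⟨n, c, h⟩
  obtain ⟨c', hc'⟩ := Nat.find_spec hex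
  refine ⟨c', Nat.find hex, Nat.find_min' hex ⟨c, h⟩, Nat.cast_nonneg _, hc', ?_⟩
  intro c'' ℓ hℓ hS
  have h1 : S ⊆ cubeSet c'' ((⌊ℓ⌋₊ : ℕ) : ℝ) := by
    intro v hv i
    have := hS hv i
    exact_mod_cast Nat.le_floor this
  have h2 := Nat.find_min' hex ⟨c'', h1⟩
  exact (Nat.cast_le.2 h2).trans (Nat.floor_le hℓ)

end Geometry

/-! ### The abstract system attached to a code -/
section Instantiate
variable {L D K : ℕ} [NeZero L] {A : Type} [Fintype A]

/-- the syndrome as a homomorphism -/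
def synHom (code : Code L D K A) : Pauli (Site L D × Fin K) →+ (A → ZMod 2) where
  toFun E a := sympForm (code.G a) E
  map_zero' := by funext a; simp [sympForm]
  map_add' E F := by
    funext a
    simp only [sympForm, Pi.add_apply, ← Finset.sum_add_distrib]
    refine Finset.sum_congr rfl fun q _ => ?_
    simp only [Prod.fst_add, Prod.snd_add]
    ring

/-- operators supported in a ball -/
def ballOps (L D K : ℕ) [NeZero L] (u : Site L D) (n : ℕ) :
    AddSubgroup (Pauli (Site L D × Fin K)) where
  carrier := {E | ∀ q, E q ≠ 0 → dist' u q.1 ≤ n}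
  zero_mem' := by intro q hq; exact absurd rfl hq
  add_mem' := by
    intro E F hE hF q hq
    by_cases h : E q = 0
    · refine hF q fun h' => hq ?_
      simp [h, h']
    · exact hE q h
  neg_mem' := by
    intro E hE q hq
    refine hE q fun h => hq ?_
    simp [h]

lemma mem_ballOps {u : Site L D} {n : ℕ} {E : Pauli (Site L D × Fin K)} :
    E ∈ ballOps L D K u n ↔ ∀ q, E q ≠ 0 → dist' u q.1 ≤ n := Iff.rfl

lemma zmod2_ne (x : ZMod 2) : x ≠ 0 ↔ x = 1 := by revert x; decide

lemma mem_syndrome (code : Code L D K A) (E : Pauli (Site L D × Fin K)) (a : A) :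
    a ∈ code.syndrome E ↔ synHom code E a ≠ 0 := by
  rw [zmod2_ne]
  simp [Code.syndrome, synHom]

lemma zmod2_ext {S T : A → ZMod 2} (h : ∀ a, S a ≠ 0 ↔ T a ≠ 0) : S = T := by
  funext a
  have h := h a
  revert h
  generalize S a = x
  generalize T a = y
  revert x y
  decide

lemma ball_smallSupp {u : Site L D} {n : ℕ} {E : Pauli (Site L D × Fin K)}
    (h : E ∈ ballOps L D K u n) {ℓ : ℝ} (hl : (2 * n : ℝ) ≤ ℓ) : smallSupp E ℓ :=
  ⟨corner u n, fun q hq => mem_cube_of_dist (h q hq) hl⟩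

lemma relocalize (code : Code L D K A) {Ltqo : ℝ} (ht : code.tqo2 Ltqo) {S : Finset A}
    (hS : code.neutral Ltqo S) (u : Site L D) (ρ : ℕ) (hρ : 2 ≤ ρ)
    (hloc : ∀ a ∈ S, dist' (code.loc a) u ≤ ρ) :
    ∃ F ∈ ballOps L D K u (6 * ρ), code.syndrome F = S := by
  classical
  rcases S.eq_empty_or_nonempty with rfl | ⟨a₀, ha₀⟩
  · refine ⟨0, AddSubgroup.zero_mem _, ?_⟩
    ext a
    rw [mem_syndrome]
    simp
  have hsites : ∀ v ∈ code.synSites S, dist' u v ≤ ρ + 1 := by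
    intro v hv
    obtain ⟨a, ha, hv⟩ := Finset.mem_biUnion.1 hv
    have h1 := hloc a ha
    have h2 := elem_dist hv
    have h3 := dist_tri' u (code.loc a) v
    rw [dist_symm' u (code.loc a)] at h3
    omega
  obtain ⟨c, m, hm, hmin⟩ := exists_minEnclosing (code.synSites S : Set (Site L D))
    (corner u (ρ + 1)) (2 * (ρ + 1)) (fun v hv => mem_cube_of_dist (hsites v hv)
      (by push_cast; exact le_rfl))
  obtain ⟨F, hF, hFB⟩ := ht S hS c m hmin
  refine ⟨F, ?_, hF⟩
  intro q hq
  obtain ⟨v, hv, hd⟩ := hFB q hq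
  have hd : dist' v q.1 ≤ 1 := by exact_mod_cast hd
  have hl : code.loc a₀ ∈ cubeSet c (m : ℝ) :=
    hmin.2.1 (Finset.mem_biUnion.2 ⟨a₀, ha₀, self_mem_elem _⟩)
  have h1 := cube_dist hl hv
  have h2 := hloc a₀ ha₀
  rw [dist_symm'] at h2
  have h3 := dist_tri' u (code.loc a₀) v
  have h4 := dist_tri' u v q.1
  omega

lemma stab_syn' (code : Code L D K A) : ∀ E ∈ code.stab, synHom code E = 0 := by
  intro E hE
  have : code.stab ≤ (synHom code).ker := by
    unfold Code.stab
    rw [AddSubgroup.closure_le]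
    rintro _ ⟨b, rfl⟩
    change synHom code (code.G b) = 0
    funext a
    exact code.comm a b
  exact this hE

lemma local_syn (code : Code L D K A) (E : Pauli (Site L D × Fin K)) (u : Site L D) (ρ : ℕ) (a : A)
    (hE : E ∈ ballOps L D K u ρ) (ha : synHom code E a ≠ 0) : dist' (code.loc a) u ≤ ρ + 1 := by
  obtain ⟨q, _, hq⟩ := Finset.exists_ne_zero_of_sum_ne_zero ha
  have h1 : code.G a q ≠ 0 := by
    intro h; apply hq; simp [h]
  have h2 : E q ≠ 0 := by
    intro h; apply hq; simp [h]
  have h3 := elem_dist (code.localGen a q h1)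
  have h4 := hE q h2
  have h5 := dist_tri' (code.loc a) q.1 u
  rw [dist_symm' q.1] at h5
  omega

/-- separation constant -/
noncomputable def cβ (α : ℝ) : ℕ := ⌈4 * α⌉₊ + 8

lemma no_strings_abs (code : Code L D K A) {Ltqo α : ℝ} (hα : 1 ≤ α)
    (ht : code.tqo2 Ltqo) (hns : code.noStrings Ltqo α)
    (E : Pauli (Site L D × Fin K)) (u₁ u₂ : Site L D) (ρ : ℕ) (S₁ S₂ : A → ZMod 2)
    (hE : smallSupp E Ltqo) (hS : synHom code E = S₁ + S₂)
    (h₁ : ∀ a, S₁ a ≠ 0 → dist' (code.loc a) u₁ ≤ ρ)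
    (h₂ : ∀ a, S₂ a ≠ 0 → dist' (code.loc a) u₂ ≤ ρ) (hρ : 2 ≤ ρ)
    (hfar : cβ α * ρ ≤ dist' u₁ u₂) :
    ∃ F ∈ ballOps L D K u₁ (6 * ρ), synHom code F = S₁ := by
  classical
  set c₁ := corner u₁ (ρ + 1) with hc₁
  set c₂ := corner u₂ (ρ + 1) with hc₂
  set ℓ : ℝ := ((2 * (ρ + 1) : ℕ) : ℝ) with hℓ
  have hin : ∀ u v : Site L D, dist' u v ≤ ρ + 1 → v ∈ cubeSet (corner u (ρ + 1)) ℓ := by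
    intro u v h
    exact mem_cube_of_dist h (by rw [hℓ]; push_cast; exact le_rfl)
  have hel : ∀ a u, dist' (code.loc a) u ≤ ρ → ∀ v ∈ elemCube (code.loc a),
      v ∈ cubeSet (corner u (ρ + 1)) ℓ := by
    intro a u h v hv
    refine hin u v ?_
    have h2 := elem_dist hv
    have h3 := dist_tri' u (code.loc a) v
    rw [dist_symm' u (code.loc a)] at h3
    omega
  have hsep : ∀ x ∈ cubeSet c₁ ℓ, ∀ y ∈ cubeSet c₂ ℓ, α * ℓ ≤ ((dist' x y : ℕ) : ℝ) := by
    intro x hx y hy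
    have d1 := cube_dist hx (hin u₁ u₁ (by rw [dist_self']; omega))
    have d2 := cube_dist hy (hin u₂ u₂ (by rw [dist_self']; omega))
    have t1 := dist_tri' u₁ x u₂
    have t2 := dist_tri' x y u₂
    rw [dist_symm' u₁ x] at t1
    have h8 : cβ α * ρ ≤ dist' x y + 8 * ρ := by omega
    have hcl : ⌈4 * α⌉₊ * ρ ≤ dist' x y := by
      unfold cβ at h8; rw [add_mul] at h8; omega
    have hcl' : ((⌈4 * α⌉₊ : ℕ) : ℝ) * ρ ≤ ((dist' x y : ℕ) : ℝ) := by exact_mod_cast hcl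
    have h4 := Nat.le_ceil (4 * α)
    have hρ' : (2 : ℝ) ≤ ρ := by exact_mod_cast hρ
    rw [hℓ]; push_cast
    nlinarith
  have hℓ0 : 0 < ℓ := by rw [hℓ]; positivity
  have hdis : Disjoint (cubeSet c₁ ℓ) (cubeSet c₂ ℓ) := by
    rw [Set.disjoint_left]
    intro x hx hy
    have := hsep x hx x hy
    rw [dist_self'] at this
    push_cast at this
    nlinarith
  have hnot : ∀ a, S₁ a ≠ 0 → S₂ a = 0 := by
    intro a ha
    by_contra hb
    exact Set.disjoint_left.1 hdis (hel a u₁ (h₁ a ha) _ (self_mem_elem _))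
      (hel a u₂ (h₂ a hb) _ (self_mem_elem _))
  have hor : ∀ a ∈ code.syndrome E, S₁ a ≠ 0 ∨ S₂ a ≠ 0 := by
    intro a ha
    rw [mem_syndrome, hS] at ha
    by_contra hno
    push Not at hno
    apply ha
    simp [hno.1, hno.2]
  have hsub : (code.synSites (code.syndrome E) : Set (Site L D)) ⊆ cubeSet c₁ ℓ ∪ cubeSet c₂ ℓ := by
    intro v hv
    obtain ⟨a, ha, hv⟩ := Finset.mem_biUnion.1 hv
    rcases hor a ha with h | h
    · exact Or.inl (hel a u₁ (h₁ a h) v hv)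
    · exact Or.inr (hel a u₂ (h₂ a h) v hv)
  have hneu := (hns E ℓ c₁ c₂ hℓ0 hE hdis hsep hsub).1
  have hpart : ∀ a, a ∈ code.partIn (code.syndrome E) (cubeSet c₁ ℓ) ↔ S₁ a ≠ 0 := by
    intro a
    unfold Code.partIn
    rw [Finset.mem_filter]
    constructor
    · rintro ⟨ha, hv⟩ h0
      rcases hor a ha with h | h
      · exact h h0
      · exact Set.disjoint_left.1 hdis (hv _ (self_mem_elem _))
          (hel a u₂ (h₂ a h) _ (self_mem_elem _))
    · intro h
      refine ⟨?_, hel a u₁ (h₁ a h)⟩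
      rw [mem_syndrome, hS]
      simpa [hnot a h] using h
  obtain ⟨F, hF, hFs⟩ := relocalize code ht hneu u₁ ρ hρ (fun a ha => h₁ a ((hpart a).1 ha))
  refine ⟨F, hF, zmod2_ext fun a => ?_⟩
  rw [← mem_syndrome, hFs, hpart]

/-- the abstract system of a code -/
noncomputable def toSys (code : Code L D K A) {Ltqo α : ℝ} (hα : 1 ≤ α) (ht : code.tqo Ltqo)
    (hns : code.noStrings Ltqo α) (W : ℕ) (hW : (2 * W : ℝ) ≤ Ltqo) :
    Sys (Site L D) A (Pauli (Site L D × Fin K)) where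
  d := dist'
  d_self := dist_self'
  symm := dist_symm'
  tri := dist_tri'
  σ := synHom code
  loc := code.loc
  B := ballOps L D K
  B_mono := by
    intro u v ρ ρ' h E hE q hq
    have h1 := hE q hq
    have h2 := dist_tri' v u q.1
    rw [dist_symm' v u] at h2
    omega
  stab := code.stab
  stab_syn := stab_syn' code
  isLocal := local_syn code
  W := W
  β := cβ α
  H1 := by
    intro E u hE h0
    refine ht.1 E (ball_smallSupp hE hW) ?_
    ext a
    rw [mem_syndrome, h0]
    simp
  H2 := by
    intro E u₀ u ρ hE hd hρ
    obtain ⟨F, hF, hFs⟩ := relocalize code ht.2 (S := code.syndrome E)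
      ⟨E, rfl, ball_smallSupp hE hW⟩ u ρ hρ
      (fun a ha => hd a ((mem_syndrome code E a).1 ha))
    refine ⟨F, hF, zmod2_ext fun a => ?_⟩
    rw [← mem_syndrome, ← mem_syndrome, hFs]
  H3 := by
    intro E u₀ u₁ u₂ ρ S₁ S₂ hE hS h₁ h₂ hρ hfar
    exact no_strings_abs code hα ht.2 hns E u₁ u₂ ρ S₁ S₂ (ball_smallSupp hE hW) hS h₁ h₂ hρ hfar

lemma initial_cov (code : Code L D K A) {Ltqo α : ℝ} (hα : 1 ≤ α) (ht : code.tqo Ltqo)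
    (hns : code.noStrings Ltqo α) (W : ℕ) (hW : (2 * W : ℝ) ≤ Ltqo)
    (P : Pauli (Site L D × Fin K)) :
    Sys.Cov (toSys code hα ht hns W hW) P (pweight P) 1 := by
  classical
  set supp := (Finset.univ.filter fun q => P q ≠ 0) with hsupp
  refine ⟨supp.image Prod.fst, fun x q => if q.1 = x then P q else 0, ?_, ?_, ?_⟩
  · unfold pweight
    refine Finset.card_image_le.trans (le_of_eq ?_)
    rw [hsupp]
  · intro x hx q hq
    have : q.1 = x := by
      by_contra h
      exact hq (if_neg h)
    rw [this, dist_self']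
    omega
  · have : P - ∑ x ∈ supp.image Prod.fst, (fun q : Site L D × Fin K => if q.1 = x then P q else 0)
        = 0 := by
      funext q
      rw [Pi.sub_apply, Finset.sum_apply, Finset.sum_ite_eq]
      split_ifs with h
      · simp
      · have : P q = 0 := by
          by_contra hne
          exact h (Finset.mem_image_of_mem _ (Finset.mem_filter.2 ⟨Finset.mem_univ _, hne⟩))
        simp [this]
    rw [this]
    exact AddSubgroup.zero_mem _

lemma weight_pos (code : Code L D K A) (P : Pauli (Site L D × Fin K)) (hP : code.logical P) :
    1 ≤ pweight P := by
  unfold pweight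
  by_contra h
  have h0 := Finset.card_eq_zero.1 (Nat.lt_one_iff.1 (not_le.1 h))
  apply hP.2
  have : P = 0 := by
    funext q
    by_contra hq
    have : q ∈ (Finset.univ.filter fun q => P q ≠ 0) := Finset.mem_filter.2 ⟨Finset.mem_univ _, hq⟩
    rw [h0] at this
    exact absurd this (Finset.notMem_empty _)
  rw [this]
  exact AddSubgroup.zero_mem _

lemma const_pos {n k : ℕ} (hk : 1 ≤ k) : 1 ≤ 16 * n * k + 60000 * k := by
  have := Nat.zero_le (16 * n * k)
  omega

lemma const_two {k : ℕ} (m : ℕ) (hk : 1 ≤ k) : 2 ≤ 128 * (2 * m + 1539) * k :=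
  le_trans (by omega) (Nat.le_mul_of_pos_right (128 * (2 * m + 1539)) hk)

lemma exists_scale (code : Code L D K A) {Ltqo α : ℝ} (hα : 1 ≤ α) (hL0 : 0 ≤ Ltqo)
    (ht : code.tqo Ltqo) (hns : code.noStrings Ltqo α) (P : Pauli (Site L D × Fin K))
    (hP : code.logical P) :
    ∃ t : ℕ, Ltqo ≤ 2 * (Sys.cC (cβ α) (17 ^ D) : ℝ) * (Sys.cL (cβ α) (17 ^ D) : ℝ) ^ t ∧
      (2 * Sys.cL (cβ α) (17 ^ D)) ^ t ≤ pweight P := by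
  classical
  obtain ⟨C, hC⟩ : ∃ C : ℕ, C = Sys.cC (cβ α) (17 ^ D) := ⟨_, rfl⟩
  obtain ⟨Λ, hΛ⟩ : ∃ Λ : ℕ, Λ = Sys.cL (cβ α) (17 ^ D) := ⟨_, rfl⟩
  rw [← hC, ← hΛ]
  have hC1 : 1 ≤ C := by rw [hC]; exact const_pos (Sys.cK_pos _)
  have hΛ2 : 2 ≤ Λ := by rw [hΛ]; exact const_two _ (Sys.cK_pos _)
  set W := ⌊Ltqo / 2⌋₊ with hWd
  have hW : (2 * W : ℝ) ≤ Ltqo := by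
    have := Nat.floor_le (show 0 ≤ Ltqo / 2 by positivity)
    rw [← hWd] at this
    linarith
  have hW' : Ltqo ≤ 2 * ((W + 1 : ℕ) : ℝ) := by
    have := Nat.lt_floor_add_one (Ltqo / 2)
    rw [← hWd] at this
    push_cast
    linarith
  have hex : ∃ t, W + 1 ≤ C * Λ ^ t := by
    refine ⟨W + 1, ?_⟩
    have h1 : W + 1 < Λ ^ (W + 1) := Nat.lt_pow_self (by omega)
    exact h1.le.trans (Nat.le_mul_of_pos_left _ hC1)
  refine ⟨Nat.find hex, ?_, ?_⟩
  · have h := Nat.find_spec hex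
    have h' : ((W + 1 : ℕ) : ℝ) ≤ (C : ℝ) * (Λ : ℝ) ^ Nat.find hex := by exact_mod_cast h
    linarith
  · rcases Nat.eq_zero_or_pos (Nat.find hex) with h0 | h0
    · rw [h0, pow_zero]; exact weight_pos code P hP
    · obtain ⟨t, hte⟩ := Nat.exists_eq_succ_of_ne_zero (Nat.pos_iff_ne_zero.1 h0)
      have hlt : ¬ W + 1 ≤ C * Λ ^ t := Nat.find_min hex (by omega)
      rw [hte, hΛ]
      exact Sys.weight_bound (Y := toSys code hα ht hns W hW) (Np := 17 ^ D)
        (fun q hq Ys y => packing q hq Ys y)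
        (by funext a; exact hP.1 a) hP.2 (initial_cov code hα ht hns W hW P) t
        (by
          have hle : C * Λ ^ t ≤ W := by omega
          rw [hC, hΛ] at hle
          exact hle)

end Instantiate


/-- There are constants `c > 0` and `γ > 1`, depending only
on the spatial dimension `D` and the no-strings constant `α ≥ 1`, such that:
any local stabilizer code on `(ℤ/Lℤ)^D` satisfying the topological order
conditions at scale `Ltqo` and the no-strings rule with constant `α` has every
logical operator of weight at least `c·Ltqo^γ`; in particular the code distance
is at least `c·Ltqo^γ`. -/
theorem code_distance_superlinear (D : ℕ) (α : ℝ) (hα : 1 ≤ α) :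
    ∃ c γ : ℝ, 0 < c ∧ 1 < γ ∧
      ∀ (L : ℕ) [NeZero L] (K : ℕ),
        ∀ (A : Type) [Fintype A] (code : Code L D K A) (Ltqo : ℝ), 0 ≤ Ltqo →
          code.tqo Ltqo →
          code.noStrings Ltqo α →
          ∀ P, code.logical P → c * Ltqo ^ γ ≤ (pweight P : ℝ) := by
  obtain ⟨C, hC⟩ : ∃ C : ℕ, C = Sys.cC (cβ α) (17 ^ D) := ⟨_, rfl⟩
  obtain ⟨Λ, hΛ⟩ : ∃ Λ : ℕ, Λ = Sys.cL (cβ α) (17 ^ D) := ⟨_, rfl⟩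
  have hC1 : 1 ≤ C := by rw [hC]; exact const_pos (Sys.cK_pos _)
  have hΛ2 : 2 ≤ Λ := by rw [hΛ]; exact const_two _ (Sys.cK_pos _)
  have hCr : (1 : ℝ) ≤ C := by exact_mod_cast hC1
  have hΛr : (2 : ℝ) ≤ Λ := by exact_mod_cast hΛ2
  have hlog : 0 < Real.log Λ := Real.log_pos (by linarith)
  set γ : ℝ := Real.log (2 * Λ) / Real.log Λ with hγ
  have hγ1 : 1 < γ := by
    rw [hγ, one_lt_div hlog]
    exact Real.log_lt_log (by linarith) (by linarith)
  have hΛγ : (Λ : ℝ) ^ γ = 2 * Λ := by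
    rw [Real.rpow_def_of_pos (by linarith), hγ, mul_div_cancel₀ _ hlog.ne',
      Real.exp_log (by linarith)]
  have hpos : 0 < (2 * (C : ℝ)) ^ γ := Real.rpow_pos_of_pos (by linarith) _
  refine ⟨((2 * (C : ℝ)) ^ γ)⁻¹, γ, inv_pos.2 hpos, hγ1, ?_⟩
  intro L _ K A _ code Ltqo hL0 ht hns P hP
  obtain ⟨t, h1, h2⟩ := exists_scale code hα hL0 ht hns P hP
  rw [← hC, ← hΛ] at h1
  rw [← hΛ] at h2
  have h2' : ((2 : ℝ) * Λ) ^ t ≤ (pweight P : ℝ) := by exact_mod_cast h2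
  rw [inv_mul_le_iff₀ hpos]
  calc Ltqo ^ γ ≤ (2 * (C : ℝ) * (Λ : ℝ) ^ t) ^ γ :=
        Real.rpow_le_rpow hL0 h1 (zero_le_one.trans hγ1.le)
    _ = (2 * (C : ℝ)) ^ γ * ((2 : ℝ) * Λ) ^ t := by
        rw [Real.mul_rpow (by linarith) (pow_nonneg (zero_le_two.trans hΛr) t), ← Real.rpow_natCast,
          ← Real.rpow_mul (by linarith), mul_comm (t : ℝ) γ, Real.rpow_mul (by linarith), hΛγ,
          Real.rpow_natCast]
    _ ≤ _ := mul_le_mul_of_nonneg_left h2' hpos.le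

end BH
end

section
/- For every u ∈ ℤ³ and every p ≥ 0, the support of e⁽ᵖ⁾_u is contained in the cube u + {0,1,…,2ᵖ−1}³ and has exactly 4ᵖ elements. -/
open Finsupp

namespace BH

/-- The `𝔽₂`-vector space of finitely supported functions `ℤ³ → 𝔽₂`. -/
abbrev V3 := (Fin 3 → ℤ) →₀ ZMod 2

/-- The coordinate unit vector `x̂`. -/
def xhat : Fin 3 → ℤ := ![1, 0, 0]

/-- The coordinate unit vector `ŷ`. -/
def yhat : Fin 3 → ℤ := ![0, 1, 0]

/-- The coordinate unit vector `ẑ`. -/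
def zhat : Fin 3 → ℤ := ![0, 0, 1]

/-- The indicator function `δ_u`. -/
noncomputable def δ (u : Fin 3 → ℤ) : V3 := Finsupp.single u 1

/-- The fractal error: `e⁽⁰⁾_u = δ_u` and
`e⁽ᵖ⁺¹⁾_u = e⁽ᵖ⁾_u + e⁽ᵖ⁾_{u+2ᵖx̂} + e⁽ᵖ⁾_{u+2ᵖŷ} + e⁽ᵖ⁾_{u+2ᵖẑ}`. -/
noncomputable def e : ℕ → (Fin 3 → ℤ) → V3
  | 0, u => δ u
  | p + 1, u =>
      e p u + e p (u + (2 ^ p : ℤ) • xhat) + e p (u + (2 ^ p : ℤ) • yhat)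
        + e p (u + (2 ^ p : ℤ) • zhat)

/-- The syndrome map `σ` of Code 1 restricted to `X`-errors on first qubits:
the `𝔽₂`-linear map with `σ(δ_u) = δ_u + δ_{u+x̂} + δ_{u+ŷ} + δ_{u+ẑ}`. -/
noncomputable def σmap (f : V3) : V3 :=
  f + Finsupp.mapDomain (· + xhat) f + Finsupp.mapDomain (· + yhat) f
    + Finsupp.mapDomain (· + zhat) f

/-- The level-`p` pyramid with apex `c`: the four defects at
`c, c+2ᵖx̂, c+2ᵖŷ, c+2ᵖẑ`. -/
noncomputable def pyr (p : ℕ) (c : Fin 3 → ℤ) : V3 :=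
  δ c + δ (c + (2 ^ p : ℤ) • xhat) + δ (c + (2 ^ p : ℤ) • yhat)
    + δ (c + (2 ^ p : ℤ) • zhat)

end BH

namespace BH

/-- For every `u ∈ ℤ³` and `p ≥ 0`, the support of the
fractal error `e⁽ᵖ⁾_u` is contained in the cube `u + {0,1,…,2ᵖ−1}³` and has
exactly `4ᵖ` elements. -/
theorem fractal_support (u : Fin 3 → ℤ) (p : ℕ) :
    (∀ v ∈ (e p u).support, ∀ i, u i ≤ v i ∧ v i < u i + 2 ^ p) ∧
    (e p u).support.card = 4 ^ p := by
  induction p generalizing u with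
  | zero =>
    have h : (e 0 u).support = {u} := by
      simp only [e, δ]
      exact Finsupp.support_single_ne_zero u one_ne_zero
    rw [h]
    simp
  | succ p ih =>
    have hpos : (0 : ℤ) < 2 ^ p := by positivity
    have hpow : (2 : ℤ) ^ (p + 1) = 2 ^ p + 2 ^ p := by ring
    obtain ⟨b0, c0⟩ := ih u
    obtain ⟨b1, c1⟩ := ih (u + (2 ^ p : ℤ) • xhat)
    obtain ⟨b2, c2⟩ := ih (u + (2 ^ p : ℤ) • yhat)
    obtain ⟨b3, c3⟩ := ih (u + (2 ^ p : ℤ) • zhat)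
    replace b1 : ∀ v ∈ (e p (u + (2 ^ p : ℤ) • xhat)).support,
        u 0 + 2 ^ p ≤ v 0 ∧ v 0 < u 0 + 2 ^ p + 2 ^ p ∧ u 1 ≤ v 1 ∧ v 1 < u 1 + 2 ^ p ∧ u 2 ≤ v 2 ∧ v 2 < u 2 + 2 ^ p := by
      intro v h
      have h0 := b1 v h 0
      have h1 := b1 v h 1
      have h2 := b1 v h 2
      simp [xhat] at h0 h1 h2
      omega
    replace b2 : ∀ v ∈ (e p (u + (2 ^ p : ℤ) • yhat)).support,
        u 0 ≤ v 0 ∧ v 0 < u 0 + 2 ^ p ∧ u 1 + 2 ^ p ≤ v 1 ∧ v 1 < u 1 + 2 ^ p + 2 ^ p ∧ u 2 ≤ v 2 ∧ v 2 < u 2 + 2 ^ p := by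
      intro v h
      have h0 := b2 v h 0
      have h1 := b2 v h 1
      have h2 := b2 v h 2
      simp [yhat] at h0 h1 h2
      omega
    replace b3 : ∀ v ∈ (e p (u + (2 ^ p : ℤ) • zhat)).support,
        u 0 ≤ v 0 ∧ v 0 < u 0 + 2 ^ p ∧ u 1 ≤ v 1 ∧ v 1 < u 1 + 2 ^ p ∧ u 2 + 2 ^ p ≤ v 2 ∧ v 2 < u 2 + 2 ^ p + 2 ^ p := by
      intro v h
      have h0 := b3 v h 0
      have h1 := b3 v h 1
      have h2 := b3 v h 2
      simp [zhat] at h0 h1 h2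
      omega
    replace b0 : ∀ v ∈ (e p u).support,
        u 0 ≤ v 0 ∧ v 0 < u 0 + 2 ^ p ∧ u 1 ≤ v 1 ∧ v 1 < u 1 + 2 ^ p ∧ u 2 ≤ v 2 ∧ v 2 < u 2 + 2 ^ p := by
      intro v h
      have h0 := b0 v h 0
      have h1 := b0 v h 1
      have h2 := b0 v h 2
      omega
    have d1 : Disjoint (e p u).support (e p (u + (2 ^ p : ℤ) • xhat)).support := by
      rw [Finset.disjoint_left]
      intro v h h'
      have := b0 v h
      have := b1 v h'
      omega
    have d2 : Disjoint (e p u + e p (u + (2 ^ p : ℤ) • xhat)).support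
        (e p (u + (2 ^ p : ℤ) • yhat)).support := by
      rw [Finsupp.support_add_eq d1, Finset.disjoint_left]
      intro v h h'
      have := b2 v h'
      rcases Finset.mem_union.1 h with h | h
      · have := b0 v h
        omega
      · have := b1 v h
        omega
    have d3 : Disjoint (e p u + e p (u + (2 ^ p : ℤ) • xhat)
        + e p (u + (2 ^ p : ℤ) • yhat)).support
        (e p (u + (2 ^ p : ℤ) • zhat)).support := by
      rw [Finsupp.support_add_eq d2, Finsupp.support_add_eq d1, Finset.disjoint_left]
      intro v h h'
      have := b3 v h'
      rcases Finset.mem_union.1 h with h | h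
      · rcases Finset.mem_union.1 h with h | h
        · have := b0 v h
          omega
        · have := b1 v h
          omega
      · have := b2 v h
        omega
    rw [e]
    constructor
    · rw [Finsupp.support_add_eq d3, Finsupp.support_add_eq d2, Finsupp.support_add_eq d1]
      intro v h
      have key : (u 0 ≤ v 0 ∧ v 0 < u 0 + 2 ^ (p + 1)) ∧ (u 1 ≤ v 1 ∧ v 1 < u 1 + 2 ^ (p + 1)) ∧
          (u 2 ≤ v 2 ∧ v 2 < u 2 + 2 ^ (p + 1)) := by
        rw [hpow]
        rcases Finset.mem_union.1 h with h | h
        · rcases Finset.mem_union.1 h with h | h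
          · rcases Finset.mem_union.1 h with h | h
            · have := b0 v h
              omega
            · have := b1 v h
              omega
          · have := b2 v h
            omega
        · have := b3 v h
          omega
      intro i
      fin_cases i
      · exact key.1
      · exact key.2.1
      · exact key.2.2
    · rw [Finsupp.support_add_eq d3, Finset.card_union_of_disjoint d3,
        Finsupp.support_add_eq d2, Finset.card_union_of_disjoint d2,
        Finsupp.support_add_eq d1, Finset.card_union_of_disjoint d1, c0, c1, c2, c3]
      ring


end BH
end

section
/- For every u ∈ ℤ³ and every p ≥ 0, σ(e⁽ᵖ⁾_u) = s⁽ᵖ⁾_u, i.e. the fractal error e⁽ᵖ⁾_u creates from the vacuum exactly the level-p pyramid of four defects with apex u. -/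
open Finsupp

namespace BH

theorem V3_add_self (a : V3) : a + a = 0 := by
  ext i
  simpa using CharTwo.add_self_eq_zero (a i)

theorem σmap_add (f g : V3) : σmap (f + g) = σmap f + σmap g := by
  simp only [σmap, Finsupp.mapDomain_add]
  abel

/-- Sixteen terms collapse to the four diagonal ones in characteristic two. -/
theorem pyr_succ (p : ℕ) (u : Fin 3 → ℤ) :
    pyr p u + pyr p (u + (2 ^ p : ℤ) • xhat) + pyr p (u + (2 ^ p : ℤ) • yhat)
      + pyr p (u + (2 ^ p : ℤ) • zhat) = pyr (p + 1) u := by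
  simp only [pyr, pow_succ, mul_two, add_smul, ← add_assoc]
  generalize (2 ^ p : ℤ) • xhat = x
  generalize (2 ^ p : ℤ) • yhat = y
  generalize (2 ^ p : ℤ) • zhat = z
  rw [add_right_comm u y x, add_right_comm u z x, add_right_comm u z y]
  have h1 := V3_add_self (δ (u + x))
  have h2 := V3_add_self (δ (u + y))
  have h3 := V3_add_self (δ (u + z))
  have h4 := V3_add_self (δ (u + x + y))
  have h5 := V3_add_self (δ (u + x + z))
  have h6 := V3_add_self (δ (u + y + z))
  generalize δ (u + x) = a at *
  generalize δ (u + y) = b at *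
  generalize δ (u + z) = c at *
  generalize δ (u + x + y) = d at *
  generalize δ (u + x + z) = f at *
  generalize δ (u + y + z) = g at *
  grind

/-- For every `u ∈ ℤ³` and `p ≥ 0`, `σ(e⁽ᵖ⁾_u) = s⁽ᵖ⁾_u`:
the fractal error `e⁽ᵖ⁾_u` creates from the vacuum exactly the level-`p`
pyramid of four defects with apex `u`. -/
theorem fractal_syndrome_pyramid (u : Fin 3 → ℤ) (p : ℕ) :
    σmap (e p u) = pyr p u := by
  induction p generalizing u with
  | zero => simp [σmap, e, pyr, δ, Finsupp.mapDomain_single]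
  | succ p ih => rw [e, σmap_add, σmap_add, σmap_add, ih, ih, ih, ih, pyr_succ]

end BH
end

section
/- For every u ∈ ℤ³ and every p ≥ 0, the intersection of the support of e⁽ᵖ⁾_u with the plane {v ∈ ℤ³ : v₁ = u₁ + 2ᵖ − 1} is exactly the single point u + (2ᵖ−1)x̂. -/
open Finsupp

namespace BH

theorem e_high (p : ℕ) : ∀ (u v : Fin 3 → ℤ), u 0 + 2 ^ p - 1 < v 0 → e p u v = 0 := by
  induction p with
  | zero =>
    intro u v h
    simp only [e, δ]
    rw [Finsupp.single_apply, if_neg]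
    rintro rfl
    simp at h
  | succ p ih =>
    intro u v h
    have hp : (0 : ℤ) < 2 ^ p := by positivity
    rw [pow_succ] at h
    simp only [e, Finsupp.add_apply]
    rw [ih, ih, ih, ih]
    · simp
    all_goals simp [xhat, yhat, zhat]
    all_goals linarith

theorem e_plane (p : ℕ) : ∀ (u v : Fin 3 → ℤ), v 0 = u 0 + 2 ^ p - 1 →
    e p u v = if v = u + ((2 ^ p : ℤ) - 1) • xhat then 1 else 0 := by
  induction p with
  | zero =>
    intro u v h
    simp only [e, δ]
    rw [Finsupp.single_apply]
    simp [eq_comm]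
  | succ p ih =>
    intro u v h
    have hp : (0 : ℤ) < 2 ^ p := by positivity
    rw [pow_succ] at h
    simp only [e, Finsupp.add_apply]
    rw [e_high p u, e_high p (u + (2 ^ p : ℤ) • yhat), e_high p (u + (2 ^ p : ℤ) • zhat), ih]
    · have : u + (2 ^ p : ℤ) • xhat + ((2 ^ p : ℤ) - 1) • xhat
          = u + ((2 ^ (p + 1) : ℤ) - 1) • xhat := by
        rw [add_assoc, ← add_smul]
        congr 2
        ring
      rw [this]
      simp
    all_goals simp [xhat, yhat, zhat]
    all_goals linarith

/-- For every `u ∈ ℤ³` and `p ≥ 0`, the intersection of the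
support of `e⁽ᵖ⁾_u` with the plane `{v : v₁ = u₁ + 2ᵖ − 1}` is exactly the
single point `u + (2ᵖ−1)x̂`. -/
theorem fractal_support_plane (u : Fin 3 → ℤ) (p : ℕ) :
    (e p u).support.filter (fun v => v 0 = u 0 + 2 ^ p - 1)
      = {u + ((2 ^ p : ℤ) - 1) • xhat} := by
  ext v
  simp only [Finset.mem_filter, Finsupp.mem_support_iff, Finset.mem_singleton]
  constructor
  · rintro ⟨h1, h2⟩
    rw [e_plane p u v h2] at h1
    by_contra h
    exact h1 (if_neg h)
  · intro h
    have h2 : v 0 = u 0 + 2 ^ p - 1 := by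
      rw [h]
      simp [xhat]
      ring
    refine ⟨?_, h2⟩
    rw [e_plane p u v h2, if_pos h]
    exact one_ne_zero

end BH
end
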